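/- Under Assumption C, the self-affine measure satisfies the lower bound dim_H(ν) ≥ min{ 2·log N/(−log c), log N/(−log b), 1 + (log N + log b)/(−log c) }. -/

import Mathlib

open MeasureTheory Filter Set Topology
open scoped ENNReal

noncomputable section

/-- One triangular affine map `S_i(x,y) = (c x + u_i, d_i x + b y + v_i)`. -/
def Smap {N : ℕ} (c b : ℝ) (u v d : Fin N → ℝ) (i : Fin N) (p : ℝ × ℝ) : ℝ × ℝ :=
  (c * p.1 + u i, d i * p.1 + b * p.2 + v i)

/-- Composition along a finite word: `Sword [i₁,…,iₙ] = S_{i₁} ∘ ⋯ ∘ S_{iₙ}`. -/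
def Sword {N : ℕ} (c b : ℝ) (u v d : Fin N → ℝ) : List (Fin N) → (ℝ × ℝ) → ℝ × ℝ
  | [] => id
  | i :: w => Smap c b u v d i ∘ Sword c b u v d w

/-- The closed unit square `[0,1]²`. -/
def unitSq : Set (ℝ × ℝ) := Set.Icc 0 1 ×ˢ Set.Icc 0 1

/-- The length-`n` prefix of an infinite word, as a list. -/
def prefixWord {N : ℕ} (i : ℕ → Fin N) (n : ℕ) : List (Fin N) :=
  List.ofFn (fun k : Fin n => i k)

/-- The transversality condition: there is `c₃ > 0` such that for every `n` and all
`𝐢, 𝐣` with different first symbols, the projection to the `x`-axis of the intersection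
of the two level-`n` cylinder parallelograms has diameter `< c₃ bⁿ`. -/
def Transversality (N : ℕ) (c b : ℝ) (u v d : Fin N → ℝ) : Prop :=
  ∃ c₃ > (0 : ℝ), ∀ (n : ℕ) (i j : ℕ → Fin N), i 0 ≠ j 0 →
    Metric.diam (Prod.fst '' (Sword c b u v d (prefixWord i n) '' unitSq ∩
      Sword c b u v d (prefixWord j n) '' unitSq)) < c₃ * b ^ n

/-- `μ` is the uniform Bernoulli measure `(1/N,…,1/N)^ℕ` on the symbolic space. -/
def IsUniformBernoulli (N : ℕ) (μ : Measure (ℕ → Fin N)) : Prop :=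
  IsProbabilityMeasure μ ∧ ∀ (n : ℕ) (w : Fin n → Fin N),
    μ {x | ∀ k : Fin n, x (k : ℕ) = w k} = (1 / (N : ℝ≥0∞)) ^ n

/-- `m` is absolutely continuous w.r.t. Lebesgue measure with an `L^q` density. -/
def HasLqDensity (m : Measure ℝ) (q : ℝ) : Prop :=
  ∃ φ : ℝ → ℝ≥0∞, m = MeasureTheory.volume.withDensity φ ∧ (∫⁻ t, φ t ^ q) < ⊤

/-- The Hausdorff dimension of a measure: the infimum of Hausdorff dimensions
of sets of full measure. -/
def measureDimH {X : Type*} [EMetricSpace X] [MeasurableSpace X] (m : Measure X) : ℝ≥0∞ :=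
  ⨅ (A : Set X) (_ : m Aᶜ = 0), dimH A

/-- Composition of the affine maps `x ↦ λᵢ x + tᵢ` along a finite word. -/
def psiWord {N : ℕ} (lam t : Fin N → ℝ) : List (Fin N) → ℝ → ℝ
  | [] => id
  | i :: w => fun x => lam i * psiWord lam t w x + t i

/-- Hochman's exponential separation condition for the self-similar IFS `{x ↦ λᵢ x + tᵢ}`:
there are `ε > 0` and `n_k ↑ ∞` such that any two distinct words of length `n_k` whose
compositions have equal derivative have translation parts at distance `> ε^{n_k}`. -/
def HochmanESC (N : ℕ) (lam t : Fin N → ℝ) : Prop :=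
  ∃ ε > (0 : ℝ), ∃ nk : ℕ → ℕ, StrictMono nk ∧
    ∀ k, ∀ w1 w2 : Fin (nk k) → Fin N, w1 ≠ w2 →
      (∏ m, lam (w1 m)) = (∏ m, lam (w2 m)) →
        ε ^ (nk k) < |psiWord lam t (List.ofFn w1) 0 - psiWord lam t (List.ofFn w2) 0|

namespace SA
open scoped Classical

/-! ### Averages over finite types -/

/-- Average of a real function over a finite type. -/
def av {Ω : Type*} [Fintype Ω] (g : Ω → ℝ) : ℝ := (∑ ω, g ω) / (Fintype.card Ω : ℝ)

section av
variable {Ω Ω' : Type*} [Fintype Ω] [Fintype Ω']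

lemma cardpos (Ω : Type*) [Fintype Ω] [Nonempty Ω] : (0:ℝ) < (Fintype.card Ω : ℝ) := by
  exact_mod_cast Fintype.card_pos

lemma av_add (f g : Ω → ℝ) : av (fun ω => f ω + g ω) = av f + av g := by
  simp [av, Finset.sum_add_distrib, add_div]

lemma av_sub (f g : Ω → ℝ) : av (fun ω => f ω - g ω) = av f - av g := by
  simp [av, Finset.sum_sub_distrib, sub_div]

lemma av_const_mul (c : ℝ) (f : Ω → ℝ) : av (fun ω => c * f ω) = c * av f := by
  simp [av, ← Finset.mul_sum, mul_div_assoc]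

lemma av_div_const (c : ℝ) (f : Ω → ℝ) : av (fun ω => f ω / c) = av f / c := by
  simp [av, ← Finset.sum_div]; ring

lemma av_const [Nonempty Ω] (c : ℝ) : av (fun _ : Ω => c) = c := by
  have := cardpos Ω
  simp [av]

lemma av_mono {f g : Ω → ℝ} (h : ∀ ω, f ω ≤ g ω) : av f ≤ av g := by
  unfold av
  gcongr with i _
  exact h i

lemma av_nonneg {f : Ω → ℝ} (h : ∀ ω, 0 ≤ f ω) : 0 ≤ av f := by
  unfold av
  exact div_nonneg (Finset.sum_nonneg fun i _ => h i) (by positivity)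

lemma av_equiv (e : Ω ≃ Ω') (f : Ω' → ℝ) : av (fun ω => f (e ω)) = av f := by
  unfold av
  rw [Fintype.card_congr e, Equiv.sum_comp e f]

lemma av_prod (f : Ω × Ω' → ℝ) : av f = av (fun a => av (fun b => f (a, b))) := by
  unfold av
  rw [Fintype.sum_prod_type, Fintype.card_prod]
  push_cast
  rw [← Finset.sum_div, div_div, mul_comm]

lemma av_comm (f : Ω → Ω' → ℝ) : av (fun a => av (fun b => f a b)) = av (fun b => av (fun a => f a b)) := by
  unfold av
  rw [← Finset.sum_div, ← Finset.sum_div, Finset.sum_comm, div_div, div_div, mul_comm]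

lemma exists_av_le [Nonempty Ω] (f : Ω → ℝ) : ∃ ω, av f ≤ f ω := by
  by_contra h
  push Not at h
  have h1 : ∑ ω, f ω < ∑ _ω : Ω, av f :=
    Finset.sum_lt_sum_of_nonempty Finset.univ_nonempty (fun i _ => h i)
  have := cardpos Ω
  simp only [Finset.sum_const, Finset.card_univ, nsmul_eq_mul] at h1
  unfold av at h1
  rw [mul_div_cancel₀ _ this.ne'] at h1
  exact lt_irrefl _ h1

lemma av_log_le [Nonempty Ω] {g : Ω → ℝ} {c : ℝ} (hg : ∀ ω, 0 < g ω) (hc : 0 < c) (h : av g ≤ c) :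
    av (fun ω => Real.log (g ω)) ≤ Real.log c := by
  have h1 : ∀ ω, Real.log (g ω) ≤ Real.log c + (g ω / c - 1) := by
    intro ω
    have := Real.log_le_sub_one_of_pos (div_pos (hg ω) hc)
    rw [Real.log_div (hg ω).ne' hc.ne'] at this
    linarith
  calc av (fun ω => Real.log (g ω)) ≤ av (fun ω => Real.log c + (g ω / c - 1)) := av_mono h1
    _ = Real.log c + (av g / c - 1) := by
      rw [av_add, av_sub, av_div_const, av_const, av_const]
    _ ≤ Real.log c := by
      have : av g / c ≤ 1 := by rw [div_le_one hc]; exact h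
      linarith
end av

/-! ### Entropy of functions on finite uniform spaces -/

/-- Size of the fibre of `f` through `ω`. -/
def fib {Ω α : Type*} [Fintype Ω] (f : Ω → α) (ω : Ω) : ℝ :=
  ((Finset.univ.filter (fun ω' => f ω' = f ω)).card : ℝ)

/-- Shannon entropy of `f` under the uniform measure. -/
def Ent {Ω α : Type*} [Fintype Ω] (f : Ω → α) : ℝ :=
  av (fun ω => Real.log ((Fintype.card Ω : ℝ) / fib f ω))

section ent
variable {Ω Ω' : Type*} [Fintype Ω] [Fintype Ω']
variable {α β γ δ : Type*}

lemma fib_pos (f : Ω → α) (ω : Ω) : 0 < fib f ω := by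
  unfold fib
  exact_mod_cast Finset.card_pos.2 ⟨ω, by simp⟩

lemma fib_le_card (f : Ω → α) (ω : Ω) : fib f ω ≤ Fintype.card Ω := by
  unfold fib
  exact_mod_cast Finset.card_le_univ _

lemma fib_mono {f : Ω → α} {g : Ω → β} {ω : Ω} (h : ∀ ω', f ω' = f ω → g ω' = g ω) :
    fib f ω ≤ fib g ω := by
  unfold fib
  have : (Finset.univ.filter (fun ω' => f ω' = f ω)) ⊆ (Finset.univ.filter (fun ω' => g ω' = g ω)) := by
    intro x hx
    simp at hx ⊢
    exact h x hx
  exact_mod_cast Finset.card_le_card this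

lemma Ent_nonneg (f : Ω → α) : 0 ≤ Ent f := by
  apply av_nonneg
  intro ω
  apply Real.log_nonneg
  rw [le_div_iff₀ (fib_pos f ω), one_mul]
  exact fib_le_card f ω

lemma Ent_mono {f : Ω → α} {g : Ω → β} (h : ∀ ω ω', f ω = f ω' → g ω = g ω') :
    Ent g ≤ Ent f := by
  apply av_mono
  intro ω
  have : Nonempty Ω := ⟨ω⟩
  have h1 := fib_pos f ω
  have h2 := fib_pos g ω
  have h3 : fib f ω ≤ fib g ω := fib_mono (fun ω' h' => h ω' ω h')
  have := cardpos Ω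
  apply Real.log_le_log (by positivity)
  gcongr

lemma Ent_congr {f : Ω → α} {g : Ω → β} (h : ∀ ω ω', f ω = f ω' ↔ g ω = g ω') :
    Ent g = Ent f :=
  le_antisymm (Ent_mono fun a b => (h a b).1) (Ent_mono fun a b => (h a b).2)

lemma Ent_equiv (e : Ω ≃ Ω') (f : Ω' → α) : Ent (fun ω => f (e ω)) = Ent f := by
  unfold Ent
  rw [← av_equiv e]
  congr 1
  ext ω
  rw [Fintype.card_congr e]
  congr 2
  unfold fib
  congr 1
  apply Finset.card_bij (fun a _ => e a)
  · intro a ha; simpa using ha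
  · intro a _ b _ h; exact e.injective h
  · intro b hb; exact ⟨e.symm b, by simpa using hb, by simp⟩

lemma Ent_sub [Nonempty Ω] (f : Ω → α) (g : Ω → β) :
    Ent f - Ent g = av (fun ω => Real.log (fib g ω / fib f ω)) := by
  unfold Ent
  rw [← av_sub]
  congr 1
  ext ω
  have h1 := fib_pos f ω
  have h2 := fib_pos g ω
  have := cardpos Ω
  rw [Real.log_div this.ne' h1.ne', Real.log_div this.ne' h2.ne', Real.log_div h2.ne' h1.ne']
  ring

lemma sum_inv_fiber {Ω α : Type*} (S : Finset Ω) (f : Ω → α) :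
    ∑ ω ∈ S, (1:ℝ) / ((S.filter (fun ω' => f ω' = f ω)).card : ℝ) = ((S.image f).card : ℝ) := by
  rw [Finset.sum_comp (fun y => (1:ℝ) / ((S.filter (fun ω' => f ω' = y)).card : ℝ)) f]
  rw [Finset.card_eq_sum_ones]
  push_cast
  apply Finset.sum_congr rfl
  intro y hy
  obtain ⟨x, hx, rfl⟩ := Finset.mem_image.1 hy
  have : 0 < (S.filter (fun ω' => f ω' = f x)).card := Finset.card_pos.2 ⟨x, by simp [hx]⟩
  rw [nsmul_eq_mul]
  field_simp

/-- fibre-double-counting -/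
lemma sum_fib_div (f : Ω → α) (g : Ω → β) :
    ∑ ω, fib g ω / fib (fun ω => (f ω, g ω)) ω =
      ∑ ω', (((Finset.univ.filter (fun ω => g ω = g ω')).image f).card : ℝ) := by
  have h1 : ∀ ω, fib g ω / fib (fun ω => (f ω, g ω)) ω =
      ∑ ω', if g ω = g ω' then 1 / fib (fun ω => (f ω, g ω)) ω else 0 := by
    intro ω
    rw [← Finset.sum_filter, Finset.sum_const, nsmul_eq_mul]
    unfold fib
    rw [mul_one_div]
    congr 3
    ext x
    simp [eq_comm]
  simp_rw [h1]
  rw [Finset.sum_comm]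
  apply Finset.sum_congr rfl
  intro ω' _
  rw [← sum_inv_fiber, ← Finset.sum_filter]
  apply Finset.sum_congr rfl
  intro ω hω
  unfold fib
  congr 3
  ext x
  simp at hω ⊢
  rw [hω]
  tauto

lemma Ent_pair_le [Nonempty Ω] (f : Ω → α) (g : Ω → β) (k : ℕ)
    (h : ∀ ω', ((Finset.univ.filter (fun ω => g ω = g ω')).image f).card ≤ k) :
    Ent (fun ω => (f ω, g ω)) ≤ Ent g + Real.log k := by
  have hk : 0 < k := by
    obtain ⟨ω⟩ := (inferInstance : Nonempty Ω)
    exact lt_of_lt_of_le (Finset.card_pos.2 ⟨f ω, Finset.mem_image_of_mem _ (by simp)⟩) (h ω)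
  have := cardpos Ω
  suffices Ent (fun ω => (f ω, g ω)) - Ent g ≤ Real.log k by linarith
  rw [Ent_sub]
  apply av_log_le
  · intro ω; exact div_pos (fib_pos _ _) (fib_pos _ _)
  · exact_mod_cast hk
  · unfold av
    rw [sum_fib_div, div_le_iff₀ this]
    calc _ ≤ ∑ _ω' : Ω, (k:ℝ) := Finset.sum_le_sum fun ω' _ => by exact_mod_cast h ω'
      _ = _ := by simp [mul_comm]

lemma Ent_le_log_card [Nonempty Ω] (f : Ω → α) (k : ℕ) (h : (Finset.univ.image f).card ≤ k) :
    Ent f ≤ Real.log k := by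
  have h1 := Ent_pair_le f (fun _ : Ω => ()) k (by simpa using h)
  have h2 : Ent (fun _ : Ω => ()) = 0 := by
    unfold Ent fib
    have := cardpos Ω
    simp [av, this.ne']
  have h3 : Ent f ≤ Ent (fun ω => (f ω, ())) := Ent_mono (by simp)
  linarith

lemma Ent_submod [Nonempty Ω] (f : Ω → α) (g : Ω → β) (h : Ω → γ) :
    Ent (fun ω => (f ω, g ω, h ω)) + Ent h ≤ Ent (fun ω => (f ω, h ω)) + Ent (fun ω => (g ω, h ω)) := by
  have hΩ := cardpos Ω
  suffices (Ent (fun ω => (f ω, g ω, h ω)) - Ent (fun ω => (f ω, h ω))) +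
      (Ent h - Ent (fun ω => (g ω, h ω))) ≤ Real.log 1 by
    rw [Real.log_one] at this; linarith
  rw [Ent_sub, Ent_sub, ← av_add]
  have key : ∀ ω, Real.log (fib (fun ω => (f ω, h ω)) ω / fib (fun ω => (f ω, g ω, h ω)) ω) +
      Real.log (fib (fun ω => (g ω, h ω)) ω / fib h ω) =
      Real.log ((fib (fun ω => (f ω, h ω)) ω / fib (fun ω => (f ω, g ω, h ω)) ω) *
       (fib (fun ω => (g ω, h ω)) ω / fib h ω)) := by
    intro ω
    rw [Real.log_mul]
    · exact (div_pos (fib_pos _ _) (fib_pos _ _)).ne'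
    · exact (div_pos (fib_pos _ _) (fib_pos _ _)).ne'
  simp_rw [key]
  apply av_log_le
  · intro ω; exact mul_pos (div_pos (fib_pos _ _) (fib_pos _ _)) (div_pos (fib_pos _ _) (fib_pos _ _))
  · norm_num
  unfold av
  rw [div_le_one hΩ]
  -- expand fibres
  have e1 : ∀ ω, (fib (fun ω => (f ω, h ω)) ω / fib (fun ω => (f ω, g ω, h ω)) ω) *
       (fib (fun ω => (g ω, h ω)) ω / fib h ω) =
      ∑ ω', ∑ ω'', if (f ω' = f ω ∧ h ω' = h ω) ∧ (g ω'' = g ω ∧ h ω'' = h ω) then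
        1 / (fib (fun ω => (f ω, g ω, h ω)) ω * fib h ω) else 0 := by
    intro ω
    have h0 : ∀ ω' ω'', (if (f ω' = f ω ∧ h ω' = h ω) ∧ (g ω'' = g ω ∧ h ω'' = h ω) then
        1 / (fib (fun ω => (f ω, g ω, h ω)) ω * fib h ω) else 0) =
        (if (f ω' = f ω ∧ h ω' = h ω) then (1:ℝ) else 0) * ((if (g ω'' = g ω ∧ h ω'' = h ω) then (1:ℝ) else 0) *
        (1 / (fib (fun ω => (f ω, g ω, h ω)) ω * fib h ω))) := by
      intro ω' ω''
      split_ifs <;> simp_all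
    simp_rw [h0]
    rw [← Finset.sum_mul_sum, ← Finset.sum_mul]
    rw [Finset.sum_boole, Finset.sum_boole]
    have a1 : fib (fun ω => (f ω, h ω)) ω = ((Finset.univ.filter (fun x => f x = f ω ∧ h x = h ω)).card : ℝ) := by
      unfold fib; congr 3; ext x; simp
    have a2 : fib (fun ω => (g ω, h ω)) ω = ((Finset.univ.filter (fun x => g x = g ω ∧ h x = h ω)).card : ℝ) := by
      unfold fib; congr 3; ext x; simp
    rw [a1, a2]
    have := fib_pos (fun ω => (f ω, g ω, h ω)) ω
    have := fib_pos h ω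
    field_simp
  simp_rw [e1]
  rw [Finset.sum_comm]
  have e2 : ∀ ω', ∑ ω, ∑ ω'', (if (f ω' = f ω ∧ h ω' = h ω) ∧ (g ω'' = g ω ∧ h ω'' = h ω) then
        1 / (fib (fun ω => (f ω, g ω, h ω)) ω * fib h ω) else 0) ≤ 1 := by
    intro ω'
    rw [Finset.sum_comm]
    have e3 : ∀ ω'', ∑ ω, (if (f ω' = f ω ∧ h ω' = h ω) ∧ (g ω'' = g ω ∧ h ω'' = h ω) then
        1 / (fib (fun ω => (f ω, g ω, h ω)) ω * fib h ω) else 0) ≤ 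
        if h ω'' = h ω' then 1 / fib h ω' else 0 := by
      intro ω''
      split_ifs with hh
      · set S := Finset.univ.filter (fun ω => (f ω' = f ω ∧ h ω' = h ω) ∧ (g ω'' = g ω ∧ h ω'' = h ω)) with hS
        rw [← Finset.sum_filter]
        have : ∀ ω ∈ S, 1 / (fib (fun ω => (f ω, g ω, h ω)) ω * fib h ω) = 1 / ((S.card : ℝ) * fib h ω') := by
          intro ω hω
          simp [hS] at hω
          have b1 : fib h ω = fib h ω' := by unfold fib; rw [hω.1.2]
          have b2 : fib (fun ω => (f ω, g ω, h ω)) ω = S.card := by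
            unfold fib
            congr 2
            ext x
            simp [hS]
            rw [← hω.1.1, ← hω.2.1, ← hω.1.2, hh]
            constructor
            · rintro ⟨a, b, c⟩; exact ⟨⟨a.symm, c.symm⟩, b.symm, c.symm⟩
            · rintro ⟨⟨a, c⟩, b, _⟩; exact ⟨a.symm, b.symm, c.symm⟩
          rw [b1, b2]
        rw [Finset.sum_congr rfl this, Finset.sum_const, nsmul_eq_mul]
        rcases Nat.eq_zero_or_pos S.card with h0 | h0
        · rw [h0]; simp; exact (fib_pos h ω').le
        · have := fib_pos h ω'
          apply le_of_eq
          field_simp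
      · apply le_of_eq
        apply Finset.sum_eq_zero
        intro ω _
        rw [if_neg]
        rintro ⟨⟨_, a⟩, _, b⟩
        exact hh (b.trans a.symm)
    refine (Finset.sum_le_sum fun ω'' _ => e3 ω'').trans ?_
    rw [← Finset.sum_filter, Finset.sum_const, nsmul_eq_mul]
    have := fib_pos h ω'
    unfold fib at this ⊢
    rw [mul_one_div, div_self this.ne']
  refine (Finset.sum_le_sum fun ω' _ => e2 ω').trans ?_
  simp

/-- conditioning on more reduces conditional entropy -/
lemma Ent_cond_le [Nonempty Ω] (f : Ω → α) (g : Ω → β) (h : Ω → γ) :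
    Ent (fun ω => (f ω, g ω, h ω)) - Ent (fun ω => (g ω, h ω)) ≤ Ent (fun ω => (f ω, h ω)) - Ent h := by
  linarith [Ent_submod f g h]

lemma Ent_subadd [Nonempty Ω] (f : Ω → α) (g : Ω → β) :
    Ent (fun ω => (f ω, g ω)) ≤ Ent f + Ent g := by
  have h := Ent_submod f g (fun _ : Ω => ())
  have h2 : 0 ≤ Ent (fun _ : Ω => ()) := Ent_nonneg _
  have h3 : Ent (fun ω => (f ω, g ω, ())) = Ent (fun ω => (f ω, g ω)) := Ent_congr (by simp)
  have h4 : Ent (fun ω => (f ω, ())) = Ent f := Ent_congr (by simp)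
  have h5 : Ent (fun ω => (g ω, ())) = Ent g := Ent_congr (by simp)
  linarith

lemma fib_prod (f : Ω → α) (g : Ω' → β) (x : Ω × Ω') :
    fib (fun p : Ω × Ω' => (f p.1, g p.2)) x = fib f x.1 * fib g x.2 := by
  unfold fib
  rw [← Nat.cast_mul, ← Finset.card_product]
  congr 2
  ext ⟨a, b⟩
  simp

lemma Ent_indep [Nonempty Ω] [Nonempty Ω'] (f : Ω → α) (g : Ω' → β) :
    Ent (fun p : Ω × Ω' => (f p.1, g p.2)) = Ent f + Ent g := by
  unfold Ent
  have h1 := cardpos Ω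
  have h2 := cardpos Ω'
  have : ∀ p : Ω × Ω', Real.log ((Fintype.card (Ω × Ω') : ℝ) / fib (fun p : Ω × Ω' => (f p.1, g p.2)) p) =
      Real.log (Fintype.card Ω / fib f p.1) + Real.log (Fintype.card Ω' / fib g p.2) := by
    intro p
    have := fib_pos f p.1
    have := fib_pos g p.2
    rw [fib_prod, Fintype.card_prod, ← Real.log_mul (by positivity) (by positivity)]
    congr 1
    push_cast
    field_simp
  simp_rw [this]
  rw [av_prod]
  simp_rw [av_add, av_const]

lemma Ent_fst [Nonempty Ω] [Nonempty Ω'] (f : Ω → α) :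
    Ent (fun p : Ω × Ω' => f p.1) = Ent f := by
  have h := Ent_indep (Ω' := Ω') f (fun _ => ())
  have h2 : Ent (fun p : Ω × Ω' => (f p.1, ())) = Ent (fun p : Ω × Ω' => f p.1) := Ent_congr (by simp)
  have h3 : Ent (fun _ : Ω' => ()) = 0 := by
    unfold Ent fib
    have := cardpos Ω'
    simp [av, this.ne']
  linarith

lemma Ent_snd [Nonempty Ω] [Nonempty Ω'] (g : Ω' → β) :
    Ent (fun p : Ω × Ω' => g p.2) = Ent g := by
  have := Ent_equiv (Equiv.prodComm Ω Ω') (fun p : Ω' × Ω => g p.1)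
  rw [← Ent_fst (Ω := Ω') (Ω' := Ω) g, ← this]
  rfl

/-- conditional lower bound -/
lemma le_Ent_cond [Nonempty Ω] (f : Ω → α) (g : Ω → β) (c : ℝ) (hc : 0 < c)
    (h : av (fun ω => fib (fun ω => (f ω, g ω)) ω / fib g ω) ≤ c) :
    - Real.log c ≤ Ent (fun ω => (f ω, g ω)) - Ent g := by
  have := av_log_le (g := fun ω => fib (fun ω => (f ω, g ω)) ω / fib g ω) 
    (fun ω => div_pos (fib_pos _ _) (fib_pos _ _)) hc h
  have h2 := Ent_sub g (fun ω => (f ω, g ω))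
  linarith

/-- conditional entropy as average of fibre entropies -/
lemma Ent_cond_eq [Nonempty Ω] (f : Ω → α) (g : Ω → β) :
    Ent (fun ω => (f ω, g ω)) - Ent g =
      av (fun ω => Ent (fun x : {ω' // g ω' = g ω} => f x.1)) := by
  rw [Ent_sub]
  have hΩ := cardpos Ω
  have e1 : ∀ ω, Ent (fun x : {ω' // g ω' = g ω} => f x.1) = 
      ∑ ω', if g ω' = g ω then Real.log (fib g ω' / fib (fun ω => (f ω, g ω)) ω') / fib g ω' else 0 := by
    intro ω
    rw [← Finset.sum_filter]
    have hc : ((Fintype.card {ω' // g ω' = g ω} : ℕ) : ℝ) = fib g ω := by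
      unfold fib
      rw [Fintype.card_subtype]
    unfold Ent av
    rw [Finset.sum_div, hc]
    rw [← Finset.sum_subtype_eq_sum_filter (f := fun ω' => Real.log (fib g ω' / fib (fun ω => (f ω, g ω)) ω') / fib g ω')]
    have : (Finset.subtype (fun x => g x = g ω) Finset.univ) = Finset.univ := by
      ext x; simp
    rw [this]
    apply Finset.sum_congr rfl
    rintro ⟨x, hx⟩ _
    have b1 : fib g x = fib g ω := by unfold fib; rw [hx]
    have b2 : fib (fun ω => (f ω, g ω)) x = fib (fun x : {ω' // g ω' = g ω} => f x.1) ⟨x, hx⟩ := by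
      unfold fib
      congr 1
      symm
      apply Finset.card_bij (fun a _ => a.1)
      · rintro ⟨a, ha⟩ h; simp at h ⊢; exact ⟨h, ha.trans hx.symm⟩
      · intro a _ b _ h; exact Subtype.ext h
      · intro b hb
        simp at hb
        exact ⟨⟨b, hb.2.trans hx⟩, by simpa using hb.1, rfl⟩
    simp only [b1, b2]
  simp_rw [e1]
  unfold av
  congr 1
  rw [Finset.sum_comm]
  apply Finset.sum_congr rfl
  intro ω' _
  rw [← Finset.sum_filter, Finset.sum_const, nsmul_eq_mul]
  have := fib_pos g ω'
  have h2 : ((Finset.univ.filter (fun ω => g ω' = g ω)).card : ℝ) = fib g ω' := by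
    unfold fib
    congr 3
    ext x
    simp [eq_comm]
  rw [h2]
  field_simp

/-- entropy of an injective function -/
lemma Ent_inj [Nonempty Ω] (f : Ω → α) (h : Function.Injective f) : Ent f = Real.log (Fintype.card Ω) := by
  unfold Ent
  have : ∀ ω, fib f ω = 1 := by
    intro ω
    unfold fib
    have : (Finset.univ.filter (fun ω' => f ω' = f ω)) = {ω} := by
      ext x
      simp [h.eq_iff]
    rw [this]; simp
  simp_rw [this, div_one]
  rw [av_const]

lemma sum_exp_le (S : Finset ℤ) : ∑ z ∈ S, Real.exp (-|(z:ℝ)|) ≤ 4 := by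
  have h0 : ∀ z : ℤ, Real.exp (-|(z:ℝ)|) ≤ (1/2:ℝ) ^ z.natAbs := by
    intro z
    have e : |(z:ℝ)| = (z.natAbs : ℝ) := by rw [Nat.cast_natAbs]; simp
    rw [e, ← mul_one (z.natAbs : ℝ), ← mul_neg, Real.exp_nat_mul]
    apply pow_le_pow_left₀ (Real.exp_pos _).le
    rw [Real.exp_neg, one_div]
    apply inv_anti₀ (by norm_num)
    have := Real.add_one_le_exp 1
    linarith
  have hs : Summable (fun n : ℕ => (1/2:ℝ)^n) := summable_geometric_two
  have h1 : ∀ T : Finset ℤ, Set.InjOn Int.natAbs (T : Set ℤ) → ∑ z ∈ T, (1/2:ℝ) ^ z.natAbs ≤ 2 := by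
    intro T hT
    rw [← Finset.sum_image (f := fun n => (1/2:ℝ)^n) hT]
    exact (hs.sum_le_tsum _ (fun _ _ => by positivity)).trans tsum_geometric_two.le
  calc ∑ z ∈ S, Real.exp (-|(z:ℝ)|) ≤ ∑ z ∈ S, (1/2:ℝ) ^ z.natAbs := Finset.sum_le_sum fun z _ => h0 z
    _ = ∑ z ∈ S.filter (fun z => 0 ≤ z), (1/2:ℝ) ^ z.natAbs + ∑ z ∈ S.filter (fun z => ¬ 0 ≤ z), (1/2:ℝ) ^ z.natAbs :=
      (Finset.sum_filter_add_sum_filter_not _ _ _).symm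
    _ ≤ 2 + 2 := by
      apply add_le_add
      · apply h1
        intro a ha b hb hab
        simp at ha hb
        omega
      · apply h1
        intro a ha b hb hab
        simp at ha hb
        omega
    _ = 4 := by norm_num

/-- Gibbs inequality bound -/
lemma Ent_gibbs [Nonempty Ω] (Z : Ω → ℤ) : Ent Z ≤ av (fun ω => |(Z ω : ℝ)|) + Real.log 4 := by
  have hΩ := cardpos Ω
  have h := av_log_le (g := fun ω => (Fintype.card Ω : ℝ) / fib Z ω * Real.exp (-|(Z ω:ℝ)|)) (c := 4)
    (fun ω => mul_pos (div_pos hΩ (fib_pos _ _)) (Real.exp_pos _)) (by norm_num) (by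
      unfold av
      rw [div_le_iff₀ hΩ]
      have e : ∀ ω, (Fintype.card Ω : ℝ) / fib Z ω * Real.exp (-|(Z ω:ℝ)|) =
        Fintype.card Ω * (Real.exp (-|(Z ω:ℝ)|) / ((Finset.univ.filter (fun ω' => Z ω' = Z ω)).card : ℝ)) := by
        intro ω
        have : fib Z ω = ((Finset.univ.filter (fun ω' => Z ω' = Z ω)).card : ℝ) := by unfold fib; congr
        rw [this]
        ring
      simp_rw [e]
      rw [← Finset.mul_sum, mul_comm]
      gcongr
      rw [Finset.sum_comp (fun y : ℤ => Real.exp (-|(y:ℝ)|) / ((Finset.univ.filter (fun ω' => Z ω' = y)).card : ℝ)) Z]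
      refine le_trans (le_of_eq ?_) (sum_exp_le (Finset.univ.image Z))
      apply Finset.sum_congr rfl
      intro y hy
      obtain ⟨x, hx, rfl⟩ := Finset.mem_image.1 hy
      have : 0 < (Finset.univ.filter (fun ω' => Z ω' = Z x)).card := Finset.card_pos.2 ⟨x, by simp⟩
      rw [nsmul_eq_mul]
      field_simp)
  have e2 : ∀ ω, Real.log ((Fintype.card Ω : ℝ) / fib Z ω * Real.exp (-|(Z ω:ℝ)|)) =
      Real.log ((Fintype.card Ω : ℝ) / fib Z ω) - |(Z ω:ℝ)| := by
    intro ω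
    rw [Real.log_mul (div_pos hΩ (fib_pos _ _)).ne' (Real.exp_pos _).ne', Real.log_exp]; ring
  simp_rw [e2] at h
  rw [av_sub] at h
  unfold Ent
  linarith

/-- Kaimanovich-Vershik -/
lemma Ent_KV {Ω0 Ω1 Ω2 G : Type*} [Fintype Ω0] [Fintype Ω1] [Fintype Ω2] [Nonempty Ω0] [Nonempty Ω1] [Nonempty Ω2]
    [AddCommGroup G] (X : Ω0 → G) (Y : Ω1 → G) (Z : Ω2 → G) :
    Ent (fun p : Ω0 × Ω1 × Ω2 => X p.1 + Y p.2.1 + Z p.2.2) + Ent X ≤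
      Ent (fun p : Ω0 × Ω1 => X p.1 + Y p.2) + Ent (fun p : Ω0 × Ω2 => X p.1 + Z p.2) := by
  have h := Ent_submod (fun p : Ω0 × Ω1 × Ω2 => X p.1 + Y p.2.1) (fun p => Y p.2.1)
    (fun p => X p.1 + Y p.2.1 + Z p.2.2)
  have e1 : Ent (fun p : Ω0 × Ω1 × Ω2 => (X p.1 + Y p.2.1, Y p.2.1, X p.1 + Y p.2.1 + Z p.2.2)) =
      Ent X + (Ent Y + Ent Z) := by
    rw [← Ent_indep Y Z, ← Ent_indep X (fun q : Ω1 × Ω2 => (Y q.1, Z q.2))]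
    apply Ent_congr
    intro a b
    simp only [Prod.mk.injEq]
    constructor
    · rintro ⟨h1, h2, h3⟩
      rw [h1, h2, h3]; simp
    · rintro ⟨h1, h2, h3⟩
      rw [h2] at h1 h3
      have h1' := add_right_cancel h1
      rw [h1'] at h3
      exact ⟨h1', h2, add_left_cancel h3⟩
  have e2 : Ent (fun p : Ω0 × Ω1 × Ω2 => (X p.1 + Y p.2.1, X p.1 + Y p.2.1 + Z p.2.2)) =
      Ent (fun p : Ω0 × Ω1 => X p.1 + Y p.2) + Ent Z := by
    rw [← Ent_indep, ← Ent_equiv (Equiv.prodAssoc Ω0 Ω1 Ω2)]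
    apply Ent_congr
    intro a b
    simp only [Prod.mk.injEq, Equiv.prodAssoc_apply]
    constructor
    · rintro ⟨h1, h2⟩
      rw [h1, h2]; simp
    · rintro ⟨h1, h2⟩
      rw [h1] at h2
      exact ⟨h1, add_left_cancel h2⟩
  have e3 : Ent (fun p : Ω0 × Ω1 × Ω2 => (Y p.2.1, X p.1 + Y p.2.1 + Z p.2.2)) =
      Ent Y + Ent (fun p : Ω0 × Ω2 => X p.1 + Z p.2) := by
    let e : Ω0 × Ω1 × Ω2 ≃ Ω1 × Ω0 × Ω2 :=
      ⟨fun p => (p.2.1, p.1, p.2.2), fun p => (p.2.1, p.1, p.2.2), fun _ => rfl, fun _ => rfl⟩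
    rw [← Ent_indep, ← Ent_equiv e]
    apply Ent_congr
    intro a b
    simp only [Prod.mk.injEq, e, Equiv.coe_fn_mk]
    constructor
    · rintro ⟨h1, h2⟩
      refine ⟨h1, ?_⟩
      rw [add_right_comm, h2, h1, add_right_comm]
    · rintro ⟨h1, h2⟩
      refine ⟨h1, ?_⟩
      rw [add_right_comm, add_right_comm (X b.1), h1] at h2
      exact add_right_cancel h2
  rw [e1, e2, e3] at h
  linarith

lemma Ent_KV_iter {Ω0 Ω1 G : Type*} [Fintype Ω0] [Fintype Ω1] [Nonempty Ω0] [Nonempty Ω1]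
    [AddCommGroup G] (X : Ω0 → G) (Y : Ω1 → G) (k : ℕ) :
    Ent (fun p : Ω0 × (Fin k → Ω1) => X p.1 + ∑ i, Y (p.2 i)) ≤
      Ent X + k * (Ent (fun p : Ω0 × Ω1 => X p.1 + Y p.2) - Ent X) := by
  induction k with
  | zero =>
    simp only [Finset.univ_eq_empty, Finset.sum_empty, add_zero, CharP.cast_eq_zero, zero_mul]
    rw [Ent_fst]
  | succ k ih =>
    have h := Ent_KV X Y (fun w : Fin k → Ω1 => ∑ i, Y (w i))
    let e : Ω0 × Ω1 × (Fin k → Ω1) ≃ Ω0 × (Fin (k+1) → Ω1) :=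
      Equiv.prodCongr (Equiv.refl _) (Fin.consEquiv (fun _ => Ω1))
    have h2 := Ent_equiv e (fun p : Ω0 × (Fin (k+1) → Ω1) => X p.1 + ∑ i, Y (p.2 i))
    rw [← h2]
    have h3 : (fun ω => X (e ω).1 + ∑ i, Y ((e ω).2 i)) =
       fun p : Ω0 × Ω1 × (Fin k → Ω1) => X p.1 + Y p.2.1 + ∑ i, Y (p.2.2 i) := by
      ext p
      simp [e, Fin.consEquiv, Fin.sum_univ_succ, add_assoc]
    rw [h3]
    push_cast
    linarith

end ent
end SA

namespace SA
open scoped Classical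

/-! ### Entropy at a scale -/

/-- Entropy of a real random variable at scale `r`. -/
def SE {Ω : Type*} [Fintype Ω] (Z : Ω → ℝ) (r : ℝ) : ℝ := Ent (fun ω => ⌊Z ω / r⌋)

section se
variable {Ω Ω' Ω0 Ω1 : Type*} [Fintype Ω] [Fintype Ω'] [Fintype Ω0] [Fintype Ω1]
variable {α β γ : Type*}

lemma SE_nonneg (Z : Ω → ℝ) (r : ℝ) : 0 ≤ SE Z r := Ent_nonneg _

lemma floor_close {x y r : ℝ} (hr : 0 < r) (K : ℕ) (h : |x - y| ≤ K * r) :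
    |⌊x / r⌋ - ⌊y / r⌋| ≤ K + 1 := by
  have h1 : |x / r - y / r| ≤ K := by
    rw [← sub_div, abs_div, abs_of_pos hr, div_le_iff₀ hr]; exact h
  rw [abs_le] at h1 ⊢
  have a1 := Int.floor_le (x / r)
  have a2 := Int.lt_floor_add_one (x / r)
  have b1 := Int.floor_le (y / r)
  have b2 := Int.lt_floor_add_one (y / r)
  constructor
  · have : ((⌊y / r⌋ : ℤ) : ℝ) < ⌊x / r⌋ + K + 1 + 1 := by linarith
    have : ⌊y / r⌋ < ⌊x / r⌋ + K + 1 + 1 := by exact_mod_cast this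
    omega
  · have : ((⌊x / r⌋ : ℤ) : ℝ) < ⌊y / r⌋ + K + 1 + 1 := by linarith
    have : ⌊x / r⌋ < ⌊y / r⌋ + K + 1 + 1 := by exact_mod_cast this
    omega

lemma floor_eq_close {x y r : ℝ} (hr : 0 < r) (h : ⌊x / r⌋ = ⌊y / r⌋) : |x - y| ≤ r := by
  have := Int.abs_sub_lt_one_of_floor_eq_floor h
  rw [← sub_div, abs_div, abs_of_pos hr, div_lt_one hr] at this
  exact this.le

lemma SE_pair_le [Nonempty Ω] (Z : Ω → ℝ) (g : Ω → β) {r : ℝ} (hr : 0 < r) (K : ℕ)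
    (h : ∀ ω ω', g ω = g ω' → |Z ω - Z ω'| ≤ K * r) :
    Ent (fun ω => (⌊Z ω / r⌋, g ω)) ≤ Ent g + Real.log (2 * K + 3) := by
  have := Ent_pair_le (fun ω => ⌊Z ω / r⌋) g (2 * K + 3) (by
    intro ω'
    have hsub : (Finset.univ.filter (fun ω => g ω = g ω')).image (fun ω => ⌊Z ω / r⌋) ⊆
        Finset.Icc (⌊Z ω' / r⌋ - (K + 1)) (⌊Z ω' / r⌋ + (K + 1)) := by
      intro z hz
      simp only [Finset.mem_image, Finset.mem_filter, Finset.mem_univ, true_and] at hz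
      obtain ⟨ω, hω, rfl⟩ := hz
      have := floor_close hr K (h ω ω' hω)
      rw [abs_le] at this
      rw [Finset.mem_Icc]
      omega
    refine le_trans ?_ ((Finset.card_le_card hsub).trans ?_)
    · apply le_of_eq; congr; exact Subsingleton.elim _ _
    · rw [Int.card_Icc]; omega)
  push_cast at this
  exact this

lemma SE_le [Nonempty Ω] (Z : Ω → ℝ) (g : Ω → β) {r : ℝ} (hr : 0 < r) (K : ℕ)
    (h : ∀ ω ω', g ω = g ω' → |Z ω - Z ω'| ≤ K * r) :
    SE Z r ≤ Ent g + Real.log (2 * K + 3) :=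
  le_trans (Ent_mono (by intro ω ω' h; exact (Prod.mk.inj h).1)) (SE_pair_le Z g hr K h)

lemma SE_close [Nonempty Ω] (Z Z' : Ω → ℝ) {r : ℝ} (hr : 0 < r) (K : ℕ)
    (h : ∀ ω, |Z ω - Z' ω| ≤ K * r) : SE Z r ≤ SE Z' r + Real.log (4 * K + 5) := by
  have := SE_le Z (fun ω => ⌊Z' ω / r⌋) hr (2 * K + 1) (by
    intro ω ω' h'
    have h1 := floor_eq_close hr h'
    have h2 := h ω
    have h3 := h ω'
    push_cast
    rw [abs_le] at *
    constructor <;> linarith)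
  push_cast at this
  have e : (2 * (2 * (K:ℝ) + 1) + 3) = 4 * K + 5 := by ring
  rw [e] at this
  exact this

/-- fine and coarse -/
lemma SE_pair_coarse [Nonempty Ω] (Z : Ω → ℝ) {r r' : ℝ} (hr : 0 < r) (hrr : r ≤ r') :
    Ent (fun ω => (⌊Z ω / r'⌋, ⌊Z ω / r⌋)) ≤ SE Z r + Real.log 5 := by
  have := SE_pair_le Z (fun ω => ⌊Z ω / r⌋) (lt_of_lt_of_le hr hrr) 1 (by
    intro ω ω' h'
    have h1 := floor_eq_close hr h'
    push_cast; linarith)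
  norm_num at this
  exact this

lemma SE_coarse [Nonempty Ω] (Z : Ω → ℝ) {r r' : ℝ} (hr : 0 < r) (hrr : r ≤ r') :
    SE Z r' ≤ SE Z r + Real.log 5 :=
  le_trans (Ent_mono (by intro ω ω' h; exact (Prod.mk.inj h).1)) (SE_pair_coarse Z hr hrr)

lemma SE_fine [Nonempty Ω] (Z : Ω → ℝ) {r r' : ℝ} (hr : 0 < r) (hr' : 0 < r') (K : ℕ) (hrr : r' ≤ K * r) :
    SE Z r ≤ SE Z r' + Real.log (2 * K + 3) := by
  apply SE_le Z (fun ω => ⌊Z ω / r'⌋) hr K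
  intro ω ω' h'
  exact (floor_eq_close hr' h').trans hrr

lemma SE_scale_mul (Z : Ω → ℝ) {r s : ℝ} (hs : s ≠ 0) : SE (fun ω => s * Z ω) (s * r) = SE Z r := by
  unfold SE
  simp_rw [mul_div_mul_left _ _ hs]

/-- window lemma -/
lemma window [Nonempty Ω] (f : Ω → α) (g : Ω → β) (V : Ω → γ) {C : ℝ}
    (h : Ent (fun ω => (g ω, f ω)) ≤ Ent f + C) :
    (Ent (fun ω => (f ω, V ω)) - Ent V) - (Ent (fun ω => (g ω, V ω)) - Ent V) - C ≤ Ent f - Ent g := by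
  have h1 := Ent_submod f V g
  have h2 : Ent (fun ω => (f ω, g ω)) = Ent (fun ω => (g ω, f ω)) := Ent_congr (by
    intro a b; simp; tauto)
  have h3 : Ent (fun ω => (V ω, g ω)) = Ent (fun ω => (g ω, V ω)) := Ent_congr (by
    intro a b; simp; tauto)
  have h4 : Ent (fun ω => (f ω, V ω)) ≤ Ent (fun ω => (f ω, V ω, g ω)) := Ent_mono (by
    intro a b; simp; tauto)
  linarith

lemma log_nat_nonneg' (x : ℝ) (h : 1 ≤ x) : 0 ≤ Real.log x := Real.log_nonneg h

/-- real Kaimanovich-Vershik -/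
lemma SE_KV [Nonempty Ω0] [Nonempty Ω1] (X : Ω0 → ℝ) (Y : Ω1 → ℝ) {r : ℝ} (hr : 0 < r) (k : ℕ) :
    SE (fun p : Ω0 × (Fin k → Ω1) => X p.1 + ∑ i, Y (p.2 i)) r ≤
      SE X r + k * (SE (fun p : Ω0 × Ω1 => X p.1 + Y p.2) r - SE X r) + (Real.log (2 * (k + 1) + 3) + k * Real.log 7) := by
  have h := Ent_KV_iter (fun ω => ⌊X ω / r⌋) (fun ω => ⌊Y ω / r⌋) k
  have fl : ∀ x : ℝ, |x - ⌊x / r⌋ * r| ≤ r ∧ 0 ≤ x - ⌊x / r⌋ * r ∧ x - ⌊x / r⌋ * r ≤ r := by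
    intro x
    have h1 := Int.floor_le (x / r)
    have h2 := Int.lt_floor_add_one (x / r)
    rw [le_div_iff₀ hr] at h1
    rw [div_lt_iff₀ hr] at h2
    refine ⟨abs_le.2 ⟨?_, ?_⟩, ?_, ?_⟩ <;> linarith
  have h1 := SE_le (fun p : Ω0 × (Fin k → Ω1) => X p.1 + ∑ i, Y (p.2 i))
    (fun p => ⌊X p.1 / r⌋ + ∑ i, ⌊Y (p.2 i) / r⌋) hr (k + 1) (by
      intro ω ω' h
      have key : ∀ p : Ω0 × (Fin k → Ω1), 0 ≤ X p.1 + ∑ i, Y (p.2 i) - ((⌊X p.1 / r⌋ + ∑ i, ⌊Y (p.2 i) / r⌋ : ℤ) : ℝ) * r ∧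
         X p.1 + ∑ i, Y (p.2 i) - ((⌊X p.1 / r⌋ + ∑ i, ⌊Y (p.2 i) / r⌋ : ℤ) : ℝ) * r ≤ (k+1) * r := by
        intro p
        have e : X p.1 + ∑ i, Y (p.2 i) - ((⌊X p.1 / r⌋ + ∑ i, ⌊Y (p.2 i) / r⌋ : ℤ) : ℝ) * r =
          (X p.1 - ⌊X p.1 / r⌋ * r) + ∑ i, (Y (p.2 i) - ⌊Y (p.2 i) / r⌋ * r) := by
          push_cast
          rw [Finset.sum_sub_distrib, ← Finset.sum_mul]; ring
        rw [e]
        constructor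
        · have := Finset.sum_nonneg (s := Finset.univ) (fun (i : Fin k) _ => (fl (Y (p.2 i))).2.1)
          have := (fl (X p.1)).2.1
          linarith
        · have := Finset.sum_le_sum (s := Finset.univ) (fun (i : Fin k) _ => (fl (Y (p.2 i))).2.2)
          have := (fl (X p.1)).2.2
          simp at *
          linarith
      have k1 := key ω
      have k2 := key ω'
      rw [h] at k1
      push_cast
      rw [abs_le]
      constructor <;> linarith [k1.1, k1.2, k2.1, k2.2])
  have h2 : Ent (fun p : Ω0 × Ω1 => ⌊X p.1 / r⌋ + ⌊Y p.2 / r⌋) ≤ SE (fun p : Ω0 × Ω1 => X p.1 + Y p.2) r + Real.log 7 := by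
    have h3 := SE_le (fun p : Ω0 × Ω1 => ((⌊X p.1 / r⌋ + ⌊Y p.2 / r⌋ : ℤ) : ℝ))
      (fun p => ⌊(X p.1 + Y p.2) / r⌋) one_pos 2 (by
        intro ω ω' h
        push_cast
        have a1 := Int.floor_le (X ω.1 / r)
        have a2 := Int.lt_floor_add_one (X ω.1 / r)
        have b1 := Int.floor_le (Y ω.2 / r)
        have b2 := Int.lt_floor_add_one (Y ω.2 / r)
        have a1' := Int.floor_le (X ω'.1 / r)
        have a2' := Int.lt_floor_add_one (X ω'.1 / r)
        have b1' := Int.floor_le (Y ω'.2 / r)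
        have b2' := Int.lt_floor_add_one (Y ω'.2 / r)
        have c := Int.abs_sub_lt_one_of_floor_eq_floor h
        rw [add_div, add_div, abs_lt] at c
        have d1 : (((⌊X ω.1 / r⌋ + ⌊Y ω.2 / r⌋ : ℤ) : ℝ)) < ((⌊X ω'.1 / r⌋ + ⌊Y ω'.2 / r⌋ + 3 : ℤ) : ℝ) := by
          push_cast; linarith
        have d2 : (((⌊X ω'.1 / r⌋ + ⌊Y ω'.2 / r⌋ : ℤ) : ℝ)) < ((⌊X ω.1 / r⌋ + ⌊Y ω.2 / r⌋ + 3 : ℤ) : ℝ) := by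
          push_cast; linarith
        have d1' := Int.cast_lt.1 d1
        have d2' := Int.cast_lt.1 d2
        have e1 : ⌊X ω.1 / r⌋ + ⌊Y ω.2 / r⌋ ≤ ⌊X ω'.1 / r⌋ + ⌊Y ω'.2 / r⌋ + 2 := by omega
        have e2 : ⌊X ω'.1 / r⌋ + ⌊Y ω'.2 / r⌋ ≤ ⌊X ω.1 / r⌋ + ⌊Y ω.2 / r⌋ + 2 := by omega
        have e1' : (((⌊X ω.1 / r⌋ + ⌊Y ω.2 / r⌋ : ℤ) : ℝ)) ≤ ((⌊X ω'.1 / r⌋ + ⌊Y ω'.2 / r⌋ + 2 : ℤ) : ℝ) := by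
          exact_mod_cast e1
        have e2' : (((⌊X ω'.1 / r⌋ + ⌊Y ω'.2 / r⌋ : ℤ) : ℝ)) ≤ ((⌊X ω.1 / r⌋ + ⌊Y ω.2 / r⌋ + 2 : ℤ) : ℝ) := by
          exact_mod_cast e2
        push_cast at e1' e2'
        rw [abs_le]
        constructor <;> linarith)
    unfold SE at h3
    simp only [div_one, Int.floor_intCast] at h3
    norm_num at h3
    exact h3
  unfold SE at *
  push_cast at h1
  have h4 : (k:ℝ) * Ent (fun p : Ω0 × Ω1 => ⌊X p.1 / r⌋ + ⌊Y p.2 / r⌋) ≤ k * (Ent (fun p : Ω0 × Ω1 => ⌊(X p.1 + Y p.2) / r⌋) + Real.log 7) := by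
    gcongr
  linarith

end se
end SA

namespace SA
open scoped Classical

/-! ### Fourier estimate -/

/-- A positive definite kernel. -/
def Ker (x : ℝ) : ℝ := ∫ s in (0:ℝ)..1, ∫ t in (0:ℝ)..1, Real.cos (x * (s - t))

lemma Ker_nonneg (x : ℝ) : 0 ≤ Ker x := by
  have h : Ker x = (∫ s in (0:ℝ)..1, Real.cos (x * s)) * (∫ s in (0:ℝ)..1, Real.cos (x * s)) +
      (∫ s in (0:ℝ)..1, Real.sin (x * s)) * (∫ s in (0:ℝ)..1, Real.sin (x * s)) := by
    unfold Ker
    simp_rw [mul_sub, Real.cos_sub]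
    have : ∀ s : ℝ, ∫ t in (0:ℝ)..1, (Real.cos (x * s) * Real.cos (x * t) + Real.sin (x * s) * Real.sin (x * t)) =
        Real.cos (x * s) * (∫ t in (0:ℝ)..1, Real.cos (x * t)) + Real.sin (x * s) * (∫ t in (0:ℝ)..1, Real.sin (x * t)) := by
      intro s
      rw [intervalIntegral.integral_add, intervalIntegral.integral_const_mul, intervalIntegral.integral_const_mul]
      · exact Continuous.intervalIntegrable (by fun_prop) _ _
      · exact Continuous.intervalIntegrable (by fun_prop) _ _
    simp_rw [this]
    rw [intervalIntegral.integral_add, intervalIntegral.integral_mul_const, intervalIntegral.integral_mul_const]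
    · exact Continuous.intervalIntegrable (by fun_prop) _ _
    · exact Continuous.intervalIntegrable (by fun_prop) _ _
  rw [h]
  nlinarith [mul_self_nonneg (∫ s in (0:ℝ)..1, Real.cos (x * s)), mul_self_nonneg (∫ s in (0:ℝ)..1, Real.sin (x * s))]

lemma int2_mono {f g : ℝ → ℝ → ℝ} (hf : Continuous (Function.uncurry f)) (hg : Continuous (Function.uncurry g))
    (h : ∀ s ∈ Set.Icc (0:ℝ) 1, ∀ t ∈ Set.Icc (0:ℝ) 1, f s t ≤ g s t) :
    ∫ s in (0:ℝ)..1, ∫ t in (0:ℝ)..1, f s t ≤ ∫ s in (0:ℝ)..1, ∫ t in (0:ℝ)..1, g s t := by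
  apply intervalIntegral.integral_mono_on zero_le_one
  · exact (intervalIntegral.continuous_parametric_intervalIntegral_of_continuous' hf 0 1).intervalIntegrable _ _
  · exact (intervalIntegral.continuous_parametric_intervalIntegral_of_continuous' hg 0 1).intervalIntegrable _ _
  intro s hs
  apply intervalIntegral.integral_mono_on zero_le_one
  · exact Continuous.intervalIntegrable (by fun_prop) _ _
  · exact Continuous.intervalIntegrable (by fun_prop) _ _
  intro t ht
  exact h s hs t ht

lemma half_le_Ker (x : ℝ) (hx : |x| ≤ 1) : 1 / 2 ≤ Ker x := by
  have h := int2_mono (f := fun _ _ => (1/2:ℝ)) (g := fun s t => Real.cos (x * (s - t)))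
    (by fun_prop) (by fun_prop) (by
      intro s hs t ht
      have h1 : |x * (s - t)| ≤ 1 := by
        rw [abs_mul]
        have : |s - t| ≤ 1 := by rw [abs_le]; constructor <;> linarith [hs.1, hs.2, ht.1, ht.2]
        nlinarith [abs_nonneg x, abs_nonneg (s - t)]
      have h2 := Real.one_sub_sq_div_two_le_cos (x := x * (s - t))
      have h3 : (x * (s - t))^2 ≤ 1 := by
        rw [← sq_abs]; nlinarith [abs_nonneg (x * (s-t))]
      linarith)
  simp at h
  unfold Ker
  linarith

lemma cos_le_quad {x : ℝ} (hx : |x| ≤ 1) : Real.cos x ≤ 1 - x ^ 2 / 3 := by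
  have h := Real.cos_bound hx
  rw [abs_le] at h
  have h2 : |x| ^ 4 ≤ x ^ 2 := by
    have : |x|^4 = x^2 * x^2 := by rw [show (4:ℕ) = 2 * 2 from rfl, pow_mul, sq_abs]; ring
    have h3 : x^2 ≤ 1 := by rw [← sq_abs]; nlinarith [abs_nonneg x]
    nlinarith [sq_nonneg x]
  nlinarith [h.2]

lemma gauss_int {a : ℝ} (ha : 0 < a) (s : ℝ) :
    ∫ t in (0:ℝ)..1, Real.exp (-a * (s - t) ^ 2) ≤ Real.sqrt (Real.pi / a) := by
  rw [intervalIntegral.integral_of_le zero_le_one]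
  have hi : Integrable (fun t => Real.exp (-a * (s - t) ^ 2)) :=
    (integrable_exp_neg_mul_sq ha).comp_sub_left s
  calc _ ≤ ∫ t, Real.exp (-a * (s - t) ^ 2) := by
        apply setIntegral_le_integral hi
        exact Filter.Eventually.of_forall fun t => (Real.exp_pos _).le
    _ = ∫ t, Real.exp (-a * t ^ 2) := integral_sub_left_eq_self (fun t => Real.exp (-a * t ^ 2)) volume s
    _ = _ := integral_gaussian a

lemma gauss_int2 {a : ℝ} (ha : 0 < a) :
    ∫ s in (0:ℝ)..1, ∫ t in (0:ℝ)..1, Real.exp (-a * (s - t) ^ 2) ≤ Real.sqrt (Real.pi / a) := by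
  have : ∫ s in (0:ℝ)..1, ∫ t in (0:ℝ)..1, Real.exp (-a * (s - t) ^ 2) ≤ ∫ _s in (0:ℝ)..1, Real.sqrt (Real.pi / a) := by
    apply intervalIntegral.integral_mono_on zero_le_one
    · exact (intervalIntegral.continuous_parametric_intervalIntegral_of_continuous' (by fun_prop) 0 1).intervalIntegrable _ _
    · exact Continuous.intervalIntegrable (by fun_prop) _ _
    intro s _
    exact gauss_int ha s
  simpa using this

lemma sum_prod_cos {P : Type*} [Fintype P] (q d : P → ℝ) (k : ℕ) (ξ : ℝ)
    (hs : ∑ p, q p * Real.sin (d p * ξ) = 0) :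
    ∑ v : Fin k → P, (∏ i, q (v i)) * Real.cos ((∑ i, d (v i)) * ξ) = (∑ p, q p * Real.cos (d p * ξ)) ^ k := by
  have h1 : (∑ p, (q p : ℂ) * Complex.exp ((d p * ξ : ℝ) * Complex.I)) = ((∑ p, q p * Real.cos (d p * ξ) : ℝ) : ℂ) := by
    have : ∀ p, (q p : ℂ) * Complex.exp ((d p * ξ : ℝ) * Complex.I) = ((q p * Real.cos (d p * ξ) : ℝ) : ℂ) + ((q p * Real.sin (d p * ξ) : ℝ) : ℂ) * Complex.I := by
      intro p
      rw [Complex.exp_mul_I]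
      push_cast; ring
    simp_rw [this]
    rw [Finset.sum_add_distrib, ← Finset.sum_mul, ← Complex.ofReal_sum, ← Complex.ofReal_sum, hs]
    simp
  have h2 : (∑ p, (q p : ℂ) * Complex.exp ((d p * ξ : ℝ) * Complex.I)) ^ k =
      ∑ v : Fin k → P, ((∏ i, q (v i) : ℝ) : ℂ) * Complex.exp (((∑ i, d (v i)) * ξ : ℝ) * Complex.I) := by
    have h3 := Finset.prod_univ_sum (fun _ : Fin k => (Finset.univ : Finset P)) (fun _ p => (q p : ℂ) * Complex.exp ((d p * ξ : ℝ) * Complex.I))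
    rw [Finset.prod_const, Finset.card_univ, Fintype.card_fin, Fintype.piFinset_univ] at h3
    rw [h3]
    apply Finset.sum_congr rfl
    intro v _
    rw [Finset.prod_mul_distrib, ← Complex.exp_sum]
    push_cast
    rw [Finset.sum_mul, Finset.sum_mul]
  rw [h1] at h2
  have h4 := congrArg Complex.re h2
  rw [← Complex.ofReal_pow, Complex.ofReal_re, Complex.re_sum] at h4
  rw [h4]
  apply Finset.sum_congr rfl
  intro v _
  rw [Complex.re_ofReal_mul, Complex.exp_ofReal_mul_I_re]

lemma fourier {P : Type*} [Fintype P] (q d : P → ℝ) (k : ℕ) (hq : ∀ p, 0 ≤ q p) (hq1 : ∑ p, q p = 1)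
    (hd : ∀ p, q p ≠ 0 → |d p| ≤ 1) (hs : ∀ ξ, ∑ p, q p * Real.sin (d p * ξ) = 0)
    (hV : 0 < (k : ℝ) * ∑ p, q p * d p ^ 2) :
    ∑ v : Fin k → P, (∏ i, q (v i)) * (if |∑ i, d (v i)| ≤ 1 then 1 else 0) ≤
      2 * Real.sqrt (Real.pi / ((k : ℝ) * (∑ p, q p * d p ^ 2) / 3)) := by
  set V := ∑ p, q p * d p ^ 2 with hVdef
  have h1 : ∀ v : Fin k → P, (∏ i, q (v i)) * (if |∑ i, d (v i)| ≤ 1 then 1 else 0) ≤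
      2 * ((∏ i, q (v i)) * Ker (∑ i, d (v i))) := by
    intro v
    have hp : 0 ≤ ∏ i, q (v i) := Finset.prod_nonneg fun i _ => hq _
    split_ifs with h
    · have := half_le_Ker _ h
      nlinarith
    · have := Ker_nonneg (∑ i, d (v i))
      simp only [mul_zero]
      positivity
  refine (Finset.sum_le_sum fun v _ => h1 v).trans ?_
  rw [← Finset.mul_sum]
  gcongr
  have h2 : ∑ v : Fin k → P, (∏ i, q (v i)) * Ker (∑ i, d (v i)) =
      ∫ s in (0:ℝ)..1, ∫ t in (0:ℝ)..1, (∑ p, q p * Real.cos (d p * (s - t))) ^ k := by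
    unfold Ker
    simp_rw [← sum_prod_cos q d k _ (hs _)]
    simp_rw [← intervalIntegral.integral_const_mul]
    rw [← intervalIntegral.integral_finsetSum]
    · apply intervalIntegral.integral_congr
      intro s _
      simp only
      rw [← intervalIntegral.integral_finsetSum]
      intro i _
      exact Continuous.intervalIntegrable (by fun_prop) _ _
    · intro v _
      exact (intervalIntegral.continuous_parametric_intervalIntegral_of_continuous' (by fun_prop) 0 1).intervalIntegrable _ _
  rw [h2]
  refine le_trans (int2_mono (g := fun s t => Real.exp (-((k:ℝ) * V / 3) * (s - t) ^ 2)) (by fun_prop) (by fun_prop) ?_) (gauss_int2 (by positivity))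
  intro s hs' t ht
  have hst : |s - t| ≤ 1 := by rw [abs_le]; constructor <;> linarith [hs'.1, hs'.2, ht.1, ht.2]
  have hb : ∀ p, q p ≠ 0 → |d p * (s - t)| ≤ 1 := by
    intro p hp
    rw [abs_mul]
    nlinarith [hd p hp, abs_nonneg (d p), abs_nonneg (s - t)]
  have e : Real.exp (-((k:ℝ) * V / 3) * (s - t) ^ 2) = Real.exp (-(V / 3 * (s-t)^2)) ^ k := by
    rw [← Real.exp_nat_mul]; congr 1; ring
  rw [e]
  apply pow_le_pow_left₀
  · apply Finset.sum_nonneg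
    intro p _
    by_cases hp : q p = 0
    · simp [hp]
    · apply mul_nonneg (hq p)
      apply Real.cos_nonneg_of_mem_Icc
      have := abs_le.1 (hb p hp)
      have := Real.pi_gt_three
      constructor <;> linarith
  · have : ∀ p, q p * Real.cos (d p * (s - t)) ≤ q p - (q p * d p ^ 2) * ((s - t) ^ 2 / 3) := by
      intro p
      by_cases hp : q p = 0
      · simp [hp]
      · have := mul_le_mul_of_nonneg_left (cos_le_quad (hb p hp)) (hq p)
        nlinarith
    refine (Finset.sum_le_sum fun p _ => this p).trans ?_
    rw [Finset.sum_sub_distrib, hq1, ← Finset.sum_mul]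
    have := Real.add_one_le_exp (-(V / 3 * (s-t)^2))
    linarith

end SA

namespace SA
open scoped Classical

/-- fibre mean -/
def mn {Ω α : Type*} [Fintype Ω] (τ : Ω → α) (Y : Ω → ℝ) (ω : Ω) : ℝ :=
  (∑ ω', if τ ω' = τ ω then Y ω' else 0) / fib τ ω

/-- mean conditional variance -/
def Vr {Ω α : Type*} [Fintype Ω] (τ : Ω → α) (Y : Ω → ℝ) : ℝ := av (fun ω => (Y ω - mn τ Y ω) ^ 2)

section mean
variable {Ω Ω0 : Type*} [Fintype Ω] [Fintype Ω0] {α β : Type*}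

lemma fib_eq_sum (τ : Ω → α) (ω : Ω) : fib τ ω = ∑ ω', if τ ω' = τ ω then (1:ℝ) else 0 := by
  unfold fib; rw [Finset.sum_boole]

lemma fib_congr {τ : Ω → α} {ω ω' : Ω} (h : τ ω = τ ω') : fib τ ω = fib τ ω' := by
  unfold fib; rw [h]

lemma mn_congr {τ : Ω → α} (Y : Ω → ℝ) {ω ω' : Ω} (h : τ ω = τ ω') : mn τ Y ω = mn τ Y ω' := by
  unfold mn; rw [fib_congr h, h]

lemma mn_fib {τ : Ω → α} {c : Ω → ℝ} (hc : ∀ ω ω', τ ω = τ ω' → c ω = c ω') (ω : Ω) : mn τ c ω = c ω := by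
  unfold mn
  have : ∀ ω', (if τ ω' = τ ω then c ω' else 0) = c ω * (if τ ω' = τ ω then 1 else 0) := by
    intro ω'
    split_ifs with h
    · rw [hc _ _ h]; ring
    · ring
  simp_rw [this]
  rw [← Finset.mul_sum, ← fib_eq_sum, mul_div_cancel_right₀ _ (fib_pos τ ω).ne']

lemma mn_symm (τ : Ω → α) (Y c : Ω → ℝ) : av (fun ω => mn τ Y ω * c ω) = av (fun ω => Y ω * mn τ c ω) := by
  unfold av
  congr 1
  unfold mn
  simp_rw [div_mul_eq_mul_div, mul_div_assoc', Finset.sum_mul, Finset.mul_sum, Finset.sum_div]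
  rw [Finset.sum_comm]
  apply Finset.sum_congr rfl
  intro ω _
  apply Finset.sum_congr rfl
  intro ω' _
  by_cases h : τ ω = τ ω'
  · rw [if_pos h, if_pos h.symm, fib_congr h]
  · rw [if_neg h, if_neg (fun h' => h h'.symm)]; ring

lemma av_mn (τ : Ω → α) (Y : Ω → ℝ) : av (mn τ Y) = av Y := by
  have h := mn_symm τ Y (fun _ => 1)
  simp_rw [mn_fib (τ := τ) (c := fun _ => (1:ℝ)) (fun _ _ _ => rfl)] at h
  simpa using h

lemma av_D (τ : Ω → α) (Y : Ω → ℝ) : av (fun ω => Y ω - mn τ Y ω) = 0 := by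
  rw [av_sub, sub_eq_zero]; exact (av_mn τ Y).symm

lemma Vr_nonneg (τ : Ω → α) (Y : Ω → ℝ) : 0 ≤ Vr τ Y := av_nonneg fun _ => sq_nonneg _

lemma Vr_eq (τ : Ω → α) (Y : Ω → ℝ) : Vr τ Y = av (fun ω => Y ω ^ 2) - av (fun ω => Y ω * mn τ Y ω) := by
  have h := mn_symm τ Y (mn τ Y)
  simp_rw [mn_fib (τ := τ) (c := mn τ Y) (fun _ _ h => mn_congr Y h)] at h
  unfold Vr
  have : (fun ω => (Y ω - mn τ Y ω) ^ 2) = fun ω => (Y ω ^ 2 - 2 * (Y ω * mn τ Y ω)) + mn τ Y ω * mn τ Y ω := by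
    ext ω; ring
  rw [this, av_add, av_sub, av_const_mul, h]
  ring

/-- weight on pairs -/
def qw (τ : Ω → α) (p : Ω × Ω) : ℝ := (if τ p.2 = τ p.1 then 1 else 0) / fib τ p.1 / Fintype.card Ω

lemma sum_qw (τ : Ω → α) (F : Ω → Ω → ℝ) : ∑ p, qw τ p * F p.1 p.2 = av (fun ω => mn τ (F ω) ω) := by
  rw [Fintype.sum_prod_type]
  unfold av mn qw
  rw [Finset.sum_div]
  apply Finset.sum_congr rfl
  intro ω _
  rw [Finset.sum_div, Finset.sum_div]
  apply Finset.sum_congr rfl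
  intro ω' _
  simp only
  split_ifs <;> ring

lemma qw_sq (τ : Ω → α) (Y : Ω → ℝ) (ρ : ℝ) :
    ∑ p : Ω × Ω, qw τ p * ((Y p.2 - Y p.1) / ρ) ^ 2 = 2 * Vr τ Y / ρ ^ 2 := by
  rw [sum_qw τ (fun a b => ((Y b - Y a) / ρ) ^ 2)]
  have : ∀ ω, mn τ (fun b => ((Y b - Y ω) / ρ) ^ 2) ω =
      (mn τ (fun b => Y b ^ 2) ω - 2 * (Y ω * mn τ Y ω) + Y ω ^ 2) / ρ ^ 2 := by
    intro ω
    have e : Y ω ^ 2 = mn τ (fun _ => Y ω ^ 2) ω := (mn_fib (τ := τ) (c := fun _ => Y ω ^ 2) (fun _ _ _ => rfl) ω).symm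
    rw [e]
    unfold mn
    have hf := (fib_pos τ ω).ne'
    rw [mul_div_assoc', mul_div_assoc', ← sub_div, ← add_div, div_div, mul_comm (fib τ ω), ← div_div]
    congr 1
    rw [Finset.mul_sum, Finset.mul_sum, ← Finset.sum_sub_distrib, ← Finset.sum_add_distrib, Finset.sum_div]
    apply Finset.sum_congr rfl
    intro b _
    split_ifs
    · ring
    · ring
  simp_rw [this]
  rw [av_div_const, av_add, av_sub, av_const_mul, Vr_eq]
  have h2 : av (fun ω => mn τ (fun b => Y b ^ 2) ω) = av (fun ω => Y ω ^ 2) := av_mn τ _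
  rw [h2]
  ring

lemma qw_sin (τ : Ω → α) (Y : Ω → ℝ) (ρ ξ : ℝ) :
    ∑ p : Ω × Ω, qw τ p * Real.sin ((Y p.2 - Y p.1) / ρ * ξ) = 0 := by
  have h : ∑ p : Ω × Ω, qw τ p * Real.sin ((Y p.2 - Y p.1) / ρ * ξ) =
      ∑ p : Ω × Ω, -(qw τ p * Real.sin ((Y p.2 - Y p.1) / ρ * ξ)) := by
    rw [← Equiv.sum_comp (Equiv.prodComm Ω Ω)]
    apply Finset.sum_congr rfl
    intro p _
    have e : Real.sin ((Y p.1 - Y p.2) / ρ * ξ) = - Real.sin ((Y p.2 - Y p.1) / ρ * ξ) := by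
      rw [← Real.sin_neg]; congr 1; ring
    have e2 : qw τ p.swap = qw τ p := by
      unfold qw
      by_cases h : τ p.2 = τ p.1
      · simp [h, fib_congr h]
      · have h' : ¬ τ p.1 = τ p.2 := fun h' => h h'.symm
        simp [h, h']
    simp only [Equiv.prodComm_apply, e2, Prod.fst_swap, Prod.snd_swap, e]
    ring
  rw [Finset.sum_neg_distrib] at h
  linarith

lemma cond_upper [Nonempty Ω] (S M : Ω → ℝ) (g : Ω → β) (hM : ∀ ω ω', g ω = g ω' → M ω = M ω')
    {r : ℝ} (hr : 0 < r) (h : av (fun ω => (S ω - M ω) ^ 2) ≤ r ^ 2) :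
    Ent (fun ω => (⌊S ω / r⌋, g ω)) - Ent g ≤ 2 + Real.log 4 := by
  set Z : Ω → ℤ := fun ω => ⌊S ω / r⌋ - ⌊M ω / r⌋ with hZ
  have h1 : Ent (fun ω => (⌊S ω / r⌋, g ω)) = Ent (fun ω => (Z ω, g ω)) := Ent_congr (by
    intro a b
    simp only [Prod.mk.injEq, hZ]
    constructor
    · rintro ⟨h1, h2⟩
      have := hM a b h2
      rw [this] at h1
      exact ⟨by linarith, h2⟩
    · rintro ⟨h1, h2⟩
      have := hM a b h2
      rw [this, h1]
      exact ⟨rfl, h2⟩)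
  have h2 := Ent_subadd Z g
  have h3 := Ent_gibbs Z
  have h4 : av (fun ω => |(Z ω : ℝ)|) ≤ av (fun ω => 3/2 + (S ω - M ω)^2 / (2 * r^2)) := by
    apply av_mono
    intro ω
    have a1 := Int.floor_le (S ω / r)
    have a2 := Int.lt_floor_add_one (S ω / r)
    have b1 := Int.floor_le (M ω / r)
    have b2 := Int.lt_floor_add_one (M ω / r)
    have e : (S ω - M ω)^2 / (2 * r^2) = (S ω / r - M ω / r)^2 / 2 := by field_simp
    rw [e, abs_le]
    simp only [hZ]
    push_cast
    constructor
    · nlinarith [sq_nonneg (S ω / r - M ω / r + 1)]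
    · nlinarith [sq_nonneg (S ω / r - M ω / r - 1)]
  rw [av_add, av_const, av_div_const] at h4
  have h5 : av (fun ω => (S ω - M ω) ^ 2) / (2 * r^2) ≤ 1 / 2 := by
    rw [div_le_iff₀ (by positivity)]; linarith
  linarith

lemma av_sum_sq [Nonempty Ω] (D : Ω → ℝ) (hD : av D = 0) (k : ℕ) :
    av (fun w : Fin k → Ω => (∑ i, D (w i)) ^ 2) = k * av (fun ω => D ω ^ 2) := by
  induction k with
  | zero => simp [av]
  | succ k ih =>
    rw [← av_equiv (Fin.consEquiv (fun _ => Ω)), av_prod]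
    have : ∀ (a : Ω) (b : Fin k → Ω), (∑ i, D ((Fin.consEquiv (fun _ => Ω)) (a, b) i)) ^ 2 =
        (D a ^ 2 + 2 * D a * (∑ i, D (b i))) + (∑ i, D (b i)) ^ 2 := by
      intro a b
      simp only [Fin.consEquiv, Equiv.coe_fn_mk, Fin.sum_univ_succ, Fin.cons_zero, Fin.cons_succ]
      ring
    simp_rw [this, av_add, ih, av_const, av_const_mul]
    have e : ∀ a : Ω, 2 * D a * av (fun b : Fin k → Ω => ∑ i, D (b i)) = (2 * av (fun b : Fin k → Ω => ∑ i, D (b i))) * D a := by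
      intro a; ring
    simp_rw [e, av_const_mul]
    rw [hD]
    push_cast
    ring

lemma cond_lower_aux [Nonempty Ω] [Nonempty Ω0] (X : Ω0 → ℝ) (Y : Ω → ℝ) {ρ : ℝ} (hρ : 0 < ρ) (k : ℕ)
    (τ : Ω → α) (hτ : ∀ ω ω', τ ω = τ ω' → |Y ω - Y ω'| ≤ ρ)
    {Q : ℝ} (hQ : 0 < Q) (h : Q * ρ ^ 2 ≤ k * Vr τ Y) :
    Real.log Q / 2 - Real.log 5 ≤
    Ent (fun p : Ω0 × (Fin k → Ω) => (⌊(X p.1 + ∑ i, Y (p.2 i)) / ρ⌋, p.1, fun i => τ (p.2 i))) -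
      Ent (fun p : Ω0 × (Fin k → Ω) => (p.1, fun i => τ (p.2 i))) := by
  have hcΩ := cardpos Ω
  have hlog : Real.log Q / 2 - Real.log 5 = - Real.log (5 / Real.sqrt Q) := by
    rw [Real.log_div (by norm_num) (Real.sqrt_pos.2 hQ).ne', Real.log_sqrt hQ.le]; ring
  rw [hlog]
  apply le_Ent_cond
  · have := Real.sqrt_pos.2 hQ
    positivity
  have hk : ∀ v : Fin k → Ω × Ω, (∏ i, qw τ (v i)) = (∏ i, (if τ (v i).2 = τ (v i).1 then (1:ℝ) else 0)) / (∏ i, fib τ (v i).1) / (Fintype.card Ω : ℝ) ^ k := by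
    intro v
    unfold qw
    rw [Finset.prod_div_distrib, Finset.prod_div_distrib]
    simp
  let G : (Fin k → Ω) → ℝ := fun w => ∑ w' : Fin k → Ω, (∏ i, (if τ (w' i) = τ (w i) then (1:ℝ) else 0)) / (∏ i, fib τ (w i)) *
        (if |∑ i, (Y (w' i) - Y (w i)) / ρ| ≤ 1 then 1 else 0)
  -- pointwise bound
  have hpt : ∀ p : Ω0 × (Fin k → Ω), fib (fun p : Ω0 × (Fin k → Ω) => (⌊(X p.1 + ∑ i, Y (p.2 i)) / ρ⌋, p.1, fun i => τ (p.2 i))) p /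
      fib (fun p : Ω0 × (Fin k → Ω) => (p.1, fun i => τ (p.2 i))) p ≤ G p.2 := by
    intro p
    simp only [G]
    have e1 : fib (fun p : Ω0 × (Fin k → Ω) => (p.1, fun i => τ (p.2 i))) p = ∏ i, fib τ (p.2 i) := by
      have := fib_prod (fun x : Ω0 => x) (fun w : Fin k → Ω => fun i => τ (w i)) p
      rw [this]
      have e2 : fib (fun x : Ω0 => x) p.1 = 1 := by
        unfold fib
        rw [Nat.cast_eq_one, Finset.card_eq_one]
        exact ⟨p.1, by ext x; simp⟩
      rw [e2, one_mul]
      unfold fib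
      rw [← Nat.cast_prod, ← Fintype.card_piFinset]
      congr 2
      ext w
      simp only [Finset.mem_filter, Finset.mem_univ, true_and, Fintype.mem_piFinset, funext_iff]
    rw [e1]
    simp_rw [div_mul_eq_mul_div]
    rw [← Finset.sum_div]
    have hpos : 0 < ∏ i, fib τ (p.2 i) := Finset.prod_pos fun i _ => fib_pos τ _
    gcongr
    have e3 : ∀ w' : Fin k → Ω, (∏ i, (if τ (w' i) = τ (p.2 i) then (1:ℝ) else 0)) *
        (if |∑ i, (Y (w' i) - Y (p.2 i)) / ρ| ≤ 1 then 1 else 0) =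
        if (∀ i, τ (w' i) = τ (p.2 i)) ∧ |∑ i, (Y (w' i) - Y (p.2 i)) / ρ| ≤ 1 then 1 else 0 := by
      intro w'
      rw [Finset.prod_boole]
      simp only [Finset.mem_univ, true_implies]
      split_ifs <;> simp_all
    simp_rw [e3]
    rw [Finset.sum_boole]
    unfold fib
    rw [Nat.cast_le]
    apply Finset.card_le_card_of_injOn (fun p' => p'.2)
    · intro p' hp'
      simp only [Finset.coe_filter, Finset.mem_univ, true_and, Set.mem_ofPred_eq, Prod.mk.injEq, funext_iff] at hp' ⊢
      refine ⟨hp'.2.2, ?_⟩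
      have := Int.abs_sub_lt_one_of_floor_eq_floor hp'.1
      rw [hp'.2.1] at this
      have e4 : ∑ i, (Y (p'.2 i) - Y (p.2 i)) / ρ = (X p.1 + ∑ i, Y (p'.2 i)) / ρ - (X p.1 + ∑ i, Y (p.2 i)) / ρ := by
        rw [← Finset.sum_div, Finset.sum_sub_distrib]; ring
      rw [e4]
      exact this.le
    · intro a ha b hb hab
      simp only [Finset.coe_filter, Finset.mem_univ, true_and, Set.mem_ofPred_eq, Prod.mk.injEq] at ha hb
      exact Prod.ext (ha.2.1.trans hb.2.1.symm) hab
  refine (av_mono hpt).trans ?_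
  rw [av_prod]
  simp only
  rw [av_const]
  have hF := fourier (qw τ) (fun p : Ω × Ω => (Y p.2 - Y p.1) / ρ) k
    (by intro p
        unfold qw
        have := fib_pos τ p.1
        split_ifs <;> positivity)
    (by have := sum_qw τ (fun _ _ => (1:ℝ))
        simp only [mul_one] at this
        rw [this]
        simp_rw [mn_fib (τ := τ) (c := fun _ => (1:ℝ)) (fun _ _ _ => rfl)]
        exact av_const 1)
    (by intro p hp
        have : τ p.2 = τ p.1 := by
          by_contra h
          apply hp
          unfold qw; simp [h]
        have := hτ _ _ this
        rw [abs_div, abs_of_pos hρ, div_le_one hρ]; exact this)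
    (fun ξ => qw_sin τ Y ρ ξ)
    (by rw [qw_sq]
        have : 0 < Q * ρ^2 := by positivity
        have : 0 < k * Vr τ Y := by linarith
        have e : (k:ℝ) * (2 * Vr τ Y / ρ^2) = 2 * (k * Vr τ Y) / ρ^2 := by ring
        rw [e]; positivity)
  rw [qw_sq] at hF
  have hfin : 2 * Real.sqrt (Real.pi / ((k : ℝ) * (2 * Vr τ Y / ρ ^ 2) / 3)) ≤ 5 / Real.sqrt Q := by
    have h1 : Q ≤ k * Vr τ Y / ρ^2 := by rw [le_div_iff₀ (by positivity)]; exact h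
    have h2 : Real.pi / ((k : ℝ) * (2 * Vr τ Y / ρ ^ 2) / 3) ≤ (25/4) / Q := by
      have e : (k : ℝ) * (2 * Vr τ Y / ρ ^ 2) / 3 = 2 / 3 * (k * Vr τ Y / ρ^2) := by ring
      rw [e, div_le_div_iff₀ (by linarith) hQ]
      nlinarith [Real.pi_lt_d2]
    calc 2 * Real.sqrt (Real.pi / ((k : ℝ) * (2 * Vr τ Y / ρ ^ 2) / 3)) ≤ 2 * Real.sqrt ((25/4) / Q) := by gcongr
      _ = 2 * (Real.sqrt (25/4) / Real.sqrt Q) := by rw [Real.sqrt_div (by norm_num)]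
      _ = 5 / Real.sqrt Q := by
        have : Real.sqrt (25/4) = 5/2 := by
          rw [show (25/4:ℝ) = (5/2)^2 by norm_num, Real.sqrt_sq (by norm_num)]
        rw [this]; ring
  refine le_trans (le_of_eq ?_) (hF.trans hfin)
  rw [← Equiv.sum_comp (Equiv.arrowProdEquivProdArrow (Fin k) (fun _ => Ω) (fun _ => Ω)).symm, Fintype.sum_prod_type]
  unfold av
  rw [Finset.sum_div]
  apply Finset.sum_congr rfl
  intro w _
  rw [Finset.sum_div]
  apply Finset.sum_congr rfl
  intro w' _
  rw [hk]
  simp only [Equiv.arrowProdEquivProdArrow, Equiv.coe_fn_symm_mk, Fintype.card_pi, Finset.prod_const, Finset.card_univ, Fintype.card_fin, Nat.cast_pow]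
  have hring : ∀ A B C D : ℝ, A / B * D / C = A / B / C * D := by intros; ring
  exact hring _ _ _ _

/-- lower bound for conditional entropy of many-fold convolution -/
lemma cond_lower [Nonempty Ω] [Nonempty Ω0] (X : Ω0 → ℝ) (Y : Ω → ℝ) {ρ : ℝ} (hρ : 0 < ρ) (k : ℕ)
    {Q : ℝ} (hQ : 0 < Q) (h : Q * ρ ^ 2 ≤ k * Vr (fun ω => ⌊Y ω / ρ⌋) Y) :
    Real.log Q / 2 - Real.log 5 ≤
    Ent (fun p : Ω0 × (Fin k → Ω) => (⌊(X p.1 + ∑ i, Y (p.2 i)) / ρ⌋, p.1, fun i => ⌊Y (p.2 i) / ρ⌋)) -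
      Ent (fun p : Ω0 × (Fin k → Ω) => (p.1, fun i => ⌊Y (p.2 i) / ρ⌋)) :=
  cond_lower_aux X Y hρ k (fun ω => ⌊Y ω / ρ⌋) (fun _ _ h => floor_eq_close hρ h) hQ h

/-- upper bound at coarse scale -/
lemma conv_upper [Nonempty Ω] [Nonempty Ω0] (X : Ω0 → ℝ) (Y : Ω → ℝ) {ρ R : ℝ} (hρ : 0 < ρ) (hR : 0 < R) (k : ℕ)
    (h : k * ρ ^ 2 ≤ R ^ 2) :
    Ent (fun p : Ω0 × (Fin k → Ω) => (⌊(X p.1 + ∑ i, Y (p.2 i)) / R⌋, p.1, fun i => ⌊Y (p.2 i) / ρ⌋)) -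
      Ent (fun p : Ω0 × (Fin k → Ω) => (p.1, fun i => ⌊Y (p.2 i) / ρ⌋)) ≤ 2 + Real.log 4 := by
  set τ : Ω → ℤ := fun ω => ⌊Y ω / ρ⌋ with hτ
  apply cond_upper (fun p : Ω0 × (Fin k → Ω) => X p.1 + ∑ i, Y (p.2 i))
    (fun p : Ω0 × (Fin k → Ω) => X p.1 + ∑ i, mn τ Y (p.2 i)) _ _ hR
  · have e : ∀ p : Ω0 × (Fin k → Ω), (X p.1 + ∑ i, Y (p.2 i) - (X p.1 + ∑ i, mn τ Y (p.2 i))) ^ 2 =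
      (∑ i, (Y (p.2 i) - mn τ Y (p.2 i))) ^ 2 := by
      intro p; rw [Finset.sum_sub_distrib]; ring
    simp_rw [e]
    rw [av_prod]
    simp only
    rw [av_const, av_sum_sq (fun ω => Y ω - mn τ Y ω) (av_D τ Y)]
    refine le_trans ?_ h
    gcongr
    calc av (fun ω => (Y ω - mn τ Y ω)^2) ≤ av (fun _ : Ω => ρ^2) := by
          apply av_mono
          intro ω
          apply sq_le_sq'
          all_goals
            have hf := fib_pos τ ω
            have key : |Y ω - mn τ Y ω| ≤ ρ := by
              have e : Y ω - mn τ Y ω = (∑ ω', if τ ω' = τ ω then (Y ω - Y ω') else 0) / fib τ ω := by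
                have e0 : Y ω = Y ω * fib τ ω / fib τ ω := by field_simp
                unfold mn
                conv_lhs => lhs; rw [e0]
                rw [fib_eq_sum τ ω, ← sub_div, Finset.mul_sum, ← Finset.sum_sub_distrib]
                congr 1
                apply Finset.sum_congr rfl
                intro ω' _
                split_ifs <;> ring
              rw [e, abs_div, abs_of_pos hf, div_le_iff₀ hf, fib_eq_sum, Finset.mul_sum]
              refine (Finset.abs_sum_le_sum_abs _ _).trans (Finset.sum_le_sum ?_)
              intro ω' _
              split_ifs with h
              · rw [mul_one]; exact floor_eq_close hρ h.symm
              · simp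
            have := abs_le.1 key
            linarith
      _ = ρ^2 := av_const _
  · intro a b hab
    simp only [Prod.mk.injEq, funext_iff] at hab
    rw [hab.1]
    congr 1
    apply Finset.sum_congr rfl
    intro i _
    exact mn_congr Y (hab.2 i)

/-- small conditional variance implies small conditional entropy -/
lemma small_var [Nonempty Ω] (Y : Ω → ℝ) {ρ r : ℝ} (hr : 0 < r) (h : Vr (fun ω => ⌊Y ω / ρ⌋) Y ≤ r ^ 2) :
    Ent (fun ω => (⌊Y ω / r⌋, ⌊Y ω / ρ⌋)) - SE Y ρ ≤ 2 + Real.log 4 :=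
  cond_upper Y (mn (fun ω => ⌊Y ω / ρ⌋) Y) _ (fun _ _ h => mn_congr Y h) hr h

end mean
end SA

namespace SA
open scoped Classical

/-! ### Self-similar sums -/

/-- the partial sums -/
def XX {N : ℕ} (lam : ℝ) (t : Fin N → ℝ) (n : ℕ) (w : Fin n → Fin N) : ℝ := ∑ j : Fin n, lam ^ (j : ℕ) * t (w j)

/-- entropy of partial sums at natural scale -/
def EE {N : ℕ} (lam : ℝ) (t : Fin N → ℝ) (n : ℕ) : ℝ := SE (XX lam t n) (lam ^ n)

section gen
variable {Ω0 Ω1 : Type*} [Fintype Ω0] [Fintype Ω1] [Nonempty Ω0] [Nonempty Ω1]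

lemma Ent_le_card {Ω α : Type*} [Fintype Ω] [Nonempty Ω] (f : Ω → α) : Ent f ≤ Real.log (Fintype.card Ω) := by
  apply Ent_le_log_card f (Fintype.card Ω)
  exact Finset.card_image_le

lemma Ent_id_fst_pair {α : Type*} (f : Ω1 → α) :
    Ent (fun p : Ω0 × Ω1 => (f p.2, p.1)) - Ent (fun p : Ω0 × Ω1 => p.1) = Ent f := by
  have h1 := Ent_indep (fun x : Ω0 => x) f
  have h2 : Ent (fun p : Ω0 × Ω1 => (f p.2, p.1)) = Ent (fun p : Ω0 × Ω1 => (p.1, f p.2)) := Ent_congr (by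
    intro a b; simp; tauto)
  have h3 := Ent_fst (Ω' := Ω1) (fun x : Ω0 => x)
  linarith

lemma cond_indep_lower (A : Ω0 → ℝ) (B : Ω1 → ℝ) {r : ℝ} (hr : 0 < r) :
    SE B r - Real.log 5 ≤ Ent (fun p : Ω0 × Ω1 => (⌊(A p.1 + B p.2) / r⌋, p.1)) - Ent (fun p : Ω0 × Ω1 => p.1) := by
  have h1 := SE_pair_le (fun p : Ω0 × Ω1 => B p.2) (fun p : Ω0 × Ω1 => (⌊(A p.1 + B p.2) / r⌋, p.1)) hr 1 (by
    intro a b hab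
    simp only [Prod.mk.injEq] at hab
    have := floor_eq_close hr hab.1
    rw [hab.2] at this
    push_cast
    convert this using 2
    · ring
    · ring)
  have h2 : Ent (fun p : Ω0 × Ω1 => (⌊B p.2 / r⌋, p.1)) ≤
    Ent (fun p : Ω0 × Ω1 => (⌊B p.2 / r⌋, (⌊(A p.1 + B p.2) / r⌋, p.1))) := Ent_mono (by
      intro a b h; simp at h ⊢; tauto)
  have h3 := Ent_id_fst_pair (Ω0 := Ω0) (fun x : Ω1 => ⌊B x / r⌋)
  norm_num at h1
  unfold SE
  linarith

lemma cond_indep_upper (A : Ω0 → ℝ) (B : Ω1 → ℝ) {r : ℝ} (hr : 0 < r) (K : ℕ) (hB : ∀ x y, |B x - B y| ≤ K * r) :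
    Ent (fun p : Ω0 × Ω1 => (⌊(A p.1 + B p.2) / r⌋, p.1)) - Ent (fun p : Ω0 × Ω1 => p.1) ≤ Real.log (2 * K + 3) := by
  have h1 := SE_pair_le (fun p : Ω0 × Ω1 => A p.1 + B p.2) (fun p : Ω0 × Ω1 => p.1) hr K (by
    intro a b hab
    rw [hab]
    convert hB a.2 b.2 using 2
    ring)
  linarith

lemma window_indep (A : Ω0 → ℝ) (B : Ω1 → ℝ) {r R : ℝ} (hr : 0 < r) (hrR : r ≤ R) (K : ℕ)
    (hB : ∀ x y, |B x - B y| ≤ K * R) :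
    SE B r - Real.log 5 - Real.log (2 * K + 3) - Real.log 5 ≤
      SE (fun p : Ω0 × Ω1 => A p.1 + B p.2) r - SE (fun p : Ω0 × Ω1 => A p.1 + B p.2) R := by
  have h1 := window (fun p : Ω0 × Ω1 => ⌊(A p.1 + B p.2) / r⌋) (fun p : Ω0 × Ω1 => ⌊(A p.1 + B p.2) / R⌋)
    (fun p => p.1) (SE_pair_coarse (fun p : Ω0 × Ω1 => A p.1 + B p.2) hr hrR)
  have h2 := cond_indep_lower A B hr
  have h3 := cond_indep_upper A B (lt_of_lt_of_le hr hrR) K hB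
  unfold SE at *
  linarith
end gen

section hoch
variable {N : ℕ} {lam : ℝ} {t : Fin N → ℝ}

lemma psiWord_eq (lam : ℝ) (t : Fin N → ℝ) (n : ℕ) (w : Fin n → Fin N) :
    psiWord (fun _ => lam) t (List.ofFn w) 0 = XX lam t n w := by
  induction n with
  | zero => simp [psiWord, XX]
  | succ n ih =>
    rw [List.ofFn_succ]
    simp only [psiWord]
    rw [ih]
    unfold XX
    rw [Fin.sum_univ_succ, Finset.mul_sum]
    simp only [Fin.val_zero, pow_zero, one_mul, Fin.val_succ]
    rw [add_comm]
    congr 1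
    apply Finset.sum_congr rfl
    intro i _
    ring

lemma XX_append (lam : ℝ) (t : Fin N → ℝ) (n m : ℕ) (w : Fin n → Fin N) (w' : Fin m → Fin N) :
    XX lam t (n + m) (Fin.append w w') = XX lam t n w + lam ^ n * XX lam t m w' := by
  unfold XX
  rw [Fin.sum_univ_add, Finset.mul_sum]
  congr 1
  · apply Finset.sum_congr rfl
    intro i _
    simp
  · apply Finset.sum_congr rfl
    intro i _
    simp [pow_add, mul_assoc]

lemma XX_bdd (h0 : 0 < lam) (h1 : lam < 1) (t : Fin N → ℝ) : ∃ D : ℕ, ∀ n w, |XX lam t n w| ≤ D := by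
  obtain ⟨D, hD⟩ := exists_nat_ge ((∑ i, |t i|) * (1 - lam)⁻¹)
  refine ⟨D, fun n w => le_trans ?_ hD⟩
  unfold XX
  refine (Finset.abs_sum_le_sum_abs _ _).trans ?_
  have : ∀ j : Fin n, |lam ^ (j:ℕ) * t (w j)| ≤ (∑ i, |t i|) * lam ^ (j:ℕ) := by
    intro j
    rw [abs_mul, abs_of_pos (pow_pos h0 _), mul_comm]
    gcongr
    exact Finset.single_le_sum (f := fun i => |t i|) (fun i _ => abs_nonneg _) (Finset.mem_univ _)
  refine (Finset.sum_le_sum fun j _ => this j).trans ?_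
  rw [← Finset.mul_sum]
  have h2 : 0 ≤ ∑ i, |t i| := Finset.sum_nonneg fun i _ => abs_nonneg _
  gcongr
  rw [Fin.sum_univ_eq_sum_range (fun j => lam ^ j), ← tsum_geometric_of_lt_one h0.le h1]
  exact (summable_geometric_of_lt_one h0.le h1).sum_le_tsum _ (fun _ _ => by positivity)

/-- split a word -/
def spl (N n m : ℕ) : (Fin n → Fin N) × (Fin m → Fin N) ≃ (Fin (n + m) → Fin N) := Fin.appendEquiv n m

lemma SE_XX_split (lam : ℝ) (t : Fin N → ℝ) (n m : ℕ) (r : ℝ) :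
    SE (XX lam t (n + m)) r = SE (fun p : (Fin n → Fin N) × (Fin m → Fin N) => XX lam t n p.1 + lam ^ n * XX lam t m p.2) r := by
  unfold SE
  rw [← Ent_equiv (spl N n m)]
  congr 1
  ext p
  have := XX_append lam t n m p.1 p.2
  simp only
  rw [← this]
  rfl

lemma lamX_diff {D : ℕ} (h0 : 0 < lam) (hD : ∀ n w, |XX lam t n w| ≤ D) (n m : ℕ) (x y : Fin m → Fin N) :
    |lam ^ n * XX lam t m x - lam ^ n * XX lam t m y| ≤ ((2 * D : ℕ) : ℝ) * lam ^ n := by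
  rw [← mul_sub, abs_mul, abs_of_pos (pow_pos h0 _), mul_comm]
  gcongr
  have := abs_sub (XX lam t m x) (XX lam t m y)
  have := hD m x
  have := hD m y
  push_cast
  linarith

variable [NeZero N]

lemma EE_le_SE_long {D : ℕ} (h0 : 0 < lam) (hD : ∀ n w, |XX lam t n w| ≤ D) (n m : ℕ) :
    EE lam t n ≤ SE (XX lam t (n + m)) (lam ^ n) + Real.log (4 * D + 5) := by
  rw [SE_XX_split]
  have h1 := SE_close (fun p : (Fin n → Fin N) × (Fin m → Fin N) => XX lam t n p.1)
    (fun p => XX lam t n p.1 + lam ^ n * XX lam t m p.2) (pow_pos h0 n) D (by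
      intro p
      rw [sub_add_cancel_left, abs_neg, abs_mul, abs_of_pos (pow_pos h0 _), mul_comm]
      gcongr
      exact hD _ _)
  refine le_trans (le_of_eq ?_) h1
  exact (Ent_fst _).symm

lemma EE_superadd {D : ℕ} (h0 : 0 < lam) (h1 : lam < 1) (hD : ∀ n w, |XX lam t n w| ≤ D) (n m : ℕ) :
    EE lam t n + EE lam t m - (2 * Real.log 5 + Real.log (2 * (2 * D : ℕ) + 3) + Real.log (4 * D + 5)) ≤ EE lam t (n + m) := by
  have hw := window_indep (XX lam t n) (fun w : Fin m → Fin N => lam ^ n * XX lam t m w) (r := lam ^ (n + m)) (R := lam ^ n)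
    (pow_pos h0 _) (pow_le_pow_of_le_one h0.le h1.le (by omega)) (2 * D) (lamX_diff h0 hD n m)
  have h2 := EE_le_SE_long h0 hD n m
  rw [SE_XX_split] at h2
  have h3 : SE (fun w : Fin m → Fin N => lam ^ n * XX lam t m w) (lam ^ (n + m)) = EE lam t m := by
    rw [pow_add, SE_scale_mul _ (pow_pos h0 _).ne']; rfl
  rw [h3] at hw
  unfold EE at *
  rw [SE_XX_split lam t n m (lam ^ (n + m))]
  linarith

lemma EE_le (n : ℕ) : EE lam t n ≤ n * Real.log N := by
  have h := Ent_le_card (fun w : Fin n → Fin N => ⌊XX lam t n w / lam ^ n⌋)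
  rw [Fintype.card_fun, Fintype.card_fin, Fintype.card_fin] at h
  push_cast at h
  rwa [Real.log_pow] at h

lemma exists_A (h0 : 0 < lam) (h1 : lam < 1) (t : Fin N → ℝ) :
    ∃ A C : ℝ, 0 ≤ C ∧ (∀ n, EE lam t n ≤ A * n + C) ∧ ∀ ε > 0, ∃ n0 : ℕ, ∀ n ≥ n0, (A - ε) * n ≤ EE lam t n := by
  obtain ⟨D, hD⟩ := XX_bdd h0 h1 t
  set C := (2 * Real.log 5 + Real.log (2 * (2 * D : ℕ) + 3) + Real.log (4 * D + 5)) with hC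
  have hC0 : 0 ≤ C := by
    have a1 : 0 ≤ Real.log 5 := Real.log_nonneg (by norm_num)
    have a2 : 0 ≤ Real.log (2 * (2 * D : ℕ) + 3) := Real.log_nonneg (by
      have : (0:ℝ) ≤ (2 * D : ℕ) := by positivity
      linarith)
    have a3 : 0 ≤ Real.log (4 * D + 5) := Real.log_nonneg (by
      have : (0:ℝ) ≤ D := by positivity
      linarith)
    linarith
  have hsub : Subadditive (fun n => C - EE lam t n) := by
    intro n m
    have := EE_superadd h0 h1 hD n m
    simp only
    linarith
  have hlogN : 0 ≤ Real.log N := Real.log_natCast_nonneg N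
  have hbdd : BddBelow (range fun n : ℕ => (C - EE lam t n) / n) := by
    refine ⟨-Real.log N, ?_⟩
    rintro _ ⟨n, rfl⟩
    simp only
    rcases Nat.eq_zero_or_pos n with rfl | hn
    · simp [hlogN]
    · have : (0:ℝ) < n := by exact_mod_cast hn
      rw [le_div_iff₀ this]
      have := EE_le (lam := lam) (t := t) n
      linarith
  refine ⟨-hsub.lim, C, hC0, ?_, ?_⟩
  · intro n
    rcases Nat.eq_zero_or_pos n with rfl | hn
    · have := EE_le (lam := lam) (t := t) 0
      simp at this ⊢
      linarith
    · have h2 := hsub.lim_le_div hbdd hn.ne'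
      have : (0:ℝ) < n := by exact_mod_cast hn
      rw [le_div_iff₀ this] at h2
      linarith
  · intro ε hε
    have h2 := (hsub.tendsto_lim hbdd).eventually (gt_mem_nhds (show hsub.lim < hsub.lim + ε by linarith))
    obtain ⟨n0, hn0⟩ := eventually_atTop.1 h2
    refine ⟨n0 + 1, fun n hn => ?_⟩
    have h3 := hn0 n (by omega)
    have : (0:ℝ) < n := by exact_mod_cast (by omega : 0 < n)
    rw [div_lt_iff₀ this] at h3
    linarith

end hoch
end SA

namespace SA
open scoped Classical

lemma sum_window (h : ℕ → ℝ) (K T : ℕ) (hKT : K ≤ T) (M : ℝ) (h0 : ∀ t, 0 ≤ h t) (hM : ∀ t < T, h t ≤ M) :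
    ∑ t ∈ Finset.Ico K T, (h t - h (t - K)) ≤ K * M := by
  rw [Finset.sum_sub_distrib]
  have e1 : ∑ t ∈ Finset.Ico K T, h (t - K) = ∑ t ∈ Finset.range (T - K), h t := by
    rw [Finset.sum_Ico_eq_sum_range]
    apply Finset.sum_congr rfl
    intro i _
    congr 1; omega
  have e2 : ∑ t ∈ Finset.Ico K T, h t ≤ ∑ t ∈ Finset.range T, h t := by
    apply Finset.sum_le_sum_of_subset_of_nonneg
    · intro x; simp
    · intro i _ _; exact h0 i
  have e3 : ∑ t ∈ Finset.range T, h t = ∑ t ∈ Finset.range (T - K), h t + ∑ t ∈ Finset.Ico (T - K) T, h t :=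
    (Finset.sum_range_add_sum_Ico _ (by omega)).symm
  have e4 : ∑ t ∈ Finset.Ico (T - K) T, h t ≤ ∑ _t ∈ Finset.Ico (T - K) T, M := by
    apply Finset.sum_le_sum
    intro i hi
    exact hM i (Finset.mem_Ico.1 hi).2
  have e5 : ∑ _t ∈ Finset.Ico (T - K) T, M = K * M := by
    rw [Finset.sum_const, Nat.card_Ico, nsmul_eq_mul, Nat.sub_sub_self hKT]
  linarith

section hoch
variable {N : ℕ} {lam : ℝ} {t : Fin N → ℝ} [NeZero N]

lemma win_a {D : ℕ} (h0 : 0 < lam) (h1 : lam < 1) (hD : ∀ n w, |XX lam t n w| ≤ D) {Ω1 : Type*} [Fintype Ω1] [Nonempty Ω1]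
    (W : Ω1 → ℝ) (L n a : ℕ) (hL : n + a ≤ L) :
    EE lam t a - (Real.log (4 * D + 5) + 2 * Real.log 5 + Real.log (2 * (2 * D : ℕ) + 3)) ≤
    SE (fun p : (Fin L → Fin N) × Ω1 => XX lam t L p.1 + W p.2) (lam ^ (n + a)) -
      SE (fun p : (Fin L → Fin N) × Ω1 => XX lam t L p.1 + W p.2) (lam ^ n) := by
  obtain ⟨m, rfl⟩ : ∃ m, L = n + (a + m) := ⟨L - (n + a), by omega⟩
  let e : ((Fin n → Fin N) × Ω1) × (Fin (a + m) → Fin N) ≃ (Fin (n + (a + m)) → Fin N) × Ω1 :=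
    (⟨fun p => ((p.1.1, p.2), p.1.2), fun p => ((p.1.1, p.2), p.1.2), fun _ => rfl, fun _ => rfl⟩ :
      ((Fin n → Fin N) × Ω1) × (Fin (a + m) → Fin N) ≃ ((Fin n → Fin N) × (Fin (a + m) → Fin N)) × Ω1).trans
      (Equiv.prodCongr (spl N n (a + m)) (Equiv.refl _))
  have key : ∀ r, SE (fun p : (Fin (n + (a + m)) → Fin N) × Ω1 => XX lam t (n + (a + m)) p.1 + W p.2) r =
      SE (fun p : ((Fin n → Fin N) × Ω1) × (Fin (a + m) → Fin N) => (XX lam t n p.1.1 + W p.1.2) + lam ^ n * XX lam t (a + m) p.2) r := by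
    intro r
    unfold SE
    rw [← Ent_equiv e]
    congr 1
    ext p
    have := XX_append lam t n (a + m) p.1.1 p.2
    have e2 : XX lam t (n + (a + m)) (e p).1 + W (e p).2 = XX lam t n p.1.1 + W p.1.2 + lam ^ n * XX lam t (a + m) p.2 := by
      have : XX lam t (n + (a + m)) (e p).1 = XX lam t n p.1.1 + lam ^ n * XX lam t (a + m) p.2 := by
        rw [← this]; rfl
      rw [this]
      have : W (e p).2 = W p.1.2 := rfl
      rw [this]; ring
    simp only [e2]
  rw [key, key]
  have hw := window_indep (fun q : (Fin n → Fin N) × Ω1 => XX lam t n q.1 + W q.2)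
    (fun w : Fin (a + m) → Fin N => lam ^ n * XX lam t (a + m) w) (r := lam ^ (n + a)) (R := lam ^ n)
    (pow_pos h0 _) (pow_le_pow_of_le_one h0.le h1.le (by omega)) (2 * D) (lamX_diff h0 hD n (a + m))
  have h2 := EE_le_SE_long h0 hD a m
  have h3 : SE (fun w : Fin (a + m) → Fin N => lam ^ n * XX lam t (a + m) w) (lam ^ (n + a)) = SE (XX lam t (a + m)) (lam ^ a) := by
    rw [pow_add, SE_scale_mul _ (pow_pos h0 _).ne']
  rw [h3] at hw
  linarith

lemma win_b {Ω Ω0 : Type*} [Fintype Ω] [Fintype Ω0] [Nonempty Ω] [Nonempty Ω0] (X : Ω0 → ℝ) (Y : Ω → ℝ)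
    {ρ R : ℝ} (hρ : 0 < ρ) (hρR : ρ ≤ R) (k : ℕ) (hk : k * ρ ^ 2 ≤ R ^ 2)
    {Q : ℝ} (hQ : 0 < Q) (h : Q * ρ ^ 2 ≤ k * Vr (fun ω => ⌊Y ω / ρ⌋) Y) :
    Real.log Q / 2 - Real.log 5 - (2 + Real.log 4) - Real.log 5 ≤
      SE (fun p : Ω0 × (Fin k → Ω) => X p.1 + ∑ i, Y (p.2 i)) ρ - SE (fun p : Ω0 × (Fin k → Ω) => X p.1 + ∑ i, Y (p.2 i)) R := by
  have h1 := window (fun p : Ω0 × (Fin k → Ω) => ⌊(X p.1 + ∑ i, Y (p.2 i)) / ρ⌋) (fun p : Ω0 × (Fin k → Ω) => ⌊(X p.1 + ∑ i, Y (p.2 i)) / R⌋)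
    (fun p => (p.1, fun i => ⌊Y (p.2 i) / ρ⌋)) (SE_pair_coarse (fun p : Ω0 × (Fin k → Ω) => X p.1 + ∑ i, Y (p.2 i)) hρ hρR)
  have h2 := cond_lower X Y hρ k hQ h
  have h3 := conv_upper X Y hρ (lt_of_lt_of_le hρ hρR) k hk
  unfold SE at *
  linarith

/-- counting good scales -/
lemma count_good {Ω : Type*} [Fintype Ω] [Nonempty Ω] (Y : Ω → ℝ) (hY : ∀ x y, |Y x - Y y| ≤ 1)
    (h0 : 0 < lam) (h1 : lam < 1) (s T : ℕ) :
    SE Y (lam ^ (s * T)) - Real.log 5 ≤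
      ((Finset.range T).filter (fun i => 2 + Real.log 4 < SE Y (lam ^ (s * (i + 1))) - SE Y (lam ^ (s * i)))).card *
        (-Real.log lam * s + Real.log 7) + T * (2 + Real.log 4) := by
  have hS0 : SE Y (lam ^ (s * 0)) ≤ Real.log 5 := by
    have := SE_le Y (fun _ : Ω => ()) (r := lam ^ (s * 0)) (by simp) 1 (by intro a b _; simpa using hY a b)
    have h2 : Ent (fun _ : Ω => ()) = 0 := by
      unfold Ent fib
      have := cardpos Ω
      simp [av, this.ne']
    norm_num at this
    rw [h2] at this
    simpa using this
  have htel := Finset.sum_range_sub (fun i => SE Y (lam ^ (s * i))) T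
  set good := (Finset.range T).filter (fun i => 2 + Real.log 4 < SE Y (lam ^ (s * (i + 1))) - SE Y (lam ^ (s * i))) with hg
  have hlog4 : 0 ≤ Real.log 4 := Real.log_nonneg (by norm_num)
  have hb : ∀ i ∈ Finset.range T, SE Y (lam ^ (s * (i + 1))) - SE Y (lam ^ (s * i)) ≤
      (if 2 + Real.log 4 < SE Y (lam ^ (s * (i + 1))) - SE Y (lam ^ (s * i)) then (-Real.log lam * s + Real.log 7) else 0) + (2 + Real.log 4) := by
    intro i _
    split_ifs with h
    · have hpos : 0 < lam ^ s := pow_pos h0 s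
      have hx1 : 1 ≤ (lam ^ s)⁻¹ := by
        rw [one_le_inv₀ hpos]
        exact pow_le_one₀ h0.le h1.le
      have hK := Nat.le_ceil ((lam ^ s)⁻¹)
      have hK2 := Nat.ceil_lt_add_one (show 0 ≤ (lam ^ s)⁻¹ by positivity)
      have := SE_fine Y (r := lam ^ (s * (i + 1))) (r' := lam ^ (s * i)) (pow_pos h0 _) (pow_pos h0 _) ⌈(lam ^ s)⁻¹⌉₊ (by
        have e : lam ^ (s * i) = (lam ^ s)⁻¹ * lam ^ (s * (i + 1)) := by
          rw [mul_add, pow_add, mul_one]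
          field_simp
        rw [e]
        gcongr)
      have h3 : Real.log (2 * (⌈(lam ^ s)⁻¹⌉₊ : ℝ) + 3) ≤ Real.log (7 * (lam ^ s)⁻¹) := by
        apply Real.log_le_log
        · positivity
        · linarith
      rw [Real.log_mul (by norm_num) (by positivity), Real.log_inv, Real.log_pow] at h3
      linarith
    · push Not at h
      linarith
  have hsum := Finset.sum_le_sum hb
  rw [htel, Finset.sum_add_distrib, ← Finset.sum_filter, Finset.sum_const, Finset.sum_const, Finset.card_range, nsmul_eq_mul, nsmul_eq_mul] at hsum
  linarith

set_option maxHeartbeats 4000000 in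
theorem lemmaG (h0 : 0 < lam) (h1 : lam < 1) (t : Fin N → ℝ) {A C : ℝ} (hC : 0 ≤ C)
    (hA1 : ∀ n : ℕ, EE lam t n ≤ A * n + C) (hA2 : ∀ ε > 0, ∃ n0 : ℕ, ∀ n ≥ n0, (A - ε) * n ≤ EE lam t n)
    (hAL : A < -Real.log lam) {c1 : ℝ} (hc1 : 0 < c1) :
    ∃ s : ℕ, 1 ≤ s ∧ ∃ δ > 0, ∃ T0 : ℕ, ∀ T ≥ T0, ∀ (Ω : Type) [Fintype Ω] [Nonempty Ω] (Y : Ω → ℝ),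
      (∀ x y, |Y x - Y y| ≤ 1) → c1 * (s * T) ≤ SE Y (lam ^ (s * T)) →
      (A + δ) * (s * T) ≤ SE (fun p : (Fin (s * T) → Fin N) × Ω => XX lam t (s * T) p.1 + Y p.2) (lam ^ (s * T)) := by
  obtain ⟨D, hD⟩ := XX_bdd h0 h1 t
  set Λ := -Real.log lam with hΛ
  have hΛ0 : 0 < Λ := by
    have := Real.log_neg h0 h1; linarith
  have hlog7 : 0 < Real.log 7 := Real.log_pos (by norm_num)
  have hlog5 : 0 < Real.log 5 := Real.log_pos (by norm_num)
  have hlog4 : 0 < Real.log 4 := Real.log_pos (by norm_num)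
  have hlog2 : 0 < Real.log 2 := Real.log_pos (by norm_num)
  set c2 := 2 + Real.log 4 with hc2
  set p := c1 / (4 * (Λ + Real.log 7)) with hp
  have hp0 : 0 < p := by positivity
  set η := p * (Λ - A) / 4 with hη
  have hη0 : 0 < η := by
    have : 0 < Λ - A := by linarith
    positivity
  obtain ⟨s, hs⟩ := exists_nat_ge (max 1 (2 * c2 / c1))
  have hs1 : (1:ℝ) ≤ s := (le_max_left _ _).trans hs
  have hs2 : 2 * c2 ≤ c1 * s := by
    have := (le_max_right _ _).trans hs
    rw [div_le_iff₀ hc1] at this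
    linarith
  set Ca := (Real.log (4 * D + 5) + 2 * Real.log 5 + Real.log (2 * (2 * D : ℕ) + 3)) with hCa
  have hCa0 : 0 ≤ Ca := by
    have hD0 : (0:ℝ) ≤ D := by positivity
    have hD1 : (0:ℝ) ≤ (2 * D : ℕ) := by positivity
    have a2 : 0 ≤ Real.log (2 * (2 * D : ℕ) + 3) := Real.log_nonneg (by linarith)
    have a3 : 0 ≤ Real.log (4 * D + 5) := Real.log_nonneg (by linarith)
    linarith
  set Cb := 2 * Real.log 5 + c2 + Real.log 2 / 2 with hCb
  have hCb0 : 0 ≤ Cb := by linarith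
  obtain ⟨n0, hn0⟩ := hA2 (η / 4) (by linarith)
  obtain ⟨K, hK⟩ := exists_nat_ge (max (max 1 (n0:ℝ)) (max (4 * Ca / η) (2 * (Λ + Cb) / (Λ - A))))
  have hK1 : (1:ℝ) ≤ K := (le_max_left _ _).trans ((le_max_left _ _).trans hK)
  have hK2 : n0 ≤ K := by
    have : (n0:ℝ) ≤ K := (le_max_right _ _).trans ((le_max_left _ _).trans hK)
    exact_mod_cast this
  have hK3 : Ca ≤ η / 4 * (s * K) := by
    have := (le_max_left _ _).trans ((le_max_right _ _).trans hK)
    rw [div_le_iff₀ hη0] at this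
    nlinarith [mul_le_mul_of_nonneg_right hs1 (show 0 ≤ (K:ℝ) * η by positivity)]
  have hK4 : s * Λ + Cb ≤ (Λ - A) * (s * K) / 2 := by
    have := (le_max_right _ _).trans ((le_max_right _ _).trans hK)
    rw [div_le_iff₀ (by linarith)] at this
    nlinarith
  have hsN : 1 ≤ s := by exact_mod_cast hs1
  have hKN : 1 ≤ K := by exact_mod_cast hK1
  have hEK : (A - η / 4) * (s * K) ≤ EE lam t (s * K) := by
    have := hn0 (s * K) (by nlinarith)
    push_cast at this
    exact this
  have hlamsK : 0 < lam ^ (s * K) := pow_pos h0 _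
  set x := ((lam ^ (s * K))⁻¹) ^ 2 with hx
  have hx1 : 1 ≤ x := by
    apply one_le_pow₀
    rw [one_le_inv₀ hlamsK]
    exact pow_le_one₀ h0.le h1.le
  set k := ⌊x⌋₊ with hk
  have hkx : (k:ℝ) ≤ x := Nat.floor_le (by linarith)
  have hk1 : 1 ≤ k := Nat.le_floor (by simpa using hx1)
  have hk1' : (1:ℝ) ≤ k := by exact_mod_cast hk1
  have hkx2 : x / 2 ≤ k := by
    have := Nat.lt_floor_add_one x
    linarith
  have hlogk : 2 * (s * K) * Λ - Real.log 2 ≤ Real.log k := by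
    have h2 : Real.log (x / 2) ≤ Real.log k := Real.log_le_log (by positivity) hkx2
    rw [Real.log_div (by positivity) (by norm_num), hx, Real.log_pow, Real.log_inv, Real.log_pow] at h2
    push_cast at h2
    rw [hΛ]
    linarith
  set δ := η / (8 * k) with hδ
  have hδ0 : 0 < δ := by positivity
  have hδk : k * δ = η / 8 := by rw [hδ]; field_simp
  obtain ⟨n1, hn1⟩ := hA2 δ hδ0
  set Ck := Real.log (2 * ((k:ℝ) + 1) + 3) + k * Real.log 7 with hCk
  set a := (A - η / 4) * (s * K) - Ca with ha
  set B := (Λ - A) * (s * K) / 2 with hB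
  have hB0 : 0 ≤ B := by
    have : 0 < Λ - A := by linarith
    positivity
  obtain ⟨T0, hT0⟩ := exists_nat_ge (max (max (K:ℝ) (n1:ℝ)) (max (4 * Real.log 5 / c1) ((C + Ck + a + B + Real.log 5 + 1) / η)))
  refine ⟨s, hsN, δ, hδ0, T0, ?_⟩
  clear_value δ a B Ck k x Cb Ca η p c2 Λ
  intro T hT Ω _ _ Y hY hYent
  have hTr : (T0:ℝ) ≤ T := by exact_mod_cast hT
  have hT1 : K ≤ T := by
    have : (K:ℝ) ≤ T := ((le_max_left _ _).trans ((le_max_left _ _).trans hT0)).trans hTr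
    exact_mod_cast this
  have hT2 : n1 ≤ T := by
    have : (n1:ℝ) ≤ T := ((le_max_right _ _).trans ((le_max_left _ _).trans hT0)).trans hTr
    exact_mod_cast this
  have hT3 : Real.log 5 ≤ c1 * s / 4 * T := by
    have := ((le_max_left _ _).trans ((le_max_right _ _).trans hT0)).trans hTr
    rw [div_le_iff₀ hc1] at this
    nlinarith [mul_le_mul_of_nonneg_right hs1 (show 0 ≤ (T:ℝ) * c1 by positivity)]
  have hT4 : C + Ck + a + B + Real.log 5 + 1 ≤ η * (s * T) := by
    have := ((le_max_right _ _).trans ((le_max_right _ _).trans hT0)).trans hTr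
    rw [div_le_iff₀ hη0] at this
    nlinarith [mul_le_mul_of_nonneg_right hs1 (show 0 ≤ (T:ℝ) * η by positivity)]
  by_contra hcon
  push Not at hcon
  set gd : ℕ → Prop := fun i => 2 + Real.log 4 < SE Y (lam ^ (s * (i + 1))) - SE Y (lam ^ (s * i)) with hgd
  have hcount := count_good Y hY h0 h1 s T
  have hgood : p * T ≤ ((Finset.range T).filter gd).card := by
    have h3 : p * T * (4 * (Λ + Real.log 7)) = c1 * T := by
      rw [hp]; field_simp
    have h4 : c1 * s / 4 * T ≤ ((Finset.range T).filter gd).card * (Λ * s + Real.log 7) := by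
      have h5 : (T:ℝ) * c2 ≤ T * (c1 * s / 2) := by
        gcongr; linarith
      have h6 : c1 * (s * T) - Real.log 5 ≤ ((Finset.range T).filter gd).card * (Λ * s + Real.log 7) + T * c2 := by
        have hc' : SE Y (lam ^ (s * T)) - Real.log 5 ≤ ((Finset.range T).filter gd).card * (-Real.log lam * s + Real.log 7) + T * (2 + Real.log 4) := hcount
        rw [hΛ, hc2]
        linarith
      linarith
    have h7 : p * T * (Λ * s + Real.log 7) ≤ c1 * s / 4 * T := by
      have : p * T * (Λ * s + Real.log 7) ≤ p * T * ((Λ + Real.log 7) * s) := by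
        gcongr
        have := mul_le_mul_of_nonneg_left hs1 hlog7.le
        linarith
      have h9 : p * T * ((Λ + Real.log 7) * s) = c1 * s / 4 * T := by
        have : p * T * ((Λ + Real.log 7) * s) = (p * T * (4 * (Λ + Real.log 7))) * (s / 4) := by ring
        rw [this, h3]; ring
      linarith
    have h8 : 0 < Λ * s + Real.log 7 := by positivity
    exact le_of_mul_le_mul_right (h7.trans h4) h8
  -- the convolution
  set h : ℕ → ℝ := fun i => SE (fun q : (Fin (s * T) → Fin N) × (Fin k → Ω) => XX lam t (s * T) q.1 + ∑ i, Y (q.2 i)) (lam ^ (s * i)) with hh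
  have hga : ∀ i ∈ Finset.Ico K T, a ≤ h i - h (i - K) := by
    intro i hi
    have hi' := Finset.mem_Ico.1 hi
    have h2 := win_a h0 h1 hD (fun w : Fin k → Ω => ∑ i, Y (w i)) (s * T) (s * (i - K)) (s * K) (by
      rw [← mul_add]; apply Nat.mul_le_mul_left; omega)
    have e : s * (i - K) + s * K = s * i := by rw [← mul_add]; congr 1; omega
    rw [e] at h2
    simp only [hh]
    linarith
  have hgb : ∀ i ∈ Finset.Ico K T, gd i → a + B ≤ h i - h (i - K) := by
    intro i hi hgi
    have hi' := Finset.mem_Ico.1 hi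
    have hVr : (lam ^ (s * (i + 1))) ^ 2 ≤ Vr (fun ω => ⌊Y ω / lam ^ (s * i)⌋) Y := by
      by_contra hV
      push Not at hV
      have h3 := small_var Y (ρ := lam ^ (s * i)) (pow_pos h0 (s * (i + 1))) hV.le
      have h4 : SE Y (lam ^ (s * (i + 1))) ≤ Ent (fun ω => (⌊Y ω / lam ^ (s * (i + 1))⌋, ⌊Y ω / lam ^ (s * i)⌋)) :=
        Ent_mono (by intro a b hab; exact (Prod.mk.inj hab).1)
      simp only [hgd] at hgi
      linarith
    have eR : lam ^ (s * i) = lam ^ (s * (i - K)) * lam ^ (s * K) := by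
      rw [← pow_add, ← mul_add]; congr 2; omega
    have h2 := win_b (XX lam t (s * T)) Y (ρ := lam ^ (s * i)) (R := lam ^ (s * (i - K))) (pow_pos h0 _)
      (pow_le_pow_of_le_one h0.le h1.le (Nat.mul_le_mul_left _ (by omega))) k (by
        have : (k:ℝ) * (lam ^ (s * i)) ^ 2 ≤ x * (lam ^ (s * i)) ^ 2 := by gcongr
        refine this.trans (le_of_eq ?_)
        rw [hx, eR]
        field_simp) (Q := k * (lam ^ s) ^ 2) (by positivity) (by
        have e : lam ^ (s * (i + 1)) = lam ^ s * lam ^ (s * i) := by rw [← pow_add]; congr 1; ring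
        rw [e] at hVr
        have := mul_le_mul_of_nonneg_left hVr (show (0:ℝ) ≤ k by positivity)
        linarith)
    rw [Real.log_mul (by positivity) (by positivity), Real.log_pow, Real.log_pow] at h2
    simp only [hh]
    push_cast at h2
    have e3 : (s:ℝ) * Real.log lam = - (s * Λ) := by rw [hΛ]; ring
    rw [e3] at h2
    have e4 : 0 ≤ η / 4 * (s * K) := by positivity
    have e5 : (s:ℝ) * Λ = s * Λ := rfl
    linarith
  have hsumlow : (T - K) * a + (p * T - K) * B ≤ ∑ i ∈ Finset.Ico K T, (h i - h (i - K)) := by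
    have h2 : ∑ i ∈ Finset.Ico K T, (a + if gd i then B else 0) ≤ ∑ i ∈ Finset.Ico K T, (h i - h (i - K)) := by
      apply Finset.sum_le_sum
      intro i hi
      split_ifs with hgi
      · exact hgb i hi hgi
      · rw [add_zero]; exact hga i hi
    refine le_trans ?_ h2
    rw [Finset.sum_add_distrib, ← Finset.sum_filter, Finset.sum_const, Finset.sum_const, Nat.card_Ico, nsmul_eq_mul, nsmul_eq_mul, Nat.cast_sub hT1]
    have h3 : ((Finset.range T).filter gd).card ≤ ((Finset.Ico K T).filter gd).card + K := by
      have hsub : (Finset.range T).filter gd ⊆ (Finset.Ico K T).filter gd ∪ Finset.range K := by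
        intro i hi
        simp only [Finset.mem_filter, Finset.mem_range, Finset.mem_union, Finset.mem_Ico] at hi ⊢
        by_cases hiK : i < K
        · right; exact hiK
        · left; exact ⟨⟨by omega, hi.1⟩, hi.2⟩
      refine (Finset.card_le_card hsub).trans ((Finset.card_union_le _ _).trans ?_)
      rw [Finset.card_range]
    have h4 : (((Finset.range T).filter gd).card : ℝ) ≤ ((Finset.Ico K T).filter gd).card + K := by exact_mod_cast h3
    have h5 : p * T - K ≤ ((Finset.Ico K T).filter gd).card := by linarith
    have := mul_le_mul_of_nonneg_right h5 hB0
    linarith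
  have hsumup := sum_window h K T hT1 (h T + Real.log 5) (fun i => SE_nonneg _ _) (by
    intro i hi
    exact SE_coarse _ (pow_pos h0 _) (pow_le_pow_of_le_one h0.le h1.le (Nat.mul_le_mul_left _ hi.le)))
  have hKV := SE_KV (XX lam t (s * T)) Y (pow_pos h0 (s * T)) k
  have hS1 := hA1 (s * T)
  have hS2 := hn1 (s * T) (by nlinarith)
  push_cast at hS1 hS2
  have hhT : h T ≤ A * (s * T) + C + η / 4 * (s * T) + Ck := by
    have h2 : (k:ℝ) * (SE (fun p : (Fin (s * T) → Fin N) × Ω => XX lam t (s * T) p.1 + Y p.2) (lam ^ (s * T)) - EE lam t (s * T)) ≤ k * (2 * δ * (s * T)) := by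
      gcongr
      linarith
    have h3 : (k:ℝ) * (2 * δ * (s * T)) = η / 4 * (s * T) := by
      calc (k:ℝ) * (2 * δ * (s * T)) = 2 * (k * δ) * (s * T) := by ring
        _ = _ := by rw [hδk]; ring
    have h4 : EE lam t (s * T) = SE (XX lam t (s * T)) (lam ^ (s * T)) := rfl
    rw [h4] at h2 hS1
    simp only [hh]
    linarith
  -- final contradiction
  have hfin1 : (K:ℝ) * (s * T * (A + 3 / 2 * η)) ≤ T * (a + p * B) := by
    have hpB : p * B = 2 * η * (s * K) := by rw [hB, hη]; ring
    have : (K:ℝ) * s * (A + 3/2 * η) ≤ a + p * B := by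
      rw [hpB, ha]; linarith
    have := mul_le_mul_of_nonneg_left this (show (0:ℝ) ≤ T by positivity)
    linarith
  have hfin2 : (K:ℝ) * (s * T * (A + 3 / 2 * η)) ≤ K * (h T + Real.log 5 + a + B) := by
    linarith
  have hfin3 := le_of_mul_le_mul_left hfin2 (by linarith)
  have : 0 ≤ η * (s * T) := by positivity
  linarith

end hoch
end SA

namespace SA
open scoped Classical

section hmain

lemma Ent_cond_prod {Ω0 Ω1 : Type} [Fintype Ω0] [Fintype Ω1] [Nonempty Ω0] [Nonempty Ω1] {α β : Type}
    (f : Ω0 × Ω1 → α) (τ : Ω0 → β) :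
    Ent (fun p => (f p, τ p.1)) - Ent τ =
      av (fun a : Ω0 => Ent (fun q : Ω1 × {a' // τ a' = τ a} => f (q.2.1, q.1))) := by
  have h1 := Ent_cond_eq f (fun p : Ω0 × Ω1 => τ p.1)
  rw [Ent_fst τ] at h1
  rw [h1, av_prod]
  congr 1
  funext a
  have : ∀ b : Ω1, Ent (fun x : {ω' : Ω0 × Ω1 // τ ω'.1 = τ a} => f x.1) = Ent (fun q : Ω1 × {a' // τ a' = τ a} => f (q.2.1, q.1)) := by
    intro b
    let e : Ω1 × {a' // τ a' = τ a} ≃ {ω' : Ω0 × Ω1 // τ ω'.1 = τ a} :=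
      { toFun := fun q => ⟨(q.2.1, q.1), q.2.2⟩
        invFun := fun x => (x.1.2, ⟨x.1.1, x.2⟩)
        left_inv := fun q => rfl
        right_inv := fun x => rfl }
    exact (Ent_equiv e (fun x : {ω' : Ω0 × Ω1 // τ ω'.1 = τ a} => f x.1)).symm
  exact (congrArg av (funext this)).trans (av_const (Ω := Ω1) _)

lemma SE_add_ge {Ω0 Ω1 : Type} [Fintype Ω0] [Fintype Ω1] [Nonempty Ω0] [Nonempty Ω1]
    (X : Ω1 → ℝ) (Y : Ω0 → ℝ) {r : ℝ} (hr : 0 < r) :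
    SE X r - Real.log 5 ≤ SE (fun p : Ω1 × Ω0 => X p.1 + Y p.2) r := by
  have h1 := cond_indep_lower Y X hr
  have h2 := Ent_subadd (fun p : Ω0 × Ω1 => ⌊(Y p.1 + X p.2) / r⌋) (fun p : Ω0 × Ω1 => p.1)
  have h3 := Ent_equiv (Equiv.prodComm Ω0 Ω1) (fun p : Ω1 × Ω0 => ⌊(X p.1 + Y p.2) / r⌋)
  have h4 : (fun ω : Ω0 × Ω1 => ⌊(X ((Equiv.prodComm Ω0 Ω1) ω).1 + Y ((Equiv.prodComm Ω0 Ω1) ω).2) / r⌋) = (fun p : Ω0 × Ω1 => ⌊(Y p.1 + X p.2) / r⌋) := by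
    funext p; simp [add_comm]
  rw [h4] at h3
  unfold SE at *
  linarith

lemma fibre_arg {Ω0 Ω1 : Type} [Fintype Ω0] [Fintype Ω1] [Nonempty Ω0] [Nonempty Ω1] {β : Type}
    (τ : Ω0 → β) (Y : Ω0 → ℝ) (X : Ω1 → ℝ) {r κ G : ℝ} (hr : 0 < r) (hκ : 0 ≤ κ)
    (hgood : ∀ (Ω : Type) [Fintype Ω] [Nonempty Ω] (Y' : Ω → ℝ), (∀ x y, |Y' x - Y' y| ≤ 1) → κ ≤ SE Y' r →
      G ≤ SE (fun p : Ω1 × Ω => X p.1 + Y' p.2) r)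
    (hY : ∀ a a', τ a = τ a' → |Y a - Y a'| ≤ 1) {l : ℝ} (hl : 0 < l) (hcl : Real.log (Fintype.card Ω0) ≤ l)
    (hGB : SE X r - Real.log 5 ≤ G) :
    (SE X r - Real.log 5) + (G - (SE X r - Real.log 5)) * ((Ent (fun a => (⌊Y a / r⌋, τ a)) - Ent τ - κ) / l) ≤
      Ent (fun p : Ω0 × Ω1 => (⌊(Y p.1 + X p.2) / r⌋, τ p.1)) - Ent τ := by
  rw [Ent_cond_prod (fun p : Ω0 × Ω1 => ⌊(Y p.1 + X p.2) / r⌋) τ, Ent_cond_eq (fun a => ⌊Y a / r⌋) τ]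
  set B := SE X r - Real.log 5 with hB
  have key : ∀ a, B + (G - B) * ((Ent (fun x : {a' // τ a' = τ a} => ⌊Y x.1 / r⌋) - κ) / l) ≤
      Ent (fun q : Ω1 × {a' // τ a' = τ a} => ⌊(Y q.2.1 + X q.1) / r⌋) := by
    intro a
    have : Nonempty {a' // τ a' = τ a} := ⟨⟨a, rfl⟩⟩
    have h1 := SE_add_ge X (fun x : {a' // τ a' = τ a} => Y x.1) hr
    have h2 := hgood {a' // τ a' = τ a} (fun x => Y x.1) (fun x y => hY _ _ (x.2.trans y.2.symm))
    have e : SE (fun p : Ω1 × {a' // τ a' = τ a} => X p.1 + Y p.2.1) r = Ent (fun q : Ω1 × {a' // τ a' = τ a} => ⌊(Y q.2.1 + X q.1) / r⌋) := by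
      unfold SE; simp only [add_comm]
    rw [e] at h1 h2
    have e2 : Ent (fun x : {a' // τ a' = τ a} => ⌊Y x.1 / r⌋) = SE (fun x : {a' // τ a' = τ a} => Y x.1) r := rfl
    rw [e2]
    by_cases hk : κ ≤ SE (fun x : {a' // τ a' = τ a} => Y x.1) r
    · have h3 := h2 hk
      have h4 : SE (fun x : {a' // τ a' = τ a} => Y x.1) r ≤ l := by
        refine le_trans ((Ent_le_card _).trans (Real.log_le_log (cardpos _) ?_)) hcl
        exact_mod_cast Fintype.card_subtype_le _
      have h5 : (SE (fun x : {a' // τ a' = τ a} => Y x.1) r - κ) / l ≤ 1 := by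
        rw [div_le_one hl]; linarith
      have h6 := mul_le_mul_of_nonneg_left h5 (show 0 ≤ G - B by linarith)
      linarith
    · push Not at hk
      have h5 : (SE (fun x : {a' // τ a' = τ a} => Y x.1) r - κ) / l ≤ 0 :=
        div_nonpos_of_nonpos_of_nonneg (by linarith) hl.le
      have h6 := mul_nonpos_of_nonneg_of_nonpos (show 0 ≤ G - B by linarith) h5
      linarith
  have := av_mono key
  refine le_trans (le_of_eq ?_) this
  rw [av_add, av_const, av_const_mul, av_div_const, av_sub, av_const]

end hmain

section hoch
variable {N : ℕ} {lam : ℝ} [NeZero N]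

set_option maxHeartbeats 1000000 in
theorem hochman_A (hN : 2 ≤ N) (h0 : 0 < lam) (h1 : lam < 1) (t : Fin N → ℝ) (hE : HochmanESC N (fun _ => lam) t)
    {A C : ℝ} (hC : 0 ≤ C)
    (hA1 : ∀ n : ℕ, EE lam t n ≤ A * n + C) (hA2 : ∀ ε > 0, ∃ n0 : ℕ, ∀ n ≥ n0, (A - ε) * n ≤ EE lam t n) :
    min (Real.log N) (-Real.log lam) ≤ A := by
  by_contra hcon
  push Not at hcon
  have hAN : A < Real.log N := lt_of_lt_of_le hcon (min_le_left _ _)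
  have hAL : A < -Real.log lam := lt_of_lt_of_le hcon (min_le_right _ _)
  have hlN : 0 < Real.log N := Real.log_pos (by exact_mod_cast hN)
  obtain ⟨D, hD⟩ := XX_bdd h0 h1 t
  obtain ⟨ε, hε, nk, hnk, hsep⟩ := hE
  obtain ⟨q, hq⟩ := exists_pow_lt_of_lt_one (lt_min hε one_pos) h1
  have hq1 : 1 ≤ q := by
    rcases Nat.eq_zero_or_pos q with rfl | h
    · simp at hq
    · exact h
  have hqε : lam ^ q ≤ ε := hq.le.trans (min_le_left _ _)
  have hq1' : (1:ℝ) ≤ q := by exact_mod_cast hq1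
  set g := Real.log N - A with hg
  have hg0 : 0 < g := by linarith
  obtain ⟨s, hs, δ, hδ, T0, hG⟩ := lemmaG h0 h1 t hC hA1 hA2 hAL (c1 := g / (4 * q)) (by positivity)
  set ε' := δ * g / (32 * Real.log N) with hε'
  have hε0 : 0 < ε' := by positivity
  obtain ⟨n0, hn0⟩ := hA2 ε' hε0
  have hlog5 : 0 < Real.log 5 := Real.log_pos (by norm_num)
  set C1 := Real.log (2 * ((1 + 2 * D : ℕ) : ℝ) + 3) with hC1
  have hC10 : 0 ≤ C1 := by
    apply Real.log_nonneg
    have : (0:ℝ) ≤ ((1 + 2 * D : ℕ) : ℝ) := by positivity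
    linarith
  obtain ⟨M, hM⟩ := exists_nat_ge (max (max (n0:ℝ) (s:ℝ)) (max (s * T0 : ℝ) (max (4 * C / g) ((C + C1 + Real.log 5 + 1) / (3 * ε')))))
  set n := nk (M + 1) with hn
  have hMn : M + 1 ≤ n := hnk.id_le (M + 1)
  have hMn' : (M:ℝ) + 1 ≤ n := by exact_mod_cast hMn
  have b1 : (n0:ℝ) ≤ n := by have := (le_max_left _ _).trans ((le_max_left _ _).trans hM); linarith
  have b2 : (s:ℝ) ≤ n := by have := (le_max_right _ _).trans ((le_max_left _ _).trans hM); linarith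
  have b3 : (s * T0:ℝ) ≤ n := by have := (le_max_left _ _).trans ((le_max_right _ _).trans hM); linarith
  have b4 : 4 * C / g ≤ n := by
    have := (le_max_left _ _).trans ((le_max_right _ _).trans ((le_max_right _ _).trans hM)); linarith
  have b5 : (C + C1 + Real.log 5 + 1) / (3 * ε') ≤ n := by
    have := (le_max_right _ _).trans ((le_max_right _ _).trans ((le_max_right _ _).trans hM)); linarith
  rw [div_le_iff₀ hg0] at b4
  rw [div_le_iff₀ (by positivity)] at b5
  have hn1 : (1:ℝ) ≤ n := by
    have : (0:ℝ) ≤ M := by positivity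
    linarith
  set T := q * n / s + 1 with hT
  have hs' : (1:ℝ) ≤ s := by exact_mod_cast hs
  have hT1 : q * n ≤ s * T := by
    have := Nat.lt_div_mul_add (a := q * n) (b := s) (by omega)
    rw [hT, mul_add, mul_one, mul_comm s]; omega
  have hT2 : s * T ≤ q * n + s := by
    rw [hT, mul_add, mul_one]
    have := Nat.mul_div_le (q * n) s
    omega
  have hT1' : (q:ℝ) * n ≤ s * T := by exact_mod_cast hT1
  have hT2' : (s:ℝ) * T ≤ 2 * (q * n) := by
    have h2 : (s:ℝ) * T ≤ q * n + s := by exact_mod_cast hT2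
    have h3 : (n:ℝ) ≤ q * n := by nlinarith
    linarith
  have hnq : (n:ℝ) ≤ q * n := by nlinarith
  have hTT0 : T0 ≤ T := by
    have h2 : (s:ℝ) * T0 ≤ s * T := by linarith
    have := le_of_mul_le_mul_left h2 (by linarith)
    exact_mod_cast this
  have hG' := hG T hTT0
  set m := s * T with hm
  have hmr : (m:ℝ) = s * T := by rw [hm]; push_cast; ring
  have hmn0 : n0 ≤ m := by
    have : (n0:ℝ) ≤ m := by rw [hmr]; linarith
    exact_mod_cast this
  have hnn0 : n0 ≤ n := by exact_mod_cast b1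
  have hEm := hn0 m hmn0
  have hEn := hn0 n hnn0
  have hE1 := hA1 n
  have hE2 := hA1 (n + m)
  have hcard : Real.log (Fintype.card (Fin n → Fin N)) ≤ n * Real.log N := by
    rw [Fintype.card_fun, Fintype.card_fin, Fintype.card_fin]; push_cast; rw [Real.log_pow]
  have hln : 0 < lam ^ n := pow_pos h0 n
  have hlm : 0 < lam ^ m := pow_pos h0 m
  -- the fibre argument
  have hF := fibre_arg (Ω0 := Fin n → Fin N) (Ω1 := Fin m → Fin N) (fun a => ⌊XX lam t n a / lam ^ n⌋)
    (fun a => XX lam t n a / lam ^ n) (XX lam t m) (r := lam ^ m) (κ := g / (4 * q) * (s * T))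
    (G := (A + δ) * (s * T)) hlm (by positivity)
    (fun Ω _ _ Y' hY' hk => hG' Ω Y' hY' hk)
    (by
      intro a a' h
      have := floor_eq_close hln h
      rw [← sub_div, abs_div, abs_of_pos hln, div_le_one hln]
      exact this) (l := n * Real.log N) (by positivity) hcard (by
      have := hA1 m
      have e : EE lam t m = SE (XX lam t m) (lam ^ m) := rfl
      rw [← e, ← hmr]
      by_contra h
      push Not at h
      -- trivial Omega gives nothing, use size
      have h3 : C + C1 + Real.log 5 + 1 ≤ δ * m := by
        have : ε' * 3 ≤ δ := by
          rw [hε']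
          have h4 : g ≤ 2 * Real.log N ∨ 2 * Real.log N < g := le_or_gt _ _
          have hA0 : 0 ≤ A := by
            by_contra hA0
            push Not at hA0
            obtain ⟨K, hK⟩ := exists_nat_gt (C / (-A))
            have := hA1 K
            have h5 : 0 ≤ EE lam t K := SE_nonneg _ _
            rw [div_lt_iff₀ (by linarith)] at hK
            linarith
          have h6 : g ≤ Real.log N := by rw [hg]; linarith
          rw [div_mul_eq_mul_div, div_le_iff₀ (by positivity)]
          have := mul_le_mul_of_nonneg_left h6 hδ.le
          have : 0 ≤ δ * Real.log N := by positivity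
          linarith
        have h7 : (n:ℝ) * (3 * ε') ≤ m * (3 * ε') := by
          gcongr
          have h9 : (n:ℝ) ≤ m := by rw [hmr]; linarith
          exact_mod_cast h9
        have h8 : (m:ℝ) * (3 * ε') ≤ m * δ := by gcongr; linarith
        linarith
      linarith)
  -- lower bound for entropy of Y
  have hY1 : Ent (fun a : Fin n → Fin N => (⌊XX lam t n a / lam ^ n / lam ^ m⌋, ⌊XX lam t n a / lam ^ n⌋)) = n * Real.log N := by
    rw [Ent_inj]
    · rw [Fintype.card_fun, Fintype.card_fin, Fintype.card_fin]; push_cast; rw [Real.log_pow]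
    · intro a a' haa
      by_contra hne
      have h2 := (Prod.mk.inj haa).1
      rw [div_div, div_div] at h2
      have h3 := floor_eq_close (mul_pos hln hlm) h2
      have h4 := hsep (M + 1) a a' hne (by simp)
      rw [psiWord_eq, psiWord_eq] at h4
      have h5 : lam ^ n * lam ^ m ≤ ε ^ n := by
        calc lam ^ n * lam ^ m ≤ 1 * lam ^ (q * n) := by
              gcongr ?_ * ?_
              · exact pow_le_one₀ h0.le h1.le
              · exact pow_le_pow_of_le_one h0.le h1.le hT1
          _ = (lam ^ q) ^ n := by rw [one_mul, pow_mul]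
          _ ≤ ε ^ n := by gcongr
      have h6 : ε ^ n < |XX lam t n a - XX lam t n a'| := h4
      linarith
  have hτ : Ent (fun a : Fin n → Fin N => ⌊XX lam t n a / lam ^ n⌋) = EE lam t n := rfl
  -- upper bound of the conditional entropy
  have hU : Ent (fun p : (Fin n → Fin N) × (Fin m → Fin N) => (⌊(XX lam t n p.1 / lam ^ n + XX lam t m p.2) / lam ^ m⌋, ⌊XX lam t n p.1 / lam ^ n⌋)) ≤ EE lam t (n + m) + C1 := by
    have e1 : EE lam t (n + m) = Ent (fun p : (Fin n → Fin N) × (Fin m → Fin N) => ⌊(XX lam t n p.1 / lam ^ n + XX lam t m p.2) / lam ^ m⌋) := by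
      unfold EE
      rw [SE_XX_split]
      unfold SE
      congr 1
      funext p
      congr 1
      rw [pow_add]
      field_simp
    have h2 := SE_pair_le (fun p : (Fin n → Fin N) × (Fin m → Fin N) => XX lam t n p.1)
      (fun p : (Fin n → Fin N) × (Fin m → Fin N) => ⌊(XX lam t n p.1 / lam ^ n + XX lam t m p.2) / lam ^ m⌋) hln (1 + 2 * D) (by
        intro p p' h
        have h3 := floor_eq_close hlm h
        have h4 : lam ^ m ≤ 1 := pow_le_one₀ h0.le h1.le
        have h5 := abs_le.1 h3
        have h6 := abs_le.1 (hD m p.2)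
        have h7 := abs_le.1 (hD m p'.2)
        have h8 : |XX lam t n p.1 / lam ^ n - XX lam t n p'.1 / lam ^ n| ≤ 1 + 2 * D := by
          rw [abs_le]; constructor <;> linarith
        rw [← sub_div, abs_div, abs_of_pos hln, div_le_iff₀ hln] at h8
        push_cast
        exact h8)
    rw [← e1] at h2
    refine le_trans (le_of_eq ?_) h2
    exact Ent_congr (by intro a b; simp [and_comm])
  rw [hY1, hτ] at hF
  have hF2 := hF.trans (sub_le_sub_right hU _)
  have e : EE lam t m = SE (XX lam t m) (lam ^ m) := rfl
  rw [← e, ← hmr] at hF2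
  have hx : g / (4 * q) * m ≤ g * n / 2 := by
    have h2 : g / (4 * q) * m ≤ g / (4 * q) * (2 * (q * n)) := by
      gcongr
      rw [hmr]; exact hT2'
    have h3 : g / (4 * q) * (2 * (q * n)) = g * n / 2 := by field_simp; ring
    linarith
  have hratio : g / 4 / Real.log N ≤ ((n * Real.log N - EE lam t n - g / (4 * q) * m) / (n * Real.log N)) := by
    rw [div_le_div_iff₀ hlN (by positivity)]
    have h2 : g / 4 * n ≤ n * Real.log N - EE lam t n - g / (4 * q) * m := by
      have : n * Real.log N = n * g + A * n := by rw [hg]; ring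
      linarith
    have := mul_le_mul_of_nonneg_right h2 hlN.le
    linarith
  have hEmu := hA1 m
  set rr := ((n * Real.log N - EE lam t n - g / (4 * q) * m) / (n * Real.log N)) with hrr
  clear_value rr
  have hrr1 : 0 ≤ g / 4 / Real.log N := by positivity
  -- E_m - log 5 + ((A+δ)m - E_m + log 5) ρ
  have hmn : (n:ℝ) ≤ m := by rw [hmr]; linarith
  have hmm : n * (3 * ε') ≤ m * (3 * ε') := by gcongr
  have hkey : 8 * ε' = δ * (g / 4 / Real.log N) := by rw [hε']; field_simp; ring
  push_cast at hE2
  set ρ := g / 4 / Real.log N with hρ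
  have hρ1 : ρ ≤ 1 := by
    rw [hρ, div_le_one hlN]
    have hA0 : 0 ≤ A := by
      by_contra hA0
      push Not at hA0
      obtain ⟨K, hK⟩ := exists_nat_gt (C / (-A))
      have := hA1 K
      have h5 : 0 ≤ EE lam t K := SE_nonneg _ _
      rw [div_lt_iff₀ (by linarith)] at hK
      linarith
    linarith
  clear_value ρ
  have hGBpos : 0 ≤ (A + δ) * m - (EE lam t m - Real.log 5) := by
    have h3 : C + C1 + Real.log 5 + 1 ≤ δ * m := by
      have h8 : ε' * 8 ≤ δ := by
        have := mul_le_mul_of_nonneg_left hρ1 hδ.le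
        linarith
      have h9 : (m:ℝ) * (ε' * 8) ≤ m * δ := by gcongr
      have : 0 ≤ (m:ℝ) * ε' := by positivity
      linarith
    linarith
  have f1 := mul_le_mul_of_nonneg_left hratio hGBpos
  -- bring together
  have f2 : EE lam t m - Real.log 5 + ((A + δ) * m - (EE lam t m - Real.log 5)) * ρ ≤ EE lam t (n + m) + C1 - EE lam t n := by linarith
  have f3 : (1 - ρ) * ((A - ε') * m - Real.log 5) ≤ (1 - ρ) * (EE lam t m - Real.log 5) := by
    apply mul_le_mul_of_nonneg_left _ (by linarith)
    linarith
  have f4 : (1 - ρ) * ((A - ε') * m - Real.log 5) + (A + δ) * m * ρ ≤ A * (n + m) + C + C1 - (A - ε') * n := by linarith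
  have f5 : δ * m * ρ = 8 * ε' * m := by rw [hkey]; ring
  have f6 : 0 ≤ ρ * Real.log 5 + ρ * ε' * m := by positivity
  have f7 : ε' * n ≤ ε' * m := by gcongr
  have f8 : 0 ≤ ε' * m := by positivity
  linarith

end hoch
end SA

namespace SA
open scoped Classical

section hout

/-- abstract Markov step: entropy close to maximal gives a large set of small fibres -/
lemma markov_fib {Ω α : Type} [Fintype Ω] [Nonempty Ω] (f : Ω → α) {H C e e1 : ℝ}
    (hI : ((Finset.univ.image f).card : ℝ) ≤ C * Real.exp H) (hE : H - e ≤ Ent f) (he1 : 0 < e1) :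
    (((Finset.univ.filter (fun ω => Fintype.card Ω * Real.exp (-(H - e1)) < fib f ω)).card : ℝ)) ≤
      (e + C) / e1 * Fintype.card Ω := by
  have hΩ := cardpos Ω
  set n : ℝ := (Fintype.card Ω : ℝ) with hn
  set S := Finset.univ.filter (fun ω => n * Real.exp (-(H - e1)) < fib f ω) with hS
  have key : ∀ ω, (if ω ∈ S then e1 else 0) ≤ (H - Real.log (n / fib f ω)) + n * Real.exp (-H) * (1 / fib f ω) := by
    intro ω
    have hf := fib_pos f ω
    have hx : n * Real.exp (-H) * (1 / fib f ω) = Real.exp (Real.log (n / fib f ω) - H) := by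
      rw [sub_eq_add_neg, Real.exp_add, Real.exp_log (by positivity)]; field_simp
    rw [hx]
    have h1 := Real.add_one_le_exp (Real.log (n / fib f ω) - H)
    have h2 := Real.exp_pos (Real.log (n / fib f ω) - H)
    split_ifs with h
    · have h3 : n * Real.exp (-(H - e1)) < fib f ω := (Finset.mem_filter.1 h).2
      have h4 : Real.log (n / fib f ω) < H - e1 := by
        rw [Real.log_lt_iff_lt_exp (by positivity), div_lt_iff₀ hf]
        rw [Real.exp_neg, ← div_eq_mul_inv, div_lt_iff₀ (Real.exp_pos _)] at h3
        linarith
      linarith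
    · linarith
  have hsum := Finset.sum_le_sum (fun ω (_ : ω ∈ Finset.univ) => key ω)
  rw [Finset.sum_add_distrib, Finset.sum_sub_distrib, ← Finset.mul_sum, Finset.sum_const, Finset.card_univ, nsmul_eq_mul,
    ← Finset.sum_filter, Finset.sum_const, nsmul_eq_mul] at hsum
  have e2 : Finset.univ.filter (fun ω => ω ∈ S) = S := by ext; simp
  rw [e2] at hsum
  have e3 : ∑ ω, Real.log (n / fib f ω) = n * Ent f := by
    unfold Ent av
    rw [← hn, mul_div_cancel₀ _ hΩ.ne']
  have e4 : ∑ ω, 1 / fib f ω = ((Finset.univ.image f).card : ℝ) := sum_inv_fiber Finset.univ f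
  rw [e3, e4] at hsum
  have h5 : n * Real.exp (-H) * ((Finset.univ.image f).card : ℝ) ≤ n * C := by
    calc n * Real.exp (-H) * ((Finset.univ.image f).card : ℝ) ≤ n * Real.exp (-H) * (C * Real.exp H) := by gcongr
      _ = n * C * (Real.exp (-H) * Real.exp H) := by ring
      _ = n * C := by rw [← Real.exp_add]; simp
  have h6 : n * (H - e) ≤ n * Ent f := by gcongr
  rw [div_mul_eq_mul_div, le_div_iff₀ he1]
  linarith

variable {N : ℕ} {lam : ℝ} [NeZero N]

lemma image_card_gen {Ω α : Type} [Fintype Ω] (f : Ω → α) : (Finset.univ.image f).card ≤ Fintype.card Ω :=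
  Finset.card_image_le.trans (by simp)

lemma image_int {Ω : Type} [Fintype Ω] (f : Ω → ℤ) (R : ℝ) (hR : 0 ≤ R) (h : ∀ ω, |(f ω : ℝ)| ≤ R) :
    ((Finset.univ.image f).card : ℝ) ≤ 2 * R + 1 := by
  have h1 : Finset.univ.image f ⊆ Finset.Icc (-⌊R⌋) ⌊R⌋ := by
    intro z hz
    obtain ⟨ω, _, rfl⟩ := Finset.mem_image.1 hz
    have := abs_le.1 (h ω)
    rw [Finset.mem_Icc]
    constructor
    · rw [neg_le]; apply Int.le_floor.2; push_cast; linarith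
    · apply Int.le_floor.2; linarith
  have h2 := Finset.card_le_card h1
  rw [Int.card_Icc] at h2
  have h3 : 0 ≤ ⌊R⌋ := Int.floor_nonneg.2 hR
  have h4 : (((Finset.univ.image f).card : ℤ)) ≤ 2 * ⌊R⌋ + 1 := by omega
  have h5 : ((Finset.univ.image f).card : ℝ) ≤ 2 * ⌊R⌋ + 1 := by exact_mod_cast h4
  have := Int.floor_le R
  linarith

lemma two_cells {Ω α : Type} [Fintype Ω] (f : Ω → α) (G : Finset Ω) (M : ℝ) (hG : ∀ ω ∈ G, fib f ω ≤ M) (hM : 0 ≤ M)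
    (P : Ω → Prop) [DecidablePred P] (a b : α) (hP : ∀ ω, P ω → f ω = a ∨ f ω = b) : ((G.filter P).card : ℝ) ≤ 2 * M := by
  have one : ∀ a : α, ((G.filter (fun ω => f ω = a)).card : ℝ) ≤ M := by
    intro a
    by_cases h : (G.filter (fun ω => f ω = a)).Nonempty
    · obtain ⟨ω, hω⟩ := h
      rw [Finset.mem_filter] at hω
      refine le_trans ?_ (hG ω hω.1)
      unfold fib
      rw [Nat.cast_le]
      apply Finset.card_le_card
      intro x hx
      rw [Finset.mem_filter] at hx ⊢
      exact ⟨Finset.mem_univ _, hx.2.trans hω.2.symm⟩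
    · rw [Finset.not_nonempty_iff_eq_empty] at h
      rw [h]; simpa using hM
  have h1 : G.filter P ⊆ G.filter (fun ω => f ω = a) ∪ G.filter (fun ω => f ω = b) := by
    intro ω hω
    rw [Finset.mem_filter] at hω
    rw [Finset.mem_union, Finset.mem_filter, Finset.mem_filter]
    rcases hP ω hω.2 with h | h
    · exact Or.inl ⟨hω.1, h⟩
    · exact Or.inr ⟨hω.1, h⟩
  have h2 : ((G.filter P).card : ℝ) ≤ (G.filter (fun ω => f ω = a)).card + (G.filter (fun ω => f ω = b)).card := by
    exact_mod_cast (Finset.card_le_card h1).trans (Finset.card_union_le _ _)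
  have := one a
  have := one b
  linarith

lemma floor_two {x y r : ℝ} (hr : 0 < r) (h1 : x ≤ y) (h2 : y ≤ x + r) : ⌊y / r⌋ = ⌊x / r⌋ ∨ ⌊y / r⌋ = ⌊x / r⌋ + 1 := by
  have h3 : ⌊x / r⌋ ≤ ⌊y / r⌋ := Int.floor_le_floor (by gcongr)
  have h4 : ⌊y / r⌋ ≤ ⌊x / r⌋ + 1 := by
    rw [← Int.floor_add_one]
    apply Int.floor_le_floor
    rw [div_add_one hr.ne']
    gcongr
  omega

theorem hochman_out (hN : 2 ≤ N) (h0 : 0 < lam) (h1 : lam < 1) (t : Fin N → ℝ) (hE : HochmanESC N (fun _ => lam) t)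
    {ε : ℝ} (hε : 0 < ε) : ∃ L0 : ℕ, ∀ L ≥ L0, ∃ G : Finset (Fin L → Fin N), ((Gᶜ).card : ℝ) ≤ ε * (N:ℝ) ^ L ∧
      ∀ x : ℝ, ((G.filter (fun w => x ≤ XX lam t L w ∧ XX lam t L w ≤ x + lam ^ L)).card : ℝ) ≤
        2 * ((N:ℝ) ^ L * Real.exp (-(L * (min (Real.log N) (-Real.log lam) - ε)))) := by
  obtain ⟨A, C, hC, hA1, hA2⟩ := exists_A h0 h1 t
  have hA := hochman_A hN h0 h1 t hE hC hA1 hA2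
  obtain ⟨D, hD⟩ := XX_bdd h0 h1 t
  set h := min (Real.log N) (-Real.log lam) with hh
  obtain ⟨n0, hn0⟩ := hA2 (ε * ε / 2) (by positivity)
  obtain ⟨M, hM⟩ := exists_nat_ge (2 * (2 * D + 3) / (ε * ε))
  refine ⟨max (max n0 M) 1, ?_⟩
  intro L hL
  have hL1 : n0 ≤ L := (le_max_left _ _).trans ((le_max_left _ _).trans hL)
  have hL2 : M ≤ L := (le_max_right _ _).trans ((le_max_left _ _).trans hL)
  have hL3 : 1 ≤ L := (le_max_right _ _).trans hL
  have hL3' : (1:ℝ) ≤ L := by exact_mod_cast hL3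
  have hL4 : 2 * (2 * D + 3) / (ε * ε) ≤ L := hM.trans (by exact_mod_cast hL2)
  rw [div_le_iff₀ (by positivity)] at hL4
  have hlL : 0 < lam ^ L := pow_pos h0 L
  have hN0 : (0:ℝ) < N := by positivity
  have hcard : (Fintype.card (Fin L → Fin N) : ℝ) = (N:ℝ) ^ L := by
    rw [Fintype.card_fun, Fintype.card_fin, Fintype.card_fin]; push_cast; rfl
  set f : (Fin L → Fin N) → ℤ := fun w => ⌊XX lam t L w / lam ^ L⌋ with hf
  have hI0 : ((Finset.univ.image f).card : ℝ) ≤ (2 * D + 3) * Real.exp (L * h) := by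
    rcases le_total (Real.log N) (-Real.log lam) with hc | hc
    · have e : h = Real.log N := min_eq_left hc
      have h2 : ((Finset.univ.image f).card : ℝ) ≤ (N:ℝ) ^ L := by
        rw [← hcard]
        exact_mod_cast Finset.card_image_le
      rw [e, mul_comm (L:ℝ), Real.exp_mul, Real.exp_log hN0, Real.rpow_natCast]
      have : (0:ℝ) < (N:ℝ) ^ L := by positivity
      have : (0:ℝ) ≤ D := by positivity
      nlinarith
    · have e : h = -Real.log lam := min_eq_right hc
      have h2 : Real.exp (L * h) = (lam ^ L)⁻¹ := by
        rw [e, mul_comm (L:ℝ), Real.exp_mul, Real.exp_neg, Real.exp_log h0, Real.rpow_natCast, inv_pow]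
      have h3 := image_int f (D / lam ^ L + 1) (by positivity) (by
        intro ω
        have h4 := abs_le.1 (hD L ω)
        have h5 := Int.floor_le (XX lam t L ω / lam ^ L)
        have h6 := Int.lt_floor_add_one (XX lam t L ω / lam ^ L)
        have h7 : XX lam t L ω / lam ^ L ≤ D / lam ^ L := by gcongr; exact h4.2
        have h8 : -(D / lam ^ L) ≤ XX lam t L ω / lam ^ L := by rw [← neg_div]; gcongr; exact h4.1
        rw [abs_le]
        constructor <;> simp only [hf] <;> linarith)
      have h9 : 1 ≤ (lam ^ L)⁻¹ := by
        rw [one_le_inv₀ hlL]; exact pow_le_one₀ h0.le h1.le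
      have h10 : ((Finset.univ.image f).card : ℝ) ≤ (2 * D + 3) * Real.exp (L * h) := by
        rw [h2]
        rw [div_eq_mul_inv] at h3
        have : (0:ℝ) ≤ D := by positivity
        nlinarith
      exact h10
  have hEnt : L * h - L * (ε * ε / 2) ≤ Ent f := by
    have h2 := hn0 L hL1
    have h3 : (A - ε * ε / 2) * L ≥ (h - ε * ε / 2) * L := by gcongr
    have h4 : EE lam t L = Ent f := rfl
    linarith
  have hmk := markov_fib f (H := L * h) (C := 2 * D + 3) (e := L * (ε * ε / 2)) (e1 := L * ε) (by
    refine le_trans (le_of_eq ?_) hI0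
    congr
    exact Subsingleton.elim _ _) hEnt (by positivity)
  rw [hcard] at hmk
  refine ⟨Finset.univ.filter (fun w => ¬ ((N:ℝ) ^ L * Real.exp (-(L * h - L * ε)) < fib f w)), ?_, ?_⟩
  · rw [Finset.compl_filter]
    simp only [not_not]
    refine hmk.trans ?_
    gcongr
    rw [div_le_iff₀ (by positivity)]
    linarith
  · intro x
    refine two_cells f _ _ ?_ (by positivity) _ ⌊x / lam ^ L⌋ (⌊x / lam ^ L⌋ + 1) ?_
    rotate_left
    · intro w hw
      exact floor_two hlL hw.1 hw.2
    · intro w hw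
      have := (Finset.mem_filter.1 hw).2
      push Not at this
      rw [mul_sub]
      exact this

end hout
end SA

namespace SA
open scoped Classical

section exop
variable {I : Type}

/-- indicator of a proposition -/
def ind (P : Prop) : ℝ := if P then 1 else 0

lemma ind_nonneg (P : Prop) : 0 ≤ ind P := by unfold ind; split_ifs <;> norm_num
lemma ind_le_one (P : Prop) : ind P ≤ 1 := by unfold ind; split_ifs <;> norm_num
lemma ind_true {P : Prop} (h : P) : ind P = 1 := by unfold ind; rw [if_pos h]
lemma ind_false {P : Prop} (h : ¬ P) : ind P = 0 := by unfold ind; rw [if_neg h]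
lemma ind_mono {P Q : Prop} (h : P → Q) : ind P ≤ ind Q := by
  by_cases hP : P
  · rw [ind_true hP, ind_true (h hP)]
  · rw [ind_false hP]; exact ind_nonneg _

/-- expectation over independent uniform choices from the sets `k i`, `i ∈ e` -/
def Ex (k : I → Finset I) : List I → (List I → ℝ) → ℝ
  | [], F => F []
  | i :: e, F => (∑ a ∈ k i, Ex k e (fun l => F (a :: l))) / ((k i).card : ℝ)

/-- support of `Ex` -/
def Sp (k : I → Finset I) : List I → Finset (List I)
  | [] => {[]}
  | i :: e => (k i ×ˢ Sp k e).map ⟨fun p => p.1 :: p.2, fun p q h => by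
      have := List.cons.inj h
      exact Prod.ext this.1 this.2⟩

variable {k : I → Finset I}

lemma Ex_repr (e : List I) (F : List I → ℝ) : Ex k e F = (∑ l ∈ Sp k e, F l) / ((Sp k e).card : ℝ) := by
  induction e generalizing F with
  | nil => simp [Ex, Sp]
  | cons i e ih =>
    simp only [Ex, Sp]
    rw [Finset.sum_map, Finset.sum_product, Finset.card_map, Finset.card_product]
    simp only [ih]
    rw [← Finset.sum_div, div_div]
    push_cast
    rw [mul_comm ((Sp k e).card : ℝ)]
    rfl

lemma mem_Sp_cons {i : I} {e l : List I} : l ∈ Sp k (i :: e) ↔ ∃ a ∈ k i, ∃ l' ∈ Sp k e, l = a :: l' := by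
  simp only [Sp, Finset.mem_map, Finset.mem_product, Prod.exists]
  constructor
  · rintro ⟨a, l', ⟨h1, h2⟩, rfl⟩; exact ⟨a, h1, l', h2, rfl⟩
  · rintro ⟨a, h1, l', h2, rfl⟩; exact ⟨a, l', ⟨h1, h2⟩, rfl⟩

lemma Sp_length {e l : List I} (h : l ∈ Sp k e) : l.length = e.length := by
  induction e generalizing l with
  | nil => simp [Sp] at h; simp [h]
  | cons i e ih =>
    obtain ⟨a, _, l', h2, rfl⟩ := mem_Sp_cons.1 h
    simp [ih h2]

lemma Sp_self (hk : ∀ i, i ∈ k i) (e : List I) : e ∈ Sp k e := by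
  induction e with
  | nil => simp [Sp]
  | cons i e ih => exact mem_Sp_cons.2 ⟨i, hk i, e, ih, rfl⟩

lemma Sp_card (hk : ∀ i, i ∈ k i) (e : List I) : (0:ℝ) < (Sp k e).card := by
  have : 0 < (Sp k e).card := Finset.card_pos.2 ⟨e, Sp_self hk e⟩
  exact_mod_cast this

lemma Ex_mono {e : List I} {F F' : List I → ℝ} (h : ∀ l ∈ Sp k e, F l ≤ F' l) : Ex k e F ≤ Ex k e F' := by
  rw [Ex_repr, Ex_repr]
  gcongr with l hl
  exact h l hl

lemma Ex_congr {e : List I} {F F' : List I → ℝ} (h : ∀ l ∈ Sp k e, F l = F' l) : Ex k e F = Ex k e F' := by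
  rw [Ex_repr, Ex_repr, Finset.sum_congr rfl h]

lemma Ex_const (hk : ∀ i, i ∈ k i) (e : List I) (x : ℝ) : Ex k e (fun _ => x) = x := by
  have := Sp_card hk e
  rw [Ex_repr, Finset.sum_const, nsmul_eq_mul]; field_simp

lemma Ex_add (e : List I) (F F' : List I → ℝ) : Ex k e (fun l => F l + F' l) = Ex k e F + Ex k e F' := by
  rw [Ex_repr, Ex_repr, Ex_repr, Finset.sum_add_distrib, add_div]

lemma Ex_mul (e : List I) (x : ℝ) (F : List I → ℝ) : Ex k e (fun l => x * F l) = x * Ex k e F := by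
  rw [Ex_repr, Ex_repr, ← Finset.mul_sum, mul_div_assoc]

lemma Ex_mul_right (e : List I) (x : ℝ) (F : List I → ℝ) : Ex k e (fun l => F l * x) = Ex k e F * x := by
  rw [Ex_repr, Ex_repr, ← Finset.sum_mul, mul_div_right_comm]

lemma Ex_sum {κ : Type} (s : Finset κ) (e : List I) (F : κ → List I → ℝ) :
    Ex k e (fun l => ∑ j ∈ s, F j l) = ∑ j ∈ s, Ex k e (F j) := by
  simp only [Ex_repr]
  rw [Finset.sum_comm, Finset.sum_div]

lemma Ex_nonneg {e : List I} {F : List I → ℝ} (h : ∀ l ∈ Sp k e, 0 ≤ F l) : 0 ≤ Ex k e F := by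
  rw [Ex_repr]
  exact div_nonneg (Finset.sum_nonneg h) (by positivity)

lemma Ex_swap {k' : I → Finset I} (e e' : List I) (F : List I → List I → ℝ) :
    Ex k e (fun l => Ex k' e' (fun l' => F l l')) = Ex k' e' (fun l' => Ex k e (fun l => F l l')) := by
  simp only [Ex_repr]
  rw [← Finset.sum_div, ← Finset.sum_div, Finset.sum_comm, div_right_comm]

lemma Ex_append (e1 e2 : List I) (F : List I → ℝ) :
    Ex k (e1 ++ e2) F = Ex k e1 (fun l1 => Ex k e2 (fun l2 => F (l1 ++ l2))) := by
  induction e1 generalizing F with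
  | nil => rfl
  | cons i e ih =>
    simp only [List.cons_append, Ex]
    simp only [ih]

lemma Sp_append {e1 e2 l1 l2 : List I} (h1 : l1 ∈ Sp k e1) (h2 : l2 ∈ Sp k e2) : l1 ++ l2 ∈ Sp k (e1 ++ e2) := by
  induction e1 generalizing l1 with
  | nil => simp [Sp] at h1; simp [h1, h2]
  | cons i e ih =>
    obtain ⟨a, ha, l', h3, rfl⟩ := mem_Sp_cons.1 h1
    exact mem_Sp_cons.2 ⟨a, ha, _, ih h3, rfl⟩

/-- collision inequality for exact coincidences -/
lemma coll {A B κ : Type} (S : Finset A) (T : Finset B) (f : A → κ) (g : B → κ) :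
    (∑ a ∈ S, (∑ b ∈ T, ind (f a = g b)) / T.card) / S.card ≤
      ((∑ a ∈ S, (∑ a' ∈ S, ind (f a = f a')) / S.card) / S.card +
        (∑ b ∈ T, (∑ b' ∈ T, ind (g b = g b')) / T.card) / T.card) / 2 := by
  set W := S.image f ∪ T.image g with hW
  set p : κ → ℝ := fun j => (∑ a ∈ S, ind (f a = j)) / S.card with hp
  set q : κ → ℝ := fun j => (∑ b ∈ T, ind (g b = j)) / T.card with hq
  have key : ∀ {A' B' : Type} (S' : Finset A') (T' : Finset B') (f' : A' → κ) (g' : B' → κ), S'.image f' ⊆ W →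
      (∑ a ∈ S', (∑ b ∈ T', ind (f' a = g' b)) / T'.card) / S'.card =
        ∑ j ∈ W, ((∑ a ∈ S', ind (f' a = j)) / S'.card) * ((∑ b ∈ T', ind (g' b = j)) / T'.card) := by
    intro A' B' S' T' f' g' hS'
    have h1 : ∀ j, ((∑ a ∈ S', ind (f' a = j)) / S'.card) * ((∑ b ∈ T', ind (g' b = j)) / T'.card) =
        (∑ a ∈ S', (∑ b ∈ T', ind (f' a = j) * ind (g' b = j))) / (S'.card * T'.card) := by
      intro j
      rw [div_mul_div_comm, Finset.sum_mul_sum]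
    simp only [h1]
    rw [← Finset.sum_div, ← Finset.sum_div, div_div, mul_comm (T'.card : ℝ)]
    congr 1
    rw [Finset.sum_comm (s := W)]
    apply Finset.sum_congr rfl
    intro a ha
    rw [Finset.sum_comm]
    apply Finset.sum_congr rfl
    intro b hb
    rw [Finset.sum_eq_single (f' a)]
    · rw [ind_true rfl, one_mul]
      unfold ind; simp only [eq_comm]
    · intro j _ hj
      rw [ind_false (fun h => hj h.symm), zero_mul]
    · intro h
      exact absurd (hS' (Finset.mem_image_of_mem _ ha)) h
  rw [key S T f g Finset.subset_union_left, key S S f f Finset.subset_union_left, key T T g g Finset.subset_union_right,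
    ← Finset.sum_add_distrib, Finset.sum_div]
  apply Finset.sum_le_sum
  intro j _
  nlinarith [sq_nonneg ((∑ a ∈ S, ind (f a = j)) / S.card - (∑ b ∈ T, ind (g b = j)) / (T.card : ℝ))]

lemma Ex_coll {k' : I → Finset I} {κ : Type} (e e' : List I) (f g : List I → κ) :
    Ex k e (fun l => Ex k' e' (fun l' => ind (f l = g l'))) ≤
      (Ex k e (fun l => Ex k e (fun l' => ind (f l = f l'))) + Ex k' e' (fun l => Ex k' e' (fun l' => ind (g l = g l')))) / 2 := by
  simp only [Ex_repr]
  exact coll _ _ f g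

/-- grid index -/
def grd (ρ : ℝ) (p : ℝ × ℝ) : ℤ × ℤ := (⌊p.1 / ρ⌋, ⌊p.2 / ρ⌋)

lemma grd_eq {ρ : ℝ} (hρ : 0 < ρ) {p q : ℝ × ℝ} (h : grd ρ p = grd ρ q) : dist p q ≤ ρ := by
  have h1 := floor_eq_close hρ (Prod.mk.inj h).1
  have h2 := floor_eq_close hρ (Prod.mk.inj h).2
  rw [Prod.dist_eq, Real.dist_eq, Real.dist_eq]
  exact max_le h1 h2

lemma floor_nb {ρ x y : ℝ} (hρ : 0 < ρ) (h : |x - y| ≤ ρ) : ∃ d ∈ Finset.Icc (-1:ℤ) 1, ⌊x / ρ⌋ + d = ⌊y / ρ⌋ := by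
  have h1 := abs_le.1 h
  rcases le_total x y with hxy | hxy
  · rcases floor_two hρ hxy (by linarith) with h2 | h2
    · exact ⟨0, by decide, by omega⟩
    · exact ⟨1, by decide, by omega⟩
  · rcases floor_two hρ hxy (by linarith) with h2 | h2
    · exact ⟨0, by decide, by omega⟩
    · exact ⟨-1, by decide, by omega⟩

lemma Ex_close {k' : I → Finset I} (e e' : List I) (f g : List I → ℝ × ℝ) {ρ : ℝ} (hρ : 0 < ρ) :
    Ex k e (fun l => Ex k' e' (fun l' => ind (dist (f l) (g l') ≤ ρ))) ≤
      9 / 2 * (Ex k e (fun l => Ex k e (fun l' => ind (dist (f l) (f l') ≤ ρ))) +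
        Ex k' e' (fun l => Ex k' e' (fun l' => ind (dist (g l) (g l') ≤ ρ)))) := by
  set Q := Finset.Icc (-1:ℤ) 1 ×ˢ Finset.Icc (-1:ℤ) 1 with hQ
  have h1 : Ex k e (fun l => Ex k' e' (fun l' => ind (dist (f l) (g l') ≤ ρ))) ≤
      ∑ d ∈ Q, Ex k e (fun l => Ex k' e' (fun l' => ind (grd ρ (f l) + d = grd ρ (g l')))) := by
    rw [← Ex_sum]
    apply Ex_mono
    intro l _
    rw [← Ex_sum]
    apply Ex_mono
    intro l' _
    by_cases h : dist (f l) (g l') ≤ ρ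
    · rw [ind_true h]
      rw [Prod.dist_eq, Real.dist_eq, Real.dist_eq] at h
      obtain ⟨d1, hd1, e1⟩ := floor_nb hρ ((le_max_left _ _).trans h)
      obtain ⟨d2, hd2, e2⟩ := floor_nb hρ ((le_max_right _ _).trans h)
      have h2 := Finset.single_le_sum (f := fun d => ind (grd ρ (f l) + d = grd ρ (g l'))) (s := Q) (fun d _ => ind_nonneg _)
        (a := (d1, d2)) (Finset.mem_product.2 ⟨hd1, hd2⟩)
      refine le_trans (le_of_eq ?_) h2
      rw [ind_true]
      exact Prod.ext e1 e2
    · rw [ind_false h]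
      exact Finset.sum_nonneg (fun d _ => ind_nonneg _)
  refine h1.trans ?_
  have h2 : ∀ d ∈ Q, Ex k e (fun l => Ex k' e' (fun l' => ind (grd ρ (f l) + d = grd ρ (g l')))) ≤
      1 / 2 * (Ex k e (fun l => Ex k e (fun l' => ind (dist (f l) (f l') ≤ ρ))) +
        Ex k' e' (fun l => Ex k' e' (fun l' => ind (dist (g l) (g l') ≤ ρ)))) := by
    intro d _
    have h3 := Ex_coll (k := k) (k' := k') e e' (fun l => grd ρ (f l) + d) (fun l => grd ρ (g l))
    have h4 : Ex k e (fun l => Ex k e (fun l' => ind (grd ρ (f l) + d = grd ρ (f l') + d))) ≤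
        Ex k e (fun l => Ex k e (fun l' => ind (dist (f l) (f l') ≤ ρ))) := by
      apply Ex_mono; intro l _; apply Ex_mono; intro l' _
      exact ind_mono (fun h => grd_eq hρ (add_right_cancel h))
    have h5 : Ex k' e' (fun l => Ex k' e' (fun l' => ind (grd ρ (g l) = grd ρ (g l')))) ≤
        Ex k' e' (fun l => Ex k' e' (fun l' => ind (dist (g l) (g l') ≤ ρ))) := by
      apply Ex_mono; intro l _; apply Ex_mono; intro l' _
      exact ind_mono (fun h => grd_eq hρ h)
    linarith
  refine (Finset.sum_le_sum h2).trans (le_of_eq ?_)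
  rw [Finset.sum_const, nsmul_eq_mul]
  have : Q.card = 9 := by rw [hQ]; rfl
  rw [this]; push_cast; ring

end exop
end SA

namespace SA
open scoped Classical

section blk
variable {I : Type}

/-- horizontal translation part of a word -/
def UU (c : ℝ) (u : I → ℝ) : List I → ℝ
  | [] => 0
  | i :: l => c * UU c u l + u i

/-- minus the slope of a word -/
def ZZ (τ : ℝ) (z : I → ℝ) : List I → ℝ
  | [] => 0
  | i :: l => τ ^ l.length * z i + ZZ τ z l

/-- vertical translation part of a word -/
def VV (c b : ℝ) (u v z : I → ℝ) : List I → ℝ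
  | [] => 0
  | i :: l => -b * z i * UU c u l + b * VV c b u v z l + v i

/-- the base point of a word -/
def pt (c b : ℝ) (u v z : I → ℝ) (l : List I) : ℝ × ℝ := (UU c u l, VV c b u v z l)

lemma UU_append (c : ℝ) (u : I → ℝ) (l1 l2 : List I) : UU c u (l1 ++ l2) = UU c u l1 + c ^ l1.length * UU c u l2 := by
  induction l1 with
  | nil => simp [UU]
  | cons i l ih => simp only [List.cons_append, UU, ih, List.length_cons, pow_succ]; ring

lemma ZZ_append (τ : ℝ) (z : I → ℝ) (l1 l2 : List I) : ZZ τ z (l1 ++ l2) = τ ^ l2.length * ZZ τ z l1 + ZZ τ z l2 := by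
  induction l1 with
  | nil => simp [ZZ]
  | cons i l ih => simp only [List.cons_append, ZZ, ih, List.length_append, pow_add]; ring

lemma VV_append {c b : ℝ} (hb : b ≠ 0) (u v z : I → ℝ) (l1 l2 : List I) :
    VV c b u v z (l1 ++ l2) = VV c b u v z l1 + b ^ l1.length * (VV c b u v z l2 - ZZ (c / b) z l1 * UU c u l2) := by
  induction l1 with
  | nil => simp [VV, ZZ]
  | cons i l ih =>
    simp only [List.cons_append, VV, ih, UU_append, ZZ, List.length_cons, pow_succ]
    have : b ^ l.length * (c / b) ^ l.length = c ^ l.length := by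
      rw [← mul_pow, mul_div_cancel₀ _ hb]
    linear_combination (-(b * z i * UU c u l2)) * (-this)

/-- the environment cell of a symbol: the whole good set or a singleton -/
def cell (G : Finset I) (i : I) : Finset I := if i ∈ G then G else {i}

lemma cell_self (G : Finset I) (i : I) : i ∈ cell G i := by
  unfold cell; split_ifs with h
  · exact h
  · simp

/-- number of bad symbols -/
def bd (G : Finset I) : List I → ℕ
  | [] => 0
  | i :: l => bd G l + if i ∈ G then 0 else 1

lemma bd_append (G : Finset I) (l1 l2 : List I) : bd G (l1 ++ l2) = bd G l1 + bd G l2 := by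
  induction l1 with
  | nil => simp [bd]
  | cons i l ih => simp only [List.cons_append, bd, ih]; ring

lemma bd_Sp {G : Finset I} {e l : List I} (h : l ∈ Sp (cell G) e) : bd G l = bd G e := by
  induction e generalizing l with
  | nil => simp [Sp] at h; simp [h]
  | cons i e ih =>
    obtain ⟨a, ha, l', h2, rfl⟩ := mem_Sp_cons.1 h
    simp only [bd, ih h2]
    unfold cell at ha
    split_ifs at ha with hi
    · simp [ha, hi]
    · simp at ha; simp [ha]

lemma cover_card (G : Finset I) (f : I → ℝ) {r M : ℝ} (hr : 0 < r)
    (h : ∀ x, ((G.filter (fun i => x ≤ f i ∧ f i ≤ x + r)).card : ℝ) ≤ M) (m : ℕ) :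
    ∀ x, ((G.filter (fun i => x ≤ f i ∧ f i ≤ x + (m + 1) * r)).card : ℝ) ≤ (m + 1) * M := by
  induction m with
  | zero => intro x; simpa using h x
  | succ m ih =>
    intro x
    have h1 := ih x
    have h2 := h (x + (m + 1) * r)
    have h3 : G.filter (fun i => x ≤ f i ∧ f i ≤ x + ((m + 1 : ℕ) + 1) * r) ⊆
        G.filter (fun i => x ≤ f i ∧ f i ≤ x + (m + 1) * r) ∪ G.filter (fun i => x + (m + 1) * r ≤ f i ∧ f i ≤ x + (m + 1) * r + r) := by
      intro i hi
      simp only [Finset.mem_filter, Finset.mem_union] at hi ⊢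
      push_cast at hi
      rcases le_total (f i) (x + (m + 1) * r) with h5 | h5
      · left; exact ⟨hi.1, hi.2.1, h5⟩
      · right; exact ⟨hi.1, h5, by linarith [hi.2.2]⟩
    have h4 : ((G.filter (fun i => x ≤ f i ∧ f i ≤ x + ((m + 1 : ℕ) + 1) * r)).card : ℝ) ≤
        (G.filter (fun i => x ≤ f i ∧ f i ≤ x + (m + 1) * r)).card + (G.filter (fun i => x + (m + 1) * r ≤ f i ∧ f i ≤ x + (m + 1) * r + r)).card := by
      exact_mod_cast (Finset.card_le_card h3).trans (Finset.card_union_le _ _)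
    push_cast at h4 ⊢
    linarith

lemma ind_cover (y x : ℝ) {r : ℝ} (hr : 0 < r) (m : ℕ) (hm : 1 ≤ m) :
    ind (|y - x| ≤ m * r) ≤ ∑ i ∈ Finset.range m, ind (|y - (x - m * r + (2 * i + 1) * r)| ≤ r) := by
  by_cases h : |y - x| ≤ m * r
  · rw [ind_true h]
    have h1 := abs_le.1 h
    -- choose the index
    set s := (y - x + m * r) / (2 * r) with hs
    have hs0 : 0 ≤ s := div_nonneg (by linarith) (by linarith)
    have hsm : s ≤ m := by rw [hs, div_le_iff₀ (by linarith)]; linarith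
    have hsy : y - x + m * r = s * (2 * r) := by rw [hs]; field_simp
    obtain ⟨i, hi, h2, h3⟩ : ∃ i : ℕ, i < m ∧ (i:ℝ) ≤ s ∧ s ≤ i + 1 := by
      by_cases h4 : ⌊s⌋₊ < m
      · exact ⟨⌊s⌋₊, h4, Nat.floor_le hs0, (Nat.lt_floor_add_one s).le⟩
      · refine ⟨m - 1, by omega, ?_, ?_⟩
        · have : ((⌊s⌋₊ : ℕ) : ℝ) ≤ s := Nat.floor_le hs0
          have h5 : (m:ℝ) ≤ (⌊s⌋₊ : ℕ) := by exact_mod_cast not_lt.1 h4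
          rw [Nat.cast_sub hm]; push_cast; linarith
        · rw [Nat.cast_sub hm]; push_cast; linarith
    have h6 := Finset.single_le_sum (f := fun i : ℕ => ind (|y - (x - m * r + (2 * i + 1) * r)| ≤ r)) (s := Finset.range m)
      (fun d _ => ind_nonneg _) (Finset.mem_range.2 hi)
    refine le_trans (le_of_eq ?_) h6
    rw [ind_true]
    have h7 := mul_le_mul_of_nonneg_right h2 hr.le
    have h8 := mul_le_mul_of_nonneg_right h3 hr.le
    rw [abs_le]
    constructor <;> linarith
  · rw [ind_false h]
    exact Finset.sum_nonneg (fun d _ => ind_nonneg _)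

lemma avg_ind_le (G : Finset I) (hG : (0:ℝ) < G.card) (P Q : I → Prop) [DecidablePred Q] (hPQ : ∀ i, P i → Q i) {M : ℝ} (h : ((G.filter Q).card : ℝ) ≤ M * G.card) :
    (∑ i ∈ G, ind (P i)) / G.card ≤ M := by
  rw [div_le_iff₀ hG]
  refine le_trans ?_ h
  rw [Finset.card_filter]
  push_cast
  apply Finset.sum_le_sum
  intro i _
  by_cases hp : P i
  · rw [ind_true hp, if_pos (hPQ i hp)]
  · rw [ind_false hp]; split_ifs <;> norm_num

variable {c b : ℝ} {u v z : I → ℝ} {G : Finset I} {Z : ℕ} {a p : ℝ}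

lemma Ex_cell_ind (i : I) (P Q : I → Prop) [DecidablePred Q] (hPQ : ∀ i, P i → Q i) {M : ℝ} (hM : 0 < M)
    (h : ((G.filter Q).card : ℝ) ≤ M * G.card) :
    (∑ x ∈ cell G i, ind (P x)) / ((cell G i).card : ℝ) ≤ M * (M⁻¹) ^ (if i ∈ G then 0 else 1) := by
  unfold cell
  split_ifs with hi
  · rw [pow_zero, mul_one]
    apply avg_ind_le G _ P Q hPQ h
    have : 0 < G.card := Finset.card_pos.2 ⟨i, hi⟩
    exact_mod_cast this
  · rw [pow_one, mul_inv_cancel₀ hM.ne']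
    simp
    exact ind_le_one _

theorem QH (hc0 : 0 < c) (hc1 : c < 1) (hU : ∀ l, 0 ≤ UU c u l ∧ UU c u l ≤ 1) (ha0 : 0 < a)
    (hH : ∀ x, ((G.filter (fun i => x ≤ u i ∧ u i ≤ x + c)).card : ℝ) ≤ a / 3 * G.card) (e : List I) :
    ∀ (x ρ : ℝ), ρ ≤ c ^ e.length → Ex (cell G) e (fun l => ind (|UU c u l - x| ≤ ρ)) ≤ a ^ e.length * (a⁻¹) ^ bd G e := by
  induction e with
  | nil => intro x ρ _; simp [Ex, bd]; exact ind_le_one _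
  | cons i e ih =>
    intro x ρ hρ
    simp only [Ex, bd, List.length_cons]
    have hρc : ρ ≤ c := hρ.trans (pow_le_of_le_one hc0.le hc1.le (by simp))
    set E := a ^ e.length * (a⁻¹) ^ bd G e with hE
    have hE0 : 0 ≤ E := by positivity
    have h1 : ∀ y, Ex (cell G) e (fun l => ind (|UU c u (y :: l) - x| ≤ ρ)) ≤ ind (x - 2 * c ≤ u y ∧ u y ≤ x + c) * E := by
      intro y
      by_cases h : x - 2 * c ≤ u y ∧ u y ≤ x + c
      · rw [ind_true h, one_mul]
        refine le_trans (Ex_mono ?_) (ih ((x - u y) / c) (ρ / c) ?_)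
        · intro l _
          apply ind_mono
          intro h2
          simp only [UU] at h2
          have h3 : UU c u l - (x - u y) / c = (c * UU c u l + u y - x) / c := by field_simp; ring
          rw [h3, abs_div, abs_of_pos hc0]
          gcongr
        · rw [div_le_iff₀ hc0, ← pow_succ]; exact hρ
      · rw [ind_false h, zero_mul]
        rw [← Ex_const (k := cell G) (cell_self G) e 0]
        apply Ex_mono
        intro l _
        rw [ind_false]
        intro h2
        apply h
        simp only [UU] at h2
        have h3 := abs_le.1 h2
        have h4 := hU l
        have h5 : c * UU c u l ≤ c * 1 := by gcongr; exact h4.2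
        have h6 : 0 ≤ c * UU c u l := mul_nonneg hc0.le h4.1
        constructor <;> linarith
    have h7 : ((G.filter (fun i => x - 2 * c ≤ u i ∧ u i ≤ x - 2 * c + ((2:ℕ) + 1) * c)).card : ℝ) ≤ a * G.card := by
      have := cover_card G u hc0 hH 2 (x - 2 * c)
      refine this.trans (le_of_eq ?_)
      push_cast
      ring
    have h8 := Ex_cell_ind i (fun y => x - 2 * c ≤ u y ∧ u y ≤ x + c) _ (fun y hy => ⟨hy.1, by push_cast; linarith [hy.2]⟩) ha0 h7
    calc (∑ y ∈ cell G i, Ex (cell G) e (fun l => ind (|UU c u (y :: l) - x| ≤ ρ))) / ((cell G i).card : ℝ)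
        ≤ (∑ y ∈ cell G i, ind (x - 2 * c ≤ u y ∧ u y ≤ x + c) * E) / ((cell G i).card : ℝ) := by
          gcongr with y hy
          exact h1 y
      _ = (∑ y ∈ cell G i, ind (x - 2 * c ≤ u y ∧ u y ≤ x + c)) / ((cell G i).card : ℝ) * E := by
          rw [← Finset.sum_mul, mul_div_right_comm]
      _ ≤ (a * (a⁻¹) ^ (if i ∈ G then 0 else 1)) * E := by gcongr
      _ = _ := by rw [hE, pow_succ, pow_add]; ring

theorem QB {τ : ℝ} (ht0 : 0 < τ) (ht1 : τ < 1) (hZ1 : 1 ≤ Z) (hZ : ∀ l, |ZZ τ z l| ≤ Z) (hp0 : 0 < p) (hp1 : p ≤ 1)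
    (hB : ∀ x, ((G.filter (fun i => x ≤ z i ∧ z i ≤ x + τ)).card : ℝ) ≤ p / (2 * Z + 2) * G.card) (e : List I) :
    ∀ (j : ℕ) (x : ℝ), j ≤ e.length → Ex (cell G) e (fun l => ind (|ZZ τ z l - x| ≤ τ ^ j)) ≤ p ^ j * (p⁻¹) ^ bd G e := by
  induction e using List.reverseRecOn with
  | nil =>
    intro j x hj
    simp at hj
    subst hj
    simp [Ex, bd]; exact ind_le_one _
  | append_singleton e i ih =>
    intro j x hj
    cases j with
    | zero =>
      rw [pow_zero, pow_zero, one_mul]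
      refine le_trans (Ex_mono (F' := fun _ => 1) (fun l _ => ind_le_one _)) ?_
      rw [Ex_const (cell_self G)]
      exact one_le_pow₀ ((one_le_inv₀ hp0).2 hp1)
    | succ j =>
      have hj' : j ≤ e.length := by simpa using hj
      rw [Ex_append, Ex_swap, bd_append]
      simp only [Ex, bd]
      set E := p ^ j * (p⁻¹) ^ bd G e with hE
      have hE0 : 0 ≤ E := by positivity
      have h1 : ∀ y, Ex (cell G) e (fun l => ind (|ZZ τ z (l ++ [y]) - x| ≤ τ ^ (j + 1))) ≤
          ind (x - (Z + 1) * τ ≤ z y ∧ z y ≤ x + (Z + 1) * τ) * E := by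
        intro y
        have hzz : ∀ l, ZZ τ z (l ++ [y]) = τ * ZZ τ z l + z y := by
          intro l; rw [ZZ_append]; simp [ZZ]
        by_cases h : x - (Z + 1) * τ ≤ z y ∧ z y ≤ x + (Z + 1) * τ
        · rw [ind_true h, one_mul]
          refine le_trans (Ex_mono ?_) (ih j ((x - z y) / τ) hj')
          intro l _
          apply ind_mono
          intro h2
          rw [hzz] at h2
          have h3 : ZZ τ z l - (x - z y) / τ = (τ * ZZ τ z l + z y - x) / τ := by field_simp; ring
          rw [h3, abs_div, abs_of_pos ht0, div_le_iff₀ ht0, ← pow_succ]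
          exact h2
        · rw [ind_false h, zero_mul]
          rw [← Ex_const (k := cell G) (cell_self G) e 0]
          apply Ex_mono
          intro l _
          rw [ind_false]
          intro h2
          apply h
          rw [hzz] at h2
          have h3 := abs_le.1 h2
          have h4 := abs_le.1 (hZ l)
          have h5 : τ * ZZ τ z l ≤ τ * Z := by gcongr; exact h4.2
          have h6 : τ * (-Z) ≤ τ * ZZ τ z l := by gcongr; exact h4.1
          have h7 : τ ^ (j + 1) ≤ τ := pow_le_of_le_one ht0.le ht1.le (by simp)
          constructor <;> linarith
      have h7 : ((G.filter (fun i => x - (Z + 1) * τ ≤ z i ∧ z i ≤ x - (Z + 1) * τ + ((2 * Z + 1 : ℕ) + 1) * τ)).card : ℝ) ≤ p * G.card := by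
        have := cover_card G z ht0 hB (2 * Z + 1) (x - (Z + 1) * τ)
        refine this.trans (le_of_eq ?_)
        push_cast
        field_simp
        ring
      have h8 := Ex_cell_ind i (fun y => x - (Z + 1) * τ ≤ z y ∧ z y ≤ x + (Z + 1) * τ) _ (fun y hy => ⟨hy.1, by push_cast; linarith [hy.2]⟩) hp0 h7
      calc (∑ y ∈ cell G i, Ex (cell G) e (fun l => ind (|ZZ τ z (l ++ [y]) - x| ≤ τ ^ (j + 1)))) / ((cell G i).card : ℝ)
          ≤ (∑ y ∈ cell G i, ind (x - (Z + 1) * τ ≤ z y ∧ z y ≤ x + (Z + 1) * τ) * E) / ((cell G i).card : ℝ) := by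
            gcongr with y hy
            exact h1 y
        _ = (∑ y ∈ cell G i, ind (x - (Z + 1) * τ ≤ z y ∧ z y ≤ x + (Z + 1) * τ)) / ((cell G i).card : ℝ) * E := by
            rw [← Finset.sum_mul, mul_div_right_comm]
        _ ≤ (p * (p⁻¹) ^ (if i ∈ G then 0 else 1)) * E := by gcongr
        _ = _ := by rw [hE, pow_succ, zero_add, pow_add]; ring

end blk
end SA

namespace SA
open scoped Classical

section stp
variable {I : Type}

/-- standing hypotheses for the block system -/
structure Hyp (c b : ℝ) (u v z : I → ℝ) (G : Finset I) (Z : ℕ) (a p : ℝ) : Prop where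
  hc0 : 0 < c
  hcb : c < b
  hb1 : b < 1
  ht : c / b ≤ 1 / 2
  hU : ∀ l, 0 ≤ UU c u l ∧ UU c u l ≤ 1
  hV : ∀ l, 0 ≤ VV c b u v z l ∧ VV c b u v z l ≤ 1
  hZ1 : 1 ≤ Z
  hZ : ∀ l, |ZZ (c / b) z l| ≤ Z
  ha0 : 0 < a
  ha1 : a ≤ 1
  hp0 : 0 < p
  hp1 : p ≤ 1
  hH : ∀ x, ((G.filter (fun i => x ≤ u i ∧ u i ≤ x + c)).card : ℝ) ≤ a / 3 * G.card
  hB : ∀ x, ((G.filter (fun i => x ≤ z i ∧ z i ≤ x + c / b)).card : ℝ) ≤ p / (2 * Z + 2) * G.card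

/-- correlation function over an environment -/
def Phi (c b : ℝ) (u v z : I → ℝ) (G : Finset I) (e : List I) (ρ : ℝ) : ℝ :=
  Ex (cell G) e (fun l => Ex (cell G) e (fun l' => ind (dist (pt c b u v z l) (pt c b u v z l') ≤ ρ)))

variable {c b : ℝ} {u v z : I → ℝ} {G : Finset I} {Z : ℕ} {a p : ℝ}

lemma Ex_indcover {e : List I} (f : List I → ℝ) {r C : ℝ} (hr : 0 < r)
    (h : ∀ x, Ex (cell G) e (fun l => ind (|f l - x| ≤ r)) ≤ C) (m : ℕ) (hm : 1 ≤ m) (x : ℝ) :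
    Ex (cell G) e (fun l => ind (|f l - x| ≤ m * r)) ≤ m * C := by
  refine (Ex_mono (fun l _ => ind_cover (f l) x hr m hm)).trans ?_
  rw [Ex_sum]
  refine (Finset.sum_le_sum (fun i _ => h _)).trans ?_
  simp

lemma Hyp.b0 (H : Hyp c b u v z G Z a p) : 0 < b := H.hc0.trans H.hcb
lemma Hyp.t0 (H : Hyp c b u v z G Z a p) : 0 < c / b := div_pos H.hc0 H.b0

lemma Hyp.QH2 (H : Hyp c b u v z G Z a p) (e : List I) (x : ℝ) :
    Ex (cell G) e (fun l => ind (|UU c u l - x| ≤ 2 * c ^ e.length)) ≤ 2 * (a ^ e.length * (a⁻¹) ^ bd G e) := by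
  have := Ex_indcover (G := G) (e := e) (UU c u) (pow_pos H.hc0 e.length)
    (fun x => QH H.hc0 (H.hcb.trans H.hb1) H.hU H.ha0 H.hH e x _ le_rfl) 2 (by norm_num) x
  exact_mod_cast this

lemma Hyp.QBm (H : Hyp c b u v z G Z a p) (e : List I) (x : ℝ) (j : ℕ) (hj : j ≤ e.length) (m : ℕ) (hm : 1 ≤ m) :
    Ex (cell G) e (fun l => ind (|ZZ (c/b) z l - x| ≤ m * (c/b) ^ j)) ≤ m * (p ^ j * (p⁻¹) ^ bd G e) := by
  exact Ex_indcover (G := G) (e := e) (ZZ (c/b) z) (pow_pos H.t0 j)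
    (fun x => QB H.t0 (by linarith [H.ht]) H.hZ1 H.hZ H.hp0 H.hp1 H.hB e j x hj) m hm x

lemma scale_find {r τ : ℝ} (hr : r ≤ 1) (n : ℕ) (hn : 1 ≤ n) :
    ∃ k < n, r ≤ τ ^ k ∧ (k + 1 = n ∨ τ ^ (k + 1) < r) := by
  induction n, hn using Nat.le_induction with
  | base => exact ⟨0, by norm_num, by simpa using hr, by simp⟩
  | succ n hn ih =>
    obtain ⟨k, hk, h1, h2⟩ := ih
    rcases h2 with h2 | h2
    · by_cases h3 : r ≤ τ ^ n
      · exact ⟨n, by omega, h3, Or.inl rfl⟩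
      · exact ⟨k, by omega, h1, Or.inr (by rw [h2]; exact not_le.1 h3)⟩
    · exact ⟨k, by omega, h1, Or.inr h2⟩

lemma Hyp.ptw (H : Hyp c b u v z G Z a p) (e : List I) (hn : 1 ≤ e.length) (X Y : ℝ) (hr : max |X| |Y| ≤ 1) :
    Ex (cell G) e (fun l => ind (|Y - ZZ (c/b) z l * X| ≤ (c/b) ^ e.length)) ≤
      ∑ k ∈ Finset.range e.length, ind (max |X| |Y| ≤ (c/b) ^ k) * (2 * Z * p ^ (e.length - 1 - k) * (p⁻¹) ^ bd G e) := by
  have hp0 := H.hp0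
  have hZ1 : (1:ℝ) ≤ Z := by exact_mod_cast H.hZ1
  have ht0 := H.t0
  have ht := H.ht
  set τ := c / b with hτ
  set n := e.length with hn'
  obtain ⟨k, hk, h1, h2⟩ := scale_find (τ := τ) hr n hn
  have hnn : ∀ k ∈ Finset.range n, 0 ≤ ind (max |X| |Y| ≤ τ ^ k) * (2 * Z * p ^ (n - 1 - k) * (p⁻¹) ^ bd G e) := by
    intro k _
    exact mul_nonneg (ind_nonneg _) (by positivity)
  refine le_trans ?_ (Finset.single_le_sum hnn (Finset.mem_range.2 hk))
  rw [ind_true h1, one_mul]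
  rcases h2 with h2 | h2
  · have : n - 1 - k = 0 := by omega
    rw [this, pow_zero, mul_one]
    refine (Ex_mono (F' := fun _ => 1) (fun l _ => ind_le_one _)).trans ?_
    rw [Ex_const (cell_self G)]
    have h3 : 1 ≤ (p⁻¹) ^ bd G e := one_le_pow₀ ((one_le_inv₀ hp0).2 H.hp1)
    have h4 : (1:ℝ) ≤ 2 * Z := by linarith
    calc (1:ℝ) = 1 * 1 := by norm_num
      _ ≤ _ := by gcongr
  · by_cases hk2 : k + 1 = n
    · have : n - 1 - k = 0 := by omega
      rw [this, pow_zero, mul_one]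
      refine (Ex_mono (F' := fun _ => 1) (fun l _ => ind_le_one _)).trans ?_
      rw [Ex_const (cell_self G)]
      have h3 : 1 ≤ (p⁻¹) ^ bd G e := one_le_pow₀ ((one_le_inv₀ hp0).2 H.hp1)
      have h4 : (1:ℝ) ≤ 2 * Z := by linarith
      calc (1:ℝ) = 1 * 1 := by norm_num
        _ ≤ _ := by gcongr
    set r := max |X| |Y| with hrr
    have hr0 : 0 < r := lt_trans (by positivity) h2
    by_cases hX : |X| * (2 * Z) < r
    · rw [show (2 * Z * p ^ (n - 1 - k) * (p⁻¹) ^ bd G e) = Ex (cell G) e (fun _ => 2 * Z * p ^ (n - 1 - k) * (p⁻¹) ^ bd G e) from (Ex_const (cell_self G) _ _).symm]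
      apply Ex_mono
      intro l _
      rw [ind_false]
      · positivity
      intro h3
      have h4 : |ZZ τ z l * X| ≤ Z * |X| := by rw [abs_mul]; gcongr; exact H.hZ l
      have hX0 := abs_nonneg X
      have h5 : |X| < r := by
        have : |X| * 1 ≤ |X| * (2 * Z) := by gcongr; linarith
        linarith
      have h6 : |Y| = r := by
        rcases max_choice |X| |Y| with h | h
        · rw [← hrr] at h; linarith
        · rw [← hrr] at h; exact h.symm
      have h7 : |Y| ≤ |Y - ZZ τ z l * X| + |ZZ τ z l * X| := by
        calc |Y| = |(Y - ZZ τ z l * X) + ZZ τ z l * X| := by ring_nf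
          _ ≤ _ := abs_add_le _ _
      have h8 : τ ^ n ≤ τ ^ (k + 1 + 1) := pow_le_pow_of_le_one ht0.le (by linarith) (by omega)
      have h9 : τ ^ (k + 1 + 1) ≤ τ ^ (k+1) * (1/2) := by rw [pow_succ τ (k+1)]; gcongr
      linarith
    · have hX' := not_lt.1 hX
      have hX0 : 0 < |X| := by
        by_contra h
        have : |X| = 0 := le_antisymm (not_lt.1 h) (abs_nonneg X)
        rw [this] at hX'; linarith
      have hXne : X ≠ 0 := abs_pos.1 hX0
      have hq := H.QBm e (Y / X) (n - 1 - k) (by omega) (2 * Z) (by have := H.hZ1; omega)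
      rw [← hτ] at hq
      refine le_trans (Ex_mono ?_) (hq.trans (le_of_eq (by push_cast; ring)))
      intro l _
      apply ind_mono
      intro h3
      have h4 : ZZ τ z l - Y / X = - ((Y - ZZ τ z l * X) / X) := by field_simp; ring
      rw [h4, abs_neg, abs_div, div_le_iff₀ hX0]
      refine h3.trans ?_
      have h5 : τ ^ n = τ ^ (n - 1 - k) * τ ^ (k + 1) := by rw [← pow_add]; congr 1; omega
      rw [h5]
      push_cast
      calc τ ^ (n - 1 - k) * τ ^ (k + 1) ≤ τ ^ (n - 1 - k) * (|X| * (2 * Z)) := by gcongr; linarith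
        _ = _ := by ring

lemma Phi_nonneg (e : List I) (ρ : ℝ) : 0 ≤ Phi c b u v z G e ρ :=
  Ex_nonneg fun _ _ => Ex_nonneg fun _ _ => ind_nonneg _

lemma Phi_le_one (e : List I) (ρ : ℝ) : Phi c b u v z G e ρ ≤ 1 := by
  unfold Phi
  rw [← Ex_const (k := cell G) (cell_self G) e 1]
  apply Ex_mono
  intro l _
  rw [← Ex_const (k := cell G) (cell_self G) e 1]
  apply Ex_mono
  intro l _
  exact ind_le_one _

lemma Phi_mono (e : List I) {ρ ρ' : ℝ} (h : ρ ≤ ρ') : Phi c b u v z G e ρ ≤ Phi c b u v z G e ρ' :=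
  Ex_mono fun _ _ => Ex_mono fun _ _ => ind_mono fun h1 => h1.trans h

lemma Hyp.pt_split (H : Hyp c b u v z G Z a p) {e1 l1 l1' : List I} (l2 l2' : List I) (h1 : l1.length = e1.length) (h1' : l1'.length = e1.length)
    (h : dist (pt c b u v z (l1 ++ l2)) (pt c b u v z (l1' ++ l2')) ≤ c ^ e1.length) :
    |UU c u l1 - UU c u l1'| ≤ 2 * c ^ e1.length ∧
    dist (VV c b u v z l2 - ZZ (c/b) z l1 * UU c u l2, (0:ℝ))
      (VV c b u v z l2' - ZZ (c/b) z l1' * UU c u l2' + (VV c b u v z l1' - VV c b u v z l1) / b ^ e1.length, (0:ℝ)) ≤ (c / b) ^ e1.length := by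
  have hb0 := H.b0
  have hc0 := H.hc0
  rw [Prod.dist_eq, max_le_iff] at h
  simp only [pt, Real.dist_eq, UU_append, VV_append hb0.ne', h1, h1'] at h
  obtain ⟨hx, hy⟩ := h
  constructor
  · have hx' := abs_le.1 hx
    have hp := pow_pos hc0 e1.length
    have e1' := mul_le_mul_of_nonneg_left (H.hU l2).2 hp.le
    have e2' := mul_le_mul_of_nonneg_left (H.hU l2').2 hp.le
    have e3' := mul_nonneg hp.le (H.hU l2).1
    have e4' := mul_nonneg hp.le (H.hU l2').1
    rw [abs_le]; constructor <;> linarith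
  · rw [Prod.dist_eq, max_le_iff]
    simp only [Real.dist_eq, sub_self, abs_zero]
    have hp := pow_pos hb0 e1.length
    refine ⟨?_, (pow_pos H.t0 _).le⟩
    rw [div_pow, le_div_iff₀ hp]
    refine le_trans (le_of_eq ?_) hy
    conv_lhs => rw [← abs_of_pos hp, ← abs_mul]
    congr 1
    rw [abs_of_pos hp]
    field_simp
    ring

theorem Hyp.step (H : Hyp c b u v z G Z a p) (e1 e2 : List I) (hn : 1 ≤ e1.length) :
    Phi c b u v z G (e1 ++ e2) (c ^ e1.length) ≤ 18 * (a ^ e1.length * (a⁻¹) ^ bd G e1) *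
      ∑ k ∈ Finset.range e1.length, Phi c b u v z G e2 ((c/b) ^ k) * (2 * Z * p ^ (e1.length - 1 - k) * (p⁻¹) ^ bd G e1) := by
  set n := e1.length with hn'
  set k := cell G with hk
  set τ := c / b with hτ
  have ha0 := H.ha0
  set f : List I → List I → ℝ × ℝ := fun l1 l2 => (VV c b u v z l2 - ZZ τ z l1 * UU c u l2, (0:ℝ)) with hf
  set g : List I → List I → List I → ℝ × ℝ := fun l1 l1' l2' => (VV c b u v z l2' - ZZ τ z l1' * UU c u l2' + (VV c b u v z l1' - VV c b u v z l1) / b ^ n, (0:ℝ)) with hg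
  set D : List I → ℝ := fun l1 => Ex k e2 (fun l2 => Ex k e2 (fun l2' => ind (dist (f l1 l2) (f l1 l2') ≤ τ ^ n))) with hD
  have hD0 : ∀ l1, 0 ≤ D l1 := fun l1 => Ex_nonneg fun _ _ => Ex_nonneg fun _ _ => ind_nonneg _
  have hτ0 : 0 < τ := H.t0
  set A := 2 * (a ^ n * (a⁻¹) ^ bd G e1) with hA
  have hA0 : 0 ≤ A := by positivity
  -- first reduction
  have s1 : Phi c b u v z G (e1 ++ e2) (c ^ n) ≤
      Ex k e1 (fun l1 => Ex k e1 (fun l1' => ind (|UU c u l1 - UU c u l1'| ≤ 2 * c ^ n) * (9 / 2 * (D l1 + D l1')))) := by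
    unfold Phi
    rw [Ex_append]
    apply Ex_mono
    intro l1 hl1
    have hl1' := Sp_length hl1
    calc Ex k e2 (fun l2 => Ex k (e1 ++ e2) (fun l' => ind (dist (pt c b u v z (l1 ++ l2)) (pt c b u v z l') ≤ c ^ n)))
        = Ex k e2 (fun l2 => Ex k e1 (fun l1' => Ex k e2 (fun l2' => ind (dist (pt c b u v z (l1 ++ l2)) (pt c b u v z (l1' ++ l2')) ≤ c ^ n)))) := by
          apply Ex_congr; intro l2 _; rw [Ex_append]
      _ = Ex k e1 (fun l1' => Ex k e2 (fun l2 => Ex k e2 (fun l2' => ind (dist (pt c b u v z (l1 ++ l2)) (pt c b u v z (l1' ++ l2')) ≤ c ^ n)))) := by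
          rw [Ex_swap]
      _ ≤ _ := by
          apply Ex_mono
          intro l1' hl2
          have hl2' := Sp_length hl2
          calc Ex k e2 (fun l2 => Ex k e2 (fun l2' => ind (dist (pt c b u v z (l1 ++ l2)) (pt c b u v z (l1' ++ l2')) ≤ c ^ n)))
              ≤ Ex k e2 (fun l2 => Ex k e2 (fun l2' => ind (|UU c u l1 - UU c u l1'| ≤ 2 * c ^ n) * ind (dist (f l1 l2) (g l1 l1' l2') ≤ τ ^ n))) := by
                apply Ex_mono; intro l2 _
                apply Ex_mono; intro l2' _
                by_cases h : dist (pt c b u v z (l1 ++ l2)) (pt c b u v z (l1' ++ l2')) ≤ c ^ n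
                · have := H.pt_split l2 l2' hl1' hl2' h
                  rw [ind_true this.1, ind_true this.2, one_mul]
                  exact ind_le_one _
                · rw [ind_false h]
                  exact mul_nonneg (ind_nonneg _) (ind_nonneg _)
            _ = ind (|UU c u l1 - UU c u l1'| ≤ 2 * c ^ n) * Ex k e2 (fun l2 => Ex k e2 (fun l2' => ind (dist (f l1 l2) (g l1 l1' l2') ≤ τ ^ n))) := by
                rw [← Ex_mul]; apply Ex_congr; intro l2 _; rw [Ex_mul]
            _ ≤ _ := by
                apply mul_le_mul_of_nonneg_left _ (ind_nonneg _)
                refine (Ex_close e2 e2 (f l1) (g l1 l1') (pow_pos hτ0 n)).trans (le_of_eq ?_)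
                congr 2
                apply Ex_congr; intro l2 _
                apply Ex_congr; intro l2' _
                congr 2
                simp only [hf, hg, Prod.dist_eq, Real.dist_eq]
                congr 2
                ring
  have s2 : Ex k e1 (fun l1 => Ex k e1 (fun l1' => ind (|UU c u l1 - UU c u l1'| ≤ 2 * c ^ n) * (9 / 2 * (D l1 + D l1')))) ≤
      9 * A * Ex k e1 D := by
    have q1 : Ex k e1 (fun l1 => Ex k e1 (fun l1' => ind (|UU c u l1 - UU c u l1'| ≤ 2 * c ^ n) * D l1)) ≤ A * Ex k e1 D := by
      rw [← Ex_mul]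
      apply Ex_mono
      intro l1 _
      rw [Ex_mul_right]
      apply mul_le_mul_of_nonneg_right _ (hD0 l1)
      refine le_trans (le_of_eq ?_) (H.QH2 e1 (UU c u l1))
      apply Ex_congr
      intro l _
      rw [abs_sub_comm]
    have q2 : Ex k e1 (fun l1 => Ex k e1 (fun l1' => ind (|UU c u l1 - UU c u l1'| ≤ 2 * c ^ n) * D l1')) ≤ A * Ex k e1 D := by
      rw [Ex_swap]
      refine le_trans (le_of_eq ?_) q1
      apply Ex_congr; intro l _
      apply Ex_congr; intro l' _
      rw [abs_sub_comm]
    have q3 : Ex k e1 (fun l1 => Ex k e1 (fun l1' => ind (|UU c u l1 - UU c u l1'| ≤ 2 * c ^ n) * (9 / 2 * (D l1 + D l1')))) =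
        9 / 2 * (Ex k e1 (fun l1 => Ex k e1 (fun l1' => ind (|UU c u l1 - UU c u l1'| ≤ 2 * c ^ n) * D l1)) +
          Ex k e1 (fun l1 => Ex k e1 (fun l1' => ind (|UU c u l1 - UU c u l1'| ≤ 2 * c ^ n) * D l1'))) := by
      rw [← Ex_add, ← Ex_mul]
      apply Ex_congr; intro l _
      rw [← Ex_add, ← Ex_mul]
      apply Ex_congr; intro l' _
      ring
    rw [q3]
    linarith
  have s3 : Ex k e1 D ≤ ∑ j ∈ Finset.range n, Phi c b u v z G e2 (τ ^ j) * (2 * Z * p ^ (n - 1 - j) * (p⁻¹) ^ bd G e1) := by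
    have q1 : Ex k e1 D = Ex k e2 (fun l2 => Ex k e2 (fun l2' => Ex k e1 (fun l1 => ind (dist (f l1 l2) (f l1 l2') ≤ τ ^ n)))) := by
      rw [hD, Ex_swap]
      apply Ex_congr; intro l2 _
      rw [Ex_swap]
    rw [q1]
    have q2 : ∑ j ∈ Finset.range n, Phi c b u v z G e2 (τ ^ j) * (2 * Z * p ^ (n - 1 - j) * (p⁻¹) ^ bd G e1) =
        Ex k e2 (fun l2 => Ex k e2 (fun l2' => ∑ j ∈ Finset.range n, ind (dist (pt c b u v z l2) (pt c b u v z l2') ≤ τ ^ j) * (2 * Z * p ^ (n - 1 - j) * (p⁻¹) ^ bd G e1))) := by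
      rw [show (fun l2 => Ex k e2 (fun l2' => ∑ j ∈ Finset.range n, ind (dist (pt c b u v z l2) (pt c b u v z l2') ≤ τ ^ j) * (2 * Z * p ^ (n - 1 - j) * (p⁻¹) ^ bd G e1))) =
        fun l2 => ∑ j ∈ Finset.range n, Ex k e2 (fun l2' => ind (dist (pt c b u v z l2) (pt c b u v z l2') ≤ τ ^ j)) * (2 * Z * p ^ (n - 1 - j) * (p⁻¹) ^ bd G e1) from by
          funext l2; rw [Ex_sum]; apply Finset.sum_congr rfl; intro j _; rw [Ex_mul_right]]
      rw [Ex_sum]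
      apply Finset.sum_congr rfl
      intro j _
      rw [Ex_mul_right]
      rfl
    rw [q2]
    apply Ex_mono; intro l2 _
    apply Ex_mono; intro l2' _
    have hu := H.hU l2
    have hu' := H.hU l2'
    have hv := H.hV l2
    have hv' := H.hV l2'
    have q3 := H.ptw e1 hn (UU c u l2 - UU c u l2') (VV c b u v z l2 - VV c b u v z l2')
      (max_le (abs_le.2 ⟨by linarith, by linarith⟩) (abs_le.2 ⟨by linarith, by linarith⟩))
    refine le_trans (Ex_mono ?_) q3
    intro l1 _
    apply ind_mono
    intro h
    simp only [hf, Prod.dist_eq, Real.dist_eq] at h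
    have := (max_le_iff.1 h).1
    refine le_trans (le_of_eq ?_) this
    congr 1
    ring
  have hAA : 0 ≤ 9 * A := by positivity
  calc _ ≤ _ := s1
    _ ≤ _ := s2
    _ ≤ _ := mul_le_mul_of_nonneg_left s3 hAA
    _ = _ := by rw [hA]; ring

end stp
end SA

namespace SA
open scoped Classical

section itr
variable {I : Type} {c b : ℝ} {u v z : I → ℝ} {G : Finset I} {Z : ℕ} {a p : ℝ}

lemma sum_pow_le {x y M : ℝ} (hx : 0 ≤ x) (hy : 0 ≤ y) (hxM : x ≤ M) (hyM : y ≤ M) (n : ℕ) :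
    ∑ k ∈ Finset.range n, x ^ k * y ^ (n - k) ≤ (2 * M) ^ n := by
  have hM : 0 ≤ M := hx.trans hxM
  calc ∑ k ∈ Finset.range n, x ^ k * y ^ (n - k) ≤ ∑ k ∈ Finset.range n, M ^ n := by
        apply Finset.sum_le_sum
        intro k hk
        have hk' := Finset.mem_range.1 hk
        calc x ^ k * y ^ (n - k) ≤ M ^ k * M ^ (n - k) := by gcongr
          _ = M ^ n := by rw [← pow_add]; congr 1; omega
    _ = n * M ^ n := by simp
    _ ≤ 2 ^ n * M ^ n := by
        gcongr
        exact_mod_cast Nat.lt_two_pow_self.le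
    _ = _ := by rw [mul_pow]

theorem Hyp.iter (H : Hyp c b u v z G Z a p) {t κ : ℝ} (ht0 : 0 ≤ t) (hκ0 : 0 ≤ κ) (hκ1 : κ ≤ 1) (hκ : c ^ κ = c / b)
    (h1 : 2 * a ≤ b ^ t) (h2 : 2 * (a * p) ≤ c ^ t) (j : ℕ) :
    ∃ K : ℝ, 1 ≤ K ∧ ∀ (n : ℕ) (e : List I), j * n ≤ e.length →
      Phi c b u v z G e (c ^ n) ≤ K * ((a * p)⁻¹) ^ (j * bd G e) * (c ^ (t * (1 - κ ^ j))) ^ n := by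
  have hc0 := H.hc0
  have hc1 : c < 1 := H.hcb.trans H.hb1
  have ha0 := H.ha0
  have hp0 := H.hp0
  have hb0 := H.b0
  have hZ1 : (1:ℝ) ≤ Z := by exact_mod_cast H.hZ1
  have hap : a * p ≤ 1 := by
    calc a * p ≤ 1 * 1 := by gcongr; exact H.ha1; exact H.hp1
      _ = 1 := by norm_num
  have hθ : 1 ≤ (a * p)⁻¹ := (one_le_inv₀ (by positivity)).2 hap
  have hai : 1 ≤ a⁻¹ := (one_le_inv₀ ha0).2 H.ha1
  have hpi : 1 ≤ p⁻¹ := (one_le_inv₀ hp0).2 H.hp1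
  induction j with
  | zero =>
    refine ⟨1, le_rfl, fun n e _ => ?_⟩
    simp
    exact Phi_le_one _ _
  | succ j ih =>
    obtain ⟨K, hK1, hK⟩ := ih
    have hκj1 : κ ^ j ≤ 1 := pow_le_one₀ hκ0 hκ1
    have hκj0 : 0 ≤ κ ^ j := pow_nonneg hκ0 j
    set s := t * (1 - κ ^ j) with hs
    have hs0 : 0 ≤ s := mul_nonneg ht0 (by linarith)
    set s' := t * (1 - κ ^ (j + 1)) with hs'
    have hs'e : s' = (1 - κ) * t + κ * s := by rw [hs', hs, pow_succ]; ring
    have hs't : s' ≤ t := by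
      have : 0 ≤ t * κ ^ (j + 1) := by positivity
      rw [hs']; linarith
    have hb : c ^ (1 - κ) = b := by
      rw [Real.rpow_sub hc0, hκ, Real.rpow_one]; field_simp
    have hx : 2 * a * (c / b) ^ s ≤ c ^ s' := by
      calc 2 * a * (c / b) ^ s ≤ b ^ t * (c / b) ^ s := by gcongr; 
        _ = c ^ s' := by
          rw [← hκ]; nth_rewrite 1 [← hb]
          rw [← Real.rpow_mul hc0.le, ← Real.rpow_mul hc0.le, ← Real.rpow_add hc0, hs'e]
    have hy : 2 * a * p ≤ c ^ s' := by
      have : c ^ t ≤ c ^ s' := Real.rpow_le_rpow_of_exponent_ge hc0 hc1.le hs't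
      linarith
    set x := (c / b) ^ s with hxx
    have hx0 : 0 ≤ x := Real.rpow_nonneg H.t0.le _
    set C := 18 * (2 * Z) * K * c ^ (-s) * p⁻¹ with hC
    have hcs : 1 ≤ c ^ (-s) := Real.one_le_rpow_of_pos_of_le_one_of_nonpos hc0 hc1.le (by linarith)
    have hC1 : 1 ≤ C := by
      have h3 : (1:ℝ) ≤ 18 * (2 * Z) := by linarith
      have h4 : 1 ≤ 18 * (2 * Z) * K := one_le_mul_of_one_le_of_one_le h3 hK1
      exact one_le_mul_of_one_le_of_one_le (one_le_mul_of_one_le_of_one_le h4 hcs) hpi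
    refine ⟨C, hC1, fun n e he => ?_⟩
    rcases Nat.eq_zero_or_pos n with hn | hn
    · subst hn
      rw [pow_zero, pow_zero, mul_one]
      exact (Phi_le_one _ _).trans (one_le_mul_of_one_le_of_one_le hC1 (one_le_pow₀ hθ))
    have hlen : n ≤ e.length := by
      refine le_trans ?_ he
      exact Nat.le_mul_of_pos_left n (by omega)
    set e1 := e.take n with he1
    set e2 := e.drop n with he2
    have hee : e1 ++ e2 = e := List.take_append_drop n e
    have hl1 : e1.length = n := by rw [he1, List.length_take]; omega
    have hl2 : j * n ≤ e2.length := by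
      rw [he2, List.length_drop]
      have : (j + 1) * n = j * n + n := by ring
      omega
    have hst := H.step e1 e2 (by omega)
    rw [hl1, hee] at hst
    have hbd : bd G e = bd G e1 + bd G e2 := by rw [← hee, bd_append]
    have hPk : ∀ k ∈ Finset.range n, Phi c b u v z G e2 ((c / b) ^ k) ≤ K * c ^ (-s) * ((a * p)⁻¹) ^ (j * bd G e2) * x ^ k := by
      intro k hk
      have hk' := Finset.mem_range.1 hk
      have hkκ : 0 ≤ k * κ := by positivity
      set m := ⌊k * κ⌋₊ with hm
      have hm1 : (m:ℝ) ≤ k * κ := Nat.floor_le hkκ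
      have hm2 : (k * κ : ℝ) < m + 1 := Nat.lt_floor_add_one _
      have hmk : m ≤ k := by
        have : (m:ℝ) ≤ k * 1 := hm1.trans (by gcongr)
        rw [mul_one] at this
        exact_mod_cast this
      have e1 : (c / b) ^ k = c ^ (k * κ) := by
        rw [← hκ, ← Real.rpow_natCast, ← Real.rpow_mul hc0.le, mul_comm]
      have e2' : (c / b) ^ k ≤ c ^ m := by
        rw [e1, ← Real.rpow_natCast c m]
        exact Real.rpow_le_rpow_of_exponent_ge hc0 hc1.le hm1
      have e3 := hK m e2 (le_trans (Nat.mul_le_mul_left j (by omega)) hl2)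
      have e4 : (c ^ s) ^ m ≤ c ^ (-s) * x ^ k := by
        have : x ^ k = c ^ (k * κ * s) := by
          rw [hxx, ← hκ, ← Real.rpow_natCast, ← Real.rpow_mul hc0.le, ← Real.rpow_mul hc0.le]
          congr 1; ring
        rw [this, ← Real.rpow_add hc0, ← Real.rpow_natCast, ← Real.rpow_mul hc0.le]
        apply Real.rpow_le_rpow_of_exponent_ge hc0 hc1.le
        have := mul_le_mul_of_nonneg_right hm2.le hs0
        linarith
      calc Phi c b u v z G e2 ((c / b) ^ k) ≤ Phi c b u v z G e2 (c ^ m) := Phi_mono _ e2'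
        _ ≤ _ := e3
        _ ≤ K * ((a * p)⁻¹) ^ (j * bd G e2) * (c ^ (-s) * x ^ k) := by gcongr
        _ = _ := by ring
    set Θ := ((a * p)⁻¹) ^ (bd G e1) * ((a * p)⁻¹) ^ (j * bd G e2) with hΘ
    have hΘ0 : 0 ≤ Θ := by positivity
    have hsum : ∑ k ∈ Finset.range n, Phi c b u v z G e2 ((c/b) ^ k) * (2 * Z * p ^ (n - 1 - k) * (p⁻¹) ^ bd G e1) ≤
        (2 * Z) * K * c ^ (-s) * p⁻¹ * ((a * p)⁻¹) ^ (j * bd G e2) * (p⁻¹) ^ bd G e1 * ∑ k ∈ Finset.range n, x ^ k * p ^ (n - k) := by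
      rw [Finset.mul_sum]
      apply Finset.sum_le_sum
      intro k hk
      have hk' := Finset.mem_range.1 hk
      have : p ^ (n - 1 - k) = p⁻¹ * p ^ (n - k) := by
        rw [show n - k = (n - 1 - k) + 1 by omega, pow_succ]; field_simp
      calc _ ≤ (K * c ^ (-s) * ((a * p)⁻¹) ^ (j * bd G e2) * x ^ k) * (2 * Z * p ^ (n - 1 - k) * (p⁻¹) ^ bd G e1) := by
            gcongr; exact hPk k hk
        _ = _ := by rw [this]; ring
    have hfin : a ^ n * ∑ k ∈ Finset.range n, x ^ k * p ^ (n - k) ≤ (c ^ s') ^ n := by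
      have h3 := sum_pow_le hx0 hp0.le (le_max_left x p) (le_max_right x p) n
      calc a ^ n * ∑ k ∈ Finset.range n, x ^ k * p ^ (n - k) ≤ a ^ n * (2 * max x p) ^ n := by gcongr
        _ = (2 * a * max x p) ^ n := by rw [← mul_pow]; congr 1; ring
        _ ≤ _ := by
          gcongr
          rcases max_choice x p with h | h <;> rw [h] <;> assumption
    calc Phi c b u v z G e (c ^ n) ≤ _ := hst
      _ ≤ 18 * (a ^ n * (a⁻¹) ^ bd G e1) * ((2 * Z) * K * c ^ (-s) * p⁻¹ * ((a * p)⁻¹) ^ (j * bd G e2) * (p⁻¹) ^ bd G e1 * ∑ k ∈ Finset.range n, x ^ k * p ^ (n - k)) := by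
          gcongr
      _ = C * Θ * (a ^ n * ∑ k ∈ Finset.range n, x ^ k * p ^ (n - k)) := by
          rw [hC, hΘ, mul_inv, mul_pow]; ring
      _ ≤ C * Θ * (c ^ s') ^ n := by gcongr
      _ ≤ C * ((a * p)⁻¹) ^ ((j + 1) * bd G e) * (c ^ s') ^ n := by
          have hcs' : 0 ≤ (c ^ s') ^ n := pow_nonneg (Real.rpow_nonneg hc0.le _) _
          gcongr
          rw [hΘ, ← pow_add]
          apply pow_le_pow_right₀ hθ
          rw [hbd]
          have : (j + 1) * (bd G e1 + bd G e2) = bd G e1 + j * bd G e2 + (j * bd G e1 + bd G e2) := by ring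
          omega

end itr
end SA

namespace SA
open scoped Classical

section fin
variable {I : Type} [Fintype I] [Nonempty I]

/-- the uniform kernel -/
def un (_ : I) : Finset I := Finset.univ

lemma un_self (i : I) : i ∈ un i := Finset.mem_univ _

lemma mem_Sp_un {e l : List I} : l ∈ Sp un e ↔ l.length = e.length := by
  constructor
  · exact Sp_length
  · induction e generalizing l with
    | nil => intro h; simp at h; simp [h, Sp]
    | cons i e ih =>
      intro h
      cases l with
      | nil => simp at h
      | cons a l => exact mem_Sp_cons.2 ⟨a, Finset.mem_univ _, l, ih (by simpa using h), rfl⟩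

lemma Sp_un_card (e : List I) : (Sp un e).card = Fintype.card I ^ e.length := by
  induction e with
  | nil => simp [Sp]
  | cons i e ih => simp [Sp, ih, un, pow_succ, mul_comm]

lemma sum_cell (G : Finset I) (h : I → ℝ) :
    ∑ i, (∑ a ∈ cell G i, h a) / ((cell G i).card : ℝ) = ∑ i, h i := by
  rw [← Finset.sum_add_sum_compl G, ← Finset.sum_add_sum_compl G h]
  congr 1
  · rcases Finset.eq_empty_or_nonempty G with hG | hG
    · simp [hG]
    · have : ∀ i ∈ G, (∑ a ∈ cell G i, h a) / ((cell G i).card : ℝ) = (∑ a ∈ G, h a) / (G.card : ℝ) := by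
        intro i hi; simp [cell, hi]
      rw [Finset.sum_congr rfl this, Finset.sum_const, nsmul_eq_mul]
      have : (G.card : ℝ) ≠ 0 := by
        have := hG.card_pos; positivity
      field_simp
  · apply Finset.sum_congr rfl
    intro i hi
    have : i ∉ G := by simpa using hi
    simp [cell, this]

lemma Ex_un_cell (G : Finset I) (e : List I) (F : List I → ℝ) :
    Ex un e (fun l => Ex (cell G) l F) = Ex un e F := by
  induction e generalizing F with
  | nil => simp [Ex]
  | cons i e ih =>
    simp only [Ex]
    congr 1
    rw [show (∑ a ∈ un i, Ex un e (fun l => F (a :: l))) = ∑ a, Ex un e (fun l => F (a :: l)) from rfl,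
      ← sum_cell G]
    apply Finset.sum_congr rfl
    intro a _
    rw [show (fun l => (∑ a_1 ∈ cell G a, Ex (cell G) l fun l => F (a_1 :: l)) / ((cell G a).card : ℝ)) =
      fun l => (∑ a_1 ∈ cell G a, Ex (cell G) l fun l => F (a_1 :: l)) * ((cell G a).card : ℝ)⁻¹ from by
        funext l; rw [div_eq_mul_inv]]
    rw [Ex_mul_right, Ex_sum, div_eq_mul_inv]
    congr 1
    apply Finset.sum_congr rfl
    intro a' _
    exact ih _

variable {c b : ℝ} {u v z : I → ℝ} {G : Finset I}

theorem corr_le (e : List I) {ρ D B : ℝ} (hρ : 0 < ρ) (hB : 0 ≤ B)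
    (h : ∀ l : List I, l.length = e.length → (bd G l : ℝ) ≤ D → Phi c b u v z G l ρ ≤ B) :
    Ex un e (fun l => ind ((bd G l : ℝ) ≤ D) * Ex un e (fun l' => ind ((bd G l' : ℝ) ≤ D) * ind (dist (pt c b u v z l) (pt c b u v z l') ≤ ρ))) ≤ 9 * B := by
  set g : List I → ℝ := fun l => ind ((bd G l : ℝ) ≤ D) with hg
  have hgc : ∀ l m, m ∈ Sp (cell G) l → g m = g l := by
    intro l m hm; simp only [hg, bd_Sp hm]
  have hg0 : ∀ l, 0 ≤ g l := fun l => ind_nonneg _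
  have hg1 : ∀ l, g l ≤ 1 := fun l => ind_le_one _
  calc _ = Ex un e (fun l => Ex un e (fun l' => g l * (g l' * ind (dist (pt c b u v z l) (pt c b u v z l') ≤ ρ)))) := by
        apply Ex_congr; intro l _; rw [Ex_mul]
    _ = Ex un e (fun l => Ex un e (fun l' => Ex (cell G) l (fun m => Ex (cell G) l' (fun m' => g m * (g m' * ind (dist (pt c b u v z m) (pt c b u v z m') ≤ ρ)))))) := by
        rw [← Ex_un_cell G e]
        apply Ex_congr; intro l _
        rw [Ex_swap (k := un) (k' := cell G)]
        apply Ex_congr; intro m _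
        rw [Ex_un_cell G e]
    _ ≤ Ex un e (fun l => Ex un e (fun l' => 9 * B)) := by
        apply Ex_mono; intro l hl
        apply Ex_mono; intro l' hl'
        have hl2 := Sp_length hl
        have hl2' := Sp_length hl'
        calc Ex (cell G) l (fun m => Ex (cell G) l' (fun m' => g m * (g m' * ind (dist (pt c b u v z m) (pt c b u v z m') ≤ ρ))))
            = g l * g l' * Ex (cell G) l (fun m => Ex (cell G) l' (fun m' => ind (dist (pt c b u v z m) (pt c b u v z m') ≤ ρ))) := by
              rw [← Ex_mul]
              apply Ex_congr; intro m hm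
              rw [← Ex_mul]
              apply Ex_congr; intro m' hm'
              rw [hgc l m hm, hgc l' m' hm', mul_assoc]
          _ ≤ g l * g l' * (9 / 2 * (Phi c b u v z G l ρ + Phi c b u v z G l' ρ)) := by
              apply mul_le_mul_of_nonneg_left _ (mul_nonneg (hg0 _) (hg0 _))
              exact Ex_close l l' _ _ hρ
          _ ≤ 9 * B := by
              by_cases h1 : (bd G l : ℝ) ≤ D
              · by_cases h2 : (bd G l' : ℝ) ≤ D
                · have e1 := h l hl2 h1
                  have e2 := h l' hl2' h2
                  simp only [hg, ind_true h1, ind_true h2]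
                  linarith
                · simp only [hg, ind_false h2]
                  linarith
              · simp only [hg, ind_false h1]
                linarith
    _ = 9 * B := by rw [Ex_const un_self, Ex_const un_self]

lemma mgf (G : Finset I) {B ε : ℝ} (hB : 1 ≤ B) (hε : 0 ≤ ε) (hG : ((Gᶜ).card : ℝ) ≤ ε * Fintype.card I) (e : List I) :
    Ex un e (fun l => B ^ bd G l) ≤ (1 + ε * B) ^ e.length := by
  induction e with
  | nil => simp [Ex, bd]
  | cons i e ih =>
    have hcard : (0:ℝ) < Fintype.card I := by exact_mod_cast Fintype.card_pos
    have hB0 : 0 ≤ B := by linarith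
    have h0 : 0 ≤ Ex un e (fun l => B ^ bd G l) := Ex_nonneg fun _ _ => by positivity
    have h1 : Ex un (i :: e) (fun l => B ^ bd G l) = (∑ a : I, B ^ (if a ∈ G then 0 else 1)) / (Fintype.card I) * Ex un e (fun l => B ^ bd G l) := by
      simp only [Ex, bd, pow_add, Ex_mul_right, un, Finset.card_univ]
      rw [← Finset.mul_sum]; ring
    have h2 : ∑ a : I, B ^ (if a ∈ G then 0 else 1) ≤ (1 + ε * B) * Fintype.card I := by
      rw [← Finset.sum_add_sum_compl G]
      have e1 : ∑ a ∈ G, B ^ (if a ∈ G then 0 else 1) = G.card := by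
        rw [Finset.sum_congr rfl (fun a ha => by rw [if_pos ha, pow_zero])]; simp
      have e2 : ∑ a ∈ Gᶜ, B ^ (if a ∈ G then 0 else 1) = (Gᶜ).card * B := by
        rw [Finset.sum_congr rfl (fun a ha => by rw [if_neg (Finset.mem_compl.1 ha), pow_one])]; simp
      rw [e1, e2]
      have e3 : (G.card : ℝ) ≤ Fintype.card I := by exact_mod_cast Finset.card_le_univ G
      have e4 := mul_le_mul_of_nonneg_right hG hB0
      linarith
    rw [h1, List.length_cons, pow_succ, mul_comm]
    apply mul_le_mul ih _ _ (by positivity)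
    · rw [div_le_iff₀ hcard]; exact h2
    · apply div_nonneg _ hcard.le
      exact Finset.sum_nonneg fun _ _ => by positivity

theorem bad_prob (G : Finset I) {ε δ : ℝ} (hε : 0 < ε) (hε1 : ε ≤ 1) (hδ : 8 ≤ (ε⁻¹) ^ δ)
    (hG : ((Gᶜ).card : ℝ) ≤ ε * Fintype.card I) (e : List I) :
    Ex un e (fun l => ind (¬ (bd G l : ℝ) ≤ δ * e.length)) ≤ (1 / 4) ^ e.length := by
  have hB : 1 ≤ ε⁻¹ := (one_le_inv₀ hε).2 hε1
  have hB0 : 0 < ε⁻¹ := by positivity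
  have h1 := mgf G hB hε.le hG e
  rw [mul_inv_cancel₀ hε.ne'] at h1
  have h2 : ∀ l, ind (¬ (bd G l : ℝ) ≤ δ * e.length) ≤ (ε⁻¹) ^ bd G l * ((8:ℝ) ^ e.length)⁻¹ := by
    intro l
    by_cases h : (bd G l : ℝ) ≤ δ * e.length
    · rw [ind_false (not_not.2 h)]; positivity
    · rw [ind_true h, ← div_eq_mul_inv, one_le_div (by positivity)]
      calc (8:ℝ) ^ e.length ≤ ((ε⁻¹) ^ δ) ^ e.length := by gcongr
        _ = (ε⁻¹) ^ (δ * e.length) := by rw [← Real.rpow_natCast, ← Real.rpow_mul hB0.le]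
        _ ≤ (ε⁻¹) ^ ((bd G l : ℕ) : ℝ) := by
          apply Real.rpow_le_rpow_of_exponent_le hB
          exact (not_le.1 h).le
        _ = _ := Real.rpow_natCast _ _
  refine (Ex_mono fun l _ => h2 l).trans ?_
  rw [Ex_mul_right]
  calc _ ≤ (1 + 1) ^ e.length * ((8:ℝ) ^ e.length)⁻¹ := by gcongr
    _ = _ := by rw [← inv_pow, ← mul_pow]; norm_num

/-- exceptional probability at one scale -/
theorem exc_prob {ε δ : ℝ} (hε : 0 < ε) (hε1 : ε ≤ 1) (hδ : 8 ≤ (ε⁻¹) ^ δ)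
    (hG : ((Gᶜ).card : ℝ) ≤ ε * Fintype.card I) (e : List I) {ρ B y : ℝ} (hρ : 0 < ρ) (hB : 0 ≤ B) (hy : 0 < y)
    (h : ∀ l : List I, l.length = e.length → (bd G l : ℝ) ≤ δ * e.length → Phi c b u v z G l ρ ≤ B) :
    Ex un e (fun l => ind (¬ ((bd G l : ℝ) ≤ δ * e.length ∧
      Ex un e (fun l' => ind ((bd G l' : ℝ) ≤ δ * e.length ∧ dist (pt c b u v z l) (pt c b u v z l') ≤ ρ)) ≤ y))) ≤ (1 / 4) ^ e.length + 9 * B / y := by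
  have h1 := bad_prob G hε hε1 hδ hG e
  have h2 := corr_le (c := c) (b := b) (u := u) (v := v) (z := z) e hρ hB h
  set D := δ * e.length with hD
  have h3 : ∀ l, ind (¬ ((bd G l : ℝ) ≤ D ∧
      Ex un e (fun l' => ind ((bd G l' : ℝ) ≤ D ∧ dist (pt c b u v z l) (pt c b u v z l') ≤ ρ)) ≤ y)) ≤
      ind (¬ (bd G l : ℝ) ≤ D) + (ind ((bd G l : ℝ) ≤ D) * Ex un e (fun l' => ind ((bd G l' : ℝ) ≤ D) * ind (dist (pt c b u v z l) (pt c b u v z l') ≤ ρ))) * y⁻¹ := by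
    intro l
    have e0 : Ex un e (fun l' => ind ((bd G l' : ℝ) ≤ D ∧ dist (pt c b u v z l) (pt c b u v z l') ≤ ρ)) =
        Ex un e (fun l' => ind ((bd G l' : ℝ) ≤ D) * ind (dist (pt c b u v z l) (pt c b u v z l') ≤ ρ)) := by
      apply Ex_congr; intro l' _
      unfold ind
      by_cases h1 : (bd G l' : ℝ) ≤ D <;> by_cases h2 : dist (pt c b u v z l) (pt c b u v z l') ≤ ρ <;> simp [h1, h2]
    rw [e0]
    set f := Ex un e (fun l' => ind ((bd G l' : ℝ) ≤ D) * ind (dist (pt c b u v z l) (pt c b u v z l') ≤ ρ)) with hf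
    have hf0 : 0 ≤ f := Ex_nonneg fun _ _ => mul_nonneg (ind_nonneg _) (ind_nonneg _)
    by_cases h4 : (bd G l : ℝ) ≤ D
    · rw [ind_true h4, ind_false (not_not.2 h4), zero_add, one_mul]
      by_cases h5 : f ≤ y
      · rw [ind_false (by simp [h4, h5])]; positivity
      · rw [ind_true (by simp [h4]; exact not_le.1 h5), ← div_eq_mul_inv, one_le_div hy]
        exact (not_le.1 h5).le
    · rw [ind_true h4, ind_false h4, zero_mul, zero_mul, add_zero]
      exact ind_le_one _
  refine (Ex_mono fun l _ => h3 l).trans ?_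
  rw [Ex_add, Ex_mul_right, div_eq_mul_inv (9 * B)]
  exact add_le_add h1 (mul_le_mul_of_nonneg_right h2 (by positivity))

end fin
end SA

namespace SA
open scoped Classical

section msr
variable {I : Type} [Fintype I] [Nonempty I] {X : Type} [MeasurableSpace X] {μ : Measure X}

/-- a reference word of given length -/
def rep (M : ℕ) : List I := List.replicate M (Classical.arbitrary I)

lemma rep_length (M : ℕ) : (rep M : List I).length = M := List.length_replicate

/-- block coding -/
structure Cod (μ : Measure X) (BL : ℕ → X → List I) : Prop where
  len : ∀ M x, (BL M x).length = M
  pre : ∀ M M' x, M ≤ M' → ∃ l, BL M' x = BL M x ++ l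
  meas : ∀ M l, MeasurableSet {x | BL M x = l}
  mu : ∀ l : List I, μ {x | BL l.length x = l} = ENNReal.ofReal ((Fintype.card I : ℝ) ^ l.length)⁻¹

variable {BL : ℕ → X → List I}

lemma Cod.set_eq (C : Cod μ BL) (M : ℕ) (Q : List I → Prop) :
    {x | Q (BL M x)} = ⋃ l ∈ (Sp un (rep M)).filter Q, {x | BL M x = l} := by
  ext x
  simp only [mem_ofPred_eq, mem_iUnion, Finset.mem_filter, mem_Sp_un, rep_length]
  constructor
  · intro h; exact ⟨_, ⟨C.len M x, h⟩, rfl⟩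
  · rintro ⟨l, ⟨_, h⟩, rfl⟩; exact h

lemma Cod.ms (C : Cod μ BL) (M : ℕ) (Q : List I → Prop) : MeasurableSet {x | Q (BL M x)} := by
  rw [C.set_eq]
  exact Finset.measurableSet_biUnion _ fun l _ => C.meas M l

lemma Cod.mu_Ex (C : Cod μ BL) (M : ℕ) (Q : List I → Prop) :
    μ {x | Q (BL M x)} = ENNReal.ofReal (Ex un (rep M) (fun l => ind (Q l))) := by
  rw [C.set_eq, measure_biUnion_finset]
  · have h1 : ∀ l ∈ (Sp un (rep M)).filter Q, μ {x | BL M x = l} = ENNReal.ofReal ((Fintype.card I : ℝ) ^ M)⁻¹ := by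
      intro l hl
      have := mem_Sp_un.1 (Finset.mem_filter.1 hl).1
      rw [rep_length] at this
      rw [← this]; exact C.mu l
    rw [Finset.sum_congr rfl h1, Finset.sum_const, nsmul_eq_mul, Ex_repr, Sp_un_card, rep_length,
      ← ENNReal.ofReal_natCast, ← ENNReal.ofReal_mul (by positivity)]
    congr 1
    rw [← div_eq_mul_inv]
    push_cast
    congr 1
    rw [Finset.card_filter]
    push_cast
    rfl
  · intro l _ l' _ hll
    rw [Function.onFun, Set.disjoint_left]
    intro x h1 h2
    exact hll (h1.symm.trans h2)
  · intro l _; exact C.meas M l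

variable {c b : ℝ} {u v z : I → ℝ} {G : Finset I} {Z : ℕ} {a p : ℝ}

lemma Hyp.pt_close (H : Hyp c b u v z G Z a p) (l1 l2 : List I) :
    dist (pt c b u v z (l1 ++ l2)) (pt c b u v z l1) ≤ (Z + 1) * b ^ l1.length := by
  have hb0 := H.b0
  have hc0 := H.hc0
  have hp := pow_pos hb0 l1.length
  have hcb : c ^ l1.length ≤ b ^ l1.length := pow_le_pow_left₀ hc0.le H.hcb.le _
  have hU := H.hU l2
  have hV := H.hV l2
  have hZ0 : (0:ℝ) ≤ Z := by positivity
  rw [Prod.dist_eq, max_le_iff]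
  simp only [pt, Real.dist_eq, UU_append, VV_append hb0.ne', add_sub_cancel_left]
  constructor
  · rw [abs_mul, abs_of_pos (pow_pos hc0 _), abs_of_nonneg hU.1]
    have e1 : c ^ l1.length * UU c u l2 ≤ b ^ l1.length * 1 := mul_le_mul hcb hU.2 hU.1 hp.le
    have e2 : 0 ≤ Z * b ^ l1.length := by positivity
    linarith
  · rw [abs_mul, abs_of_pos hp, mul_comm]
    gcongr
    have e1 : |ZZ (c / b) z l1 * UU c u l2| ≤ Z * 1 := by
      rw [abs_mul]
      gcongr
      · exact H.hZ l1
      · rw [abs_of_nonneg hU.1]; exact hU.2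
    have e2 := abs_le.1 e1
    rw [abs_le]; constructor <;> linarith

theorem Hyp.frost (H : Hyp c b u v z G Z a p) [IsProbabilityMeasure μ] (C : Cod μ BL) {Pi : X → ℝ × ℝ}
    (hPi : ∀ x, Tendsto (fun M => pt c b u v z (BL M x)) atTop (𝓝 (Pi x)))
    {t κ : ℝ} (ht0 : 0 ≤ t) (hκ0 : 0 ≤ κ) (hκ1 : κ ≤ 1) (hκ : c ^ κ = c / b)
    (h1 : 2 * a ≤ b ^ t) (h2 : 2 * (a * p) ≤ c ^ t) (J : ℕ) {η δ ε : ℝ} (hη : 0 < η) 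
    (hJ : b ^ J ≤ c) (hcZ : c * (2 * Z + 3) ≤ 1) (hθ : ((a * p)⁻¹) ^ (J * J * δ) ≤ c ^ (-η))
    (hε : 0 < ε) (hε1 : ε ≤ 1) (hεδ : 8 ≤ (ε⁻¹) ^ δ) (hG : ((Gᶜ).card : ℝ) ≤ ε * Fintype.card I) :
    ∃ F : Set X, MeasurableSet F ∧ μ F ≠ 0 ∧ ∃ n0 : ℕ, ∀ n ≥ n0, ∀ x ∈ F,
      μ (F ∩ {x' | dist (Pi x) (Pi x') ≤ c ^ (n + 1)}) ≤ ENNReal.ofReal ((c ^ (t * (1 - κ ^ J) - 2 * η)) ^ n) := by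
  have hc0 := H.hc0
  have hc1 : c < 1 := H.hcb.trans H.hb1
  have ha0 := H.ha0
  have hp0 := H.hp0
  have hb0 := H.b0
  obtain ⟨K, hK1, hK⟩ := H.iter ht0 hκ0 hκ1 hκ h1 h2 J
  set s := t * (1 - κ ^ J) with hs
  set σ := s - 2 * η with hσ
  have hap : a * p ≤ 1 := by
    calc a * p ≤ 1 * 1 := by gcongr; exact H.ha1; exact H.hp1
      _ = 1 := by norm_num
  have hθ1 : 1 ≤ (a * p)⁻¹ := (one_le_inv₀ (by positivity)).2 hap
  have hJ1 : 1 ≤ J := by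
    rcases Nat.eq_zero_or_pos J with h | h
    · rw [h, pow_zero] at hJ; linarith
    · exact h
  set Mn : ℕ → ℕ := fun n => J * (n + 1) with hMn
  set y : ℕ → ℝ := fun n => (c ^ σ) ^ n with hy
  have hy0 : ∀ n, 0 < y n := fun n => pow_pos (Real.rpow_pos_of_pos hc0 _) _
  set Bn : ℕ → ℝ := fun n => K * (c ^ (-η)) ^ (n + 1) * (c ^ s) ^ n with hBn
  have hB0 : ∀ n, 0 ≤ Bn n := by
    intro n
    have e1 := Real.rpow_pos_of_pos hc0 (-η)
    have e2 := Real.rpow_pos_of_pos hc0 s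
    positivity
  have hBy : ∀ n, 9 * Bn n / y n = 9 * K * c ^ (-η) * (c ^ η) ^ n := by
    intro n
    have e0 : c ^ s = c ^ σ * (c ^ η * c ^ η) := by
      rw [← Real.rpow_add hc0, ← Real.rpow_add hc0]; congr 1; rw [hσ]; ring
    have e1 : c ^ (-η) * c ^ η = 1 := by rw [← Real.rpow_add hc0]; simp
    have e2 := hy0 n
    rw [div_eq_iff e2.ne']
    simp only [hBn, hy, e0]
    have e3 : (c ^ (-η)) ^ n * (c ^ η) ^ n = 1 := by rw [← mul_pow, e1, one_pow]
    rw [pow_succ, mul_pow, mul_pow]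
    linear_combination (9 * K * c ^ (-η) * (c ^ σ) ^ n * (c ^ η) ^ n) * e3
  -- the good condition
  set Q : ℕ → List I → Prop := fun n l => (bd G l : ℝ) ≤ δ * (Mn n : ℕ) ∧
      Ex un (rep (Mn n)) (fun l' => ind ((bd G l' : ℝ) ≤ δ * (Mn n : ℕ) ∧ dist (pt c b u v z l) (pt c b u v z l') ≤ c ^ n)) ≤ y n with hQ
  have hexc : ∀ n, μ {x | ¬ Q n (BL (Mn n) x)} ≤ ENNReal.ofReal ((1 / 4) ^ n + 9 * K * c ^ (-η) * (c ^ η) ^ n) := by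
    intro n
    rw [C.mu_Ex (Mn n) (fun l => ¬ Q n l)]
    apply ENNReal.ofReal_le_ofReal
    have e1 := exc_prob (c := c) (b := b) (u := u) (v := v) (z := z) (G := G) hε hε1 hεδ hG (rep (Mn n)) (pow_pos hc0 n) (hB0 n) (hy0 n) (by
      intro l hl hbd
      rw [rep_length] at hl hbd
      have e2 := hK n l (by rw [hl]; exact Nat.mul_le_mul_left J (by omega))
      refine e2.trans ?_
      have e3 : ((a * p)⁻¹) ^ (J * bd G l) ≤ (c ^ (-η)) ^ (n + 1) := by
        calc ((a * p)⁻¹) ^ (J * bd G l) = ((a * p)⁻¹) ^ ((J * bd G l : ℕ) : ℝ) := (Real.rpow_natCast _ _).symm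
          _ ≤ ((a * p)⁻¹) ^ ((J * J * δ) * ((n + 1 : ℕ) : ℝ)) := by
            apply Real.rpow_le_rpow_of_exponent_le hθ1
            have := mul_le_mul_of_nonneg_left hbd (Nat.cast_nonneg (α := ℝ) J)
            push_cast [hMn] at this ⊢
            linarith
          _ = (((a * p)⁻¹) ^ (J * J * δ)) ^ (n + 1) := by
            rw [Real.rpow_mul (by linarith), Real.rpow_natCast]
          _ ≤ _ := by gcongr
      have e4 := Real.rpow_pos_of_pos hc0 s
      simp only [hBn]
      gcongr)
    rw [rep_length, hBy] at e1
    refine e1.trans ?_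
    have : (1 / 4 : ℝ) ^ (Mn n) ≤ (1 / 4) ^ n := by
      apply pow_le_pow_of_le_one (by norm_num) (by norm_num)
      calc n ≤ 1 * (n + 1) := by omega
        _ ≤ J * (n + 1) := Nat.mul_le_mul_right _ hJ1
    linarith
  have hsum : ∑' n, μ {x | ¬ Q n (BL (Mn n) x)} ≠ ∞ := by
    have hcη : c ^ η < 1 := Real.rpow_lt_one hc0.le hc1 hη
    have : Summable (fun n : ℕ => (1 / 4 : ℝ) ^ n + 9 * K * c ^ (-η) * (c ^ η) ^ n) :=
      (summable_geometric_of_lt_one (by norm_num) (by norm_num)).add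
        ((summable_geometric_of_lt_one (Real.rpow_pos_of_pos hc0 _).le hcη).mul_left _)
    exact ne_top_of_le_ne_top this.tsum_ofReal_ne_top (ENNReal.tsum_le_tsum hexc)
  have htail := ENNReal.tendsto_sum_nat_add _ hsum
  obtain ⟨n0, hn0⟩ := (htail.eventually (gt_mem_nhds (show (0:ℝ≥0∞) < 1 by norm_num))).exists
  set F : Set X := ⋂ n, {x | Q (n + n0) (BL (Mn (n + n0)) x)} with hF
  have hFm : MeasurableSet F := MeasurableSet.iInter fun n => C.ms _ _
  refine ⟨F, hFm, ?_, n0, ?_⟩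
  · intro hF0
    have e1 : μ Fᶜ ≤ ∑' n, μ {x | ¬ Q (n + n0) (BL (Mn (n + n0)) x)} := by
      rw [hF, compl_iInter]
      exact measure_iUnion_le _
    have e2 : μ F + μ Fᶜ = 1 := by rw [measure_add_measure_compl hFm, measure_univ]
    rw [hF0, zero_add] at e2
    rw [e2] at e1
    exact absurd (e1.trans_lt hn0) (lt_irrefl _)
  · intro n hn x hx
    have hmem : ∀ x ∈ F, Q n (BL (Mn n) x) := by
      intro x hx
      have := mem_iInter.1 hx (n - n0)
      rw [Nat.sub_add_cancel hn] at this
      exact this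
    have hlim : ∀ x, dist (Pi x) (pt c b u v z (BL (Mn n) x)) ≤ (Z + 1) * c ^ (n + 1) := by
      intro x
      have e1 : Tendsto (fun M => dist (pt c b u v z (BL M x)) (pt c b u v z (BL (Mn n) x))) atTop (𝓝 (dist (Pi x) (pt c b u v z (BL (Mn n) x)))) :=
        (hPi x).dist tendsto_const_nhds
      apply le_of_tendsto e1
      filter_upwards [eventually_ge_atTop (Mn n)] with M hM
      obtain ⟨l, hl⟩ := C.pre (Mn n) M x hM
      rw [hl]
      refine (H.pt_close _ l).trans ?_
      rw [C.len]
      have : b ^ (Mn n) ≤ c ^ (n + 1) := by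
        rw [hMn, pow_mul]; gcongr
      gcongr
    calc μ (F ∩ {x' | dist (Pi x) (Pi x') ≤ c ^ (n + 1)})
        ≤ μ {x' | (fun l' => (bd G l' : ℝ) ≤ δ * (Mn n : ℕ) ∧ dist (pt c b u v z (BL (Mn n) x)) (pt c b u v z l') ≤ c ^ n) (BL (Mn n) x')} := by
          apply measure_mono
          rintro x' ⟨hx', hd⟩
          refine ⟨(hmem x' hx').1, ?_⟩
          have e1 := hlim x
          have e2 := hlim x'
          have hd' : dist (Pi x) (Pi x') ≤ c ^ (n + 1) := hd
          have e3 : dist (pt c b u v z (BL (Mn n) x)) (pt c b u v z (BL (Mn n) x')) ≤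
              dist (pt c b u v z (BL (Mn n) x)) (Pi x) + dist (Pi x) (Pi x') + dist (Pi x') (pt c b u v z (BL (Mn n) x')) := dist_triangle4 _ _ _ _
          rw [dist_comm _ (Pi x)] at e3
          have e4 : c ^ (n + 1) * (2 * Z + 3) ≤ c ^ n := by
            rw [pow_succ, mul_assoc]
            calc c ^ n * (c * (2 * Z + 3)) ≤ c ^ n * 1 := by gcongr
              _ = _ := mul_one _
          linarith
      _ = ENNReal.ofReal (Ex un (rep (Mn n)) (fun l' => ind ((bd G l' : ℝ) ≤ δ * (Mn n : ℕ) ∧ dist (pt c b u v z (BL (Mn n) x)) (pt c b u v z l') ≤ c ^ n))) :=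
          C.mu_Ex (Mn n) (fun l' => (bd G l' : ℝ) ≤ δ * (Mn n : ℕ) ∧ dist (pt c b u v z (BL (Mn n) x)) (pt c b u v z l') ≤ c ^ n)
      _ ≤ _ := ENNReal.ofReal_le_ofReal (hmem x hx).2

end msr
end SA

namespace SA
open scoped Classical

section dm
variable {X : Type} [MeasurableSpace X] {μ : Measure X}

theorem frost_dim [IsProbabilityMeasure μ] {Pi : X → ℝ × ℝ} (hPm : Measurable Pi) {F : Set X} (hF : MeasurableSet F) (hF0 : μ F ≠ 0)
    {c σ : ℝ} (hc0 : 0 < c) (hc1 : c < 1) (hσ : 0 < σ) (n0 : ℕ)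
    (h : ∀ n ≥ n0, ∀ x ∈ F, μ (F ∩ {x' | dist (Pi x) (Pi x') ≤ c ^ (n + 1)}) ≤ ENNReal.ofReal ((c ^ σ) ^ n))
    (A : Set (ℝ × ℝ)) (hA : μ.map Pi Aᶜ = 0) : ENNReal.ofReal σ ≤ dimH A := by
  set m := (μ.restrict F).map Pi with hm
  have hcs0 : 0 < c ^ σ := Real.rpow_pos_of_pos hc0 _
  have hcs1 : c ^ σ < 1 := Real.rpow_lt_one hc0.le hc1 hσ
  have hmU : ∀ n ≥ n0, ∀ U : Set (ℝ × ℝ), Metric.ediam U ≤ ENNReal.ofReal (c ^ (n + 1)) → m U ≤ ENNReal.ofReal ((c ^ σ) ^ n) := by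
    intro n hn U hU
    refine (measure_mono subset_closure).trans ?_
    rw [hm, Measure.map_apply hPm isClosed_closure.measurableSet, Measure.restrict_apply (hPm isClosed_closure.measurableSet)]
    rcases Set.eq_empty_or_nonempty (Pi ⁻¹' closure U ∩ F) with h0 | ⟨x, hx1, hx2⟩
    · rw [h0]; simp
    · refine le_trans (measure_mono ?_) (h n hn x hx2)
      rintro x' ⟨h1, h2⟩
      refine ⟨h2, ?_⟩
      have h3 : edist (Pi x) (Pi x') ≤ Metric.ediam (closure U) := Metric.edist_le_ediam_of_mem hx1 h1
      rw [Metric.ediam_closure] at h3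
      have h4 := h3.trans hU
      rw [edist_dist] at h4
      exact (ENNReal.ofReal_le_ofReal_iff (by positivity)).1 h4
  set k : ℝ≥0∞ := ENNReal.ofReal ((c ^ σ) ^ 2) with hk
  have hle : k • m ≤ Measure.hausdorffMeasure σ := by
    apply Measure.le_hausdorffMeasure σ _ (ENNReal.ofReal (c ^ (n0 + 1))) (by simp; positivity)
    intro U hU
    rw [Measure.smul_apply, smul_eq_mul]
    have hfin : Metric.ediam U ≠ ∞ := ne_top_of_le_ne_top ENNReal.ofReal_ne_top hU
    set r := (Metric.ediam U).toReal with hr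
    have hre : Metric.ediam U = ENNReal.ofReal r := (ENNReal.ofReal_toReal hfin).symm
    have hr0 : 0 ≤ r := ENNReal.toReal_nonneg
    rcases hr0.eq_or_lt with h0 | h0
    · have : m U = 0 := by
        have h1 : ∀ n ≥ n0, m U ≤ ENNReal.ofReal ((c ^ σ) ^ n) := by
          intro n hn
          apply hmU n hn
          rw [hre, ← h0]
          simp
        have h2 : Tendsto (fun n : ℕ => ENNReal.ofReal ((c ^ σ) ^ n)) atTop (𝓝 (ENNReal.ofReal 0)) :=
          ENNReal.tendsto_ofReal (tendsto_pow_atTop_nhds_zero_of_lt_one hcs0.le hcs1)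
        rw [ENNReal.ofReal_zero] at h2
        have := ge_of_tendsto h2 (by filter_upwards [eventually_ge_atTop n0] with n hn using h1 n hn)
        exact le_antisymm this (zero_le)
      rw [this, mul_zero]; exact zero_le
    · have hrn : r ≤ c ^ (n0 + 1) := by
        rw [hre] at hU
        exact (ENNReal.ofReal_le_ofReal_iff (by positivity)).1 hU
      -- choose the scale
      have hex : ∃ n, c ^ (n + 2) < r := by
        obtain ⟨n, hn⟩ := exists_pow_lt_of_lt_one h0 hc1
        exact ⟨n, lt_of_le_of_lt (pow_le_pow_of_le_one hc0.le hc1.le (by omega)) hn⟩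
      set n := Nat.find hex with hn
      have hn1 : c ^ (n + 2) < r := Nat.find_spec hex
      have hn0 : n0 ≤ n := by
        by_contra hlt
        have : c ^ (n0 + 1) ≤ c ^ (n + 2) := pow_le_pow_of_le_one hc0.le hc1.le (by omega)
        linarith
      have hn2 : r ≤ c ^ (n + 1) := by
        rcases Nat.eq_zero_or_pos n with h5 | h5
        · have : n0 = 0 := by omega
          rw [h5]; rw [this] at hrn; exact hrn
        · have := Nat.find_min hex (m := n - 1) (by omega)
          rw [show n - 1 + 2 = n + 1 by omega] at this
          exact not_lt.1 this
      have h6 := hmU n hn0 U (by rw [hre]; exact ENNReal.ofReal_le_ofReal hn2)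
      calc k * m U ≤ k * ENNReal.ofReal ((c ^ σ) ^ n) := by gcongr
        _ = ENNReal.ofReal ((c ^ σ) ^ (n + 2)) := by
          rw [hk, ← ENNReal.ofReal_mul (by positivity), ← pow_add, add_comm]
        _ ≤ ENNReal.ofReal (r ^ σ) := by
          apply ENNReal.ofReal_le_ofReal
          rw [← Real.rpow_natCast, ← Real.rpow_mul hc0.le, mul_comm, Real.rpow_mul hc0.le, Real.rpow_natCast]
          exact Real.rpow_le_rpow (by positivity) hn1.le hσ.le
        _ = _ := by rw [hre, ENNReal.ofReal_rpow_of_pos h0]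
  have hmA : m A ≠ 0 := by
    intro h0
    have h1 : m Aᶜ = 0 := by
      have : m ≤ μ.map Pi := Measure.map_mono Measure.restrict_le_self hPm
      exact le_antisymm ((this Aᶜ).trans hA.le) zero_le
    have h2 : m univ ≤ 0 := by
      rw [← union_compl_self A]
      refine (measure_union_le _ _).trans ?_
      rw [h0, h1]; simp
    rw [hm, Measure.map_apply hPm MeasurableSet.univ] at h2
    simp at h2
    exact hF0 h2
  have hH : Measure.hausdorffMeasure ((σ.toNNReal : NNReal) : ℝ) A ≠ 0 := by
    rw [Real.coe_toNNReal _ hσ.le]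
    intro h0
    have := hle A
    rw [h0, Measure.smul_apply, smul_eq_mul] at this
    have h3 : k * m A = 0 := le_antisymm this zero_le
    rcases mul_eq_zero.1 h3 with h4 | h4
    · rw [hk, ENNReal.ofReal_eq_zero] at h4
      have : 0 < (c ^ σ) ^ 2 := by positivity
      linarith
    · exact hmA h4
  exact le_dimH_of_hausdorffMeasure_ne_zero hH

end dm
end SA

namespace SA
open scoped Classical

section blocks
variable {N L : ℕ}

/-- blocks of length L of an infinite word -/
def BLK (N L M : ℕ) (x : ℕ → Fin N) : List (Fin L → Fin N) :=
  List.ofFn (fun j : Fin M => (fun i : Fin L => x (j * L + i)))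

/-- concatenation of blocks -/
def flat (l : List (Fin L → Fin N)) : List (Fin N) := l.flatMap (fun w => List.ofFn w)

lemma flat_BLK (M : ℕ) (x : ℕ → Fin N) : flat (BLK N L M x) = prefixWord x (M * L) := by
  unfold flat BLK prefixWord
  rw [List.ofFn_mul, List.flatMap_def, List.map_ofFn]
  rfl

lemma flat_cons (w : Fin L → Fin N) (l : List (Fin L → Fin N)) : flat (w :: l) = List.ofFn w ++ flat l := by
  simp [flat]

lemma flat_length (l : List (Fin L → Fin N)) : (flat l).length = L * l.length := by
  induction l with
  | nil => simp [flat]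
  | cons w l ih => rw [flat_cons, List.length_append, ih]; simp; ring

variable (c b : ℝ) (u v z : Fin N → ℝ)

/-- block parameters -/
def uB (L : ℕ) (w : Fin L → Fin N) : ℝ := UU c u (List.ofFn w)
def vB (L : ℕ) (w : Fin L → Fin N) : ℝ := VV c b u v z (List.ofFn w)
def zB (L : ℕ) (w : Fin L → Fin N) : ℝ := ZZ (c / b) z (List.ofFn w)

lemma UU_flat (l : List (Fin L → Fin N)) : UU (c ^ L) (uB c u L) l = UU c u (flat l) := by
  induction l with
  | nil => simp [flat, UU]
  | cons w l ih => rw [flat_cons, UU_append, ← ih, List.length_ofFn, UU, uB]; ring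

lemma ZZ_flat (l : List (Fin L → Fin N)) : ZZ (c ^ L / b ^ L) (zB c b z L) l = ZZ (c / b) z (flat l) := by
  induction l with
  | nil => simp [flat, ZZ]
  | cons w l ih => rw [flat_cons, ZZ_append, ← ih, flat_length, ZZ, zB, pow_mul (c / b), div_pow c b L]

lemma VV_flat (hb : b ≠ 0) (l : List (Fin L → Fin N)) :
    VV (c ^ L) (b ^ L) (uB c u L) (vB c b u v z L) (zB c b z L) l = VV c b u v z (flat l) := by
  induction l with
  | nil => simp [flat, VV]
  | cons w l ih => rw [flat_cons, VV_append hb, ← ih, List.length_ofFn, VV, vB, zB, UU_flat]; ring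

lemma pt_flat (hb : b ≠ 0) (l : List (Fin L → Fin N)) :
    pt (c ^ L) (b ^ L) (uB c u L) (vB c b u v z L) (zB c b z L) l = pt c b u v z (flat l) := by
  unfold pt; rw [UU_flat, VV_flat c b u v z hb]

lemma Sword_pt (hb : b ≠ 0) (d : Fin N → ℝ) (l : List (Fin N)) :
    Sword c b u v d l 0 = pt c b u v (fun i => -(d i / b)) l := by
  induction l with
  | nil => rfl
  | cons i l ih =>
    simp only [Sword, Function.comp, ih, Smap, pt, UU, VV]
    ext
    · rfl
    · simp only
      field_simp

lemma Sword_mem {d : Fin N → ℝ} (hmaps : ∀ i, Smap c b u v d i '' unitSq ⊆ unitSq) (l : List (Fin N)) :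
    Sword c b u v d l 0 ∈ unitSq := by
  induction l with
  | nil => exact ⟨by simp [Sword], by simp [Sword]⟩
  | cons i l ih => exact hmaps i ⟨_, ih, rfl⟩

lemma uB_XX (w : Fin L → Fin N) : uB c u L w = XX c u L w := by
  unfold uB XX
  induction L with
  | zero => simp [UU]
  | succ L ih =>
    rw [List.ofFn_succ, UU, ih, Fin.sum_univ_succ, Finset.mul_sum]
    simp only [Fin.val_zero, pow_zero, one_mul, Fin.val_succ, pow_succ]
    rw [add_comm]
    congr 1
    apply Finset.sum_congr rfl
    intro i _
    ring

lemma ZZ_ofFn (τ : ℝ) (w : Fin L → Fin N) : ZZ τ z (List.ofFn w) = XX τ z L (w ∘ Fin.rev) := by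
  unfold XX
  induction L with
  | zero => simp [ZZ]
  | succ L ih =>
    rw [List.ofFn_succ, ZZ, ih, Fin.sum_univ_castSucc, add_comm, List.length_ofFn]
    congr 1
    · apply Finset.sum_congr rfl
      intro i _
      simp [Function.comp, Fin.rev_castSucc]
    · simp [Function.comp]

lemma ZZ_bound {τ : ℝ} (h0 : 0 < τ) (h1 : τ < 1) : ∃ Z : ℕ, 1 ≤ Z ∧ ∀ l, |ZZ τ z l| ≤ Z := by
  obtain ⟨m, hm⟩ : ∃ m : ℝ, ∀ i, |z i| ≤ m := by
    obtain ⟨m, hm⟩ := (Set.finite_range (fun i => |z i|)).bddAbove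
    exact ⟨m, fun i => hm ⟨i, rfl⟩⟩
  set m' := max m 0
  have hm' : ∀ i, |z i| ≤ m' := fun i => (hm i).trans (le_max_left _ _)
  have hm0 : 0 ≤ m' := le_max_right _ _
  have key : ∀ l, |ZZ τ z l| ≤ m' / (1 - τ) * (1 - τ ^ l.length) := by
    intro l
    induction l with
    | nil => simp [ZZ]
    | cons i l ih =>
      have e1 : |τ ^ l.length * z i| ≤ τ ^ l.length * m' := by
        rw [abs_mul, abs_of_pos (pow_pos h0 _)]; gcongr; exact hm' i
      have e2 : m' / (1 - τ) * (1 - τ ^ (l.length + 1)) = τ ^ l.length * m' + m' / (1 - τ) * (1 - τ ^ l.length) := by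
        have : 1 - τ ≠ 0 := by linarith
        field_simp
        ring
      rw [ZZ, List.length_cons, e2]
      exact (abs_add_le _ _).trans (add_le_add e1 ih)
  obtain ⟨Z, hZ⟩ := exists_nat_ge (m' / (1 - τ))
  refine ⟨Z + 1, by omega, fun l => ?_⟩
  have e3 : m' / (1 - τ) * (1 - τ ^ l.length) ≤ m' / (1 - τ) * 1 := by
    have : 0 ≤ m' / (1 - τ) := div_nonneg hm0 (by linarith)
    have := pow_pos h0 l.length
    gcongr
    linarith
  push_cast
  linarith [key l]

/-- restriction to finitely many coordinates -/
def rst (N n : ℕ) (x : ℕ → Fin N) : Fin n → Fin N := fun k => x k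

lemma rst_meas (n : ℕ) : Measurable (rst N n) := measurable_pi_lambda _ fun _ => measurable_pi_apply _

lemma Sword_meas {α : Type*} [MeasurableSpace α] (n : ℕ) (g : List (Fin N) → α) : Measurable (fun x : ℕ → Fin N => g (prefixWord x n)) := by
  have : (fun x : ℕ → Fin N => g (prefixWord x n)) = (fun w : Fin n → Fin N => g (List.ofFn w)) ∘ rst N n := rfl
  rw [this]
  exact (measurable_of_countable _).comp (rst_meas n)

lemma Cod_BLK (hN : 2 ≤ N) (hL : 1 ≤ L) {μ : Measure (ℕ → Fin N)} (hμ : IsUniformBernoulli N μ) : Cod μ (BLK N L) where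
  len M x := by simp [BLK]
  pre M M' x h := by
    obtain ⟨k, rfl⟩ := Nat.exists_eq_add_of_le h
    refine ⟨List.ofFn (fun j : Fin k => (fun i : Fin L => x ((M + j) * L + i))), ?_⟩
    unfold BLK
    rw [List.ofFn_add]
    rfl
  meas M l := by
    have : {x : ℕ → Fin N | BLK N L M x = l} = rst N (M * L) ⁻¹' {w | List.ofFn (fun j : Fin M => (fun i : Fin L => w ⟨j * L + i, by
      have h1 := j.2; have h2 := i.2
      calc (j:ℕ) * L + i < j * L + L := by omega
        _ = (j + 1) * L := by ring
        _ ≤ M * L := Nat.mul_le_mul_right _ h1⟩)) = l} := rfl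
    rw [this]
    exact rst_meas _ (Set.toFinite _).measurableSet
  mu l := by
    set x0 : ℕ → Fin N := fun k => (l.getD (k / L) (fun _ => ⟨0, by omega⟩)) ⟨k % L, Nat.mod_lt _ (by omega)⟩ with hx0
    have e0 : BLK N L l.length x0 = l := by
      apply List.ext_getElem (by simp [BLK])
      intro j h1 h2
      simp only [BLK, List.getElem_ofFn]
      funext i
      simp only [hx0]
      have e1 : (j * L + i) / L = j := by
        rw [mul_comm, Nat.mul_add_div (by omega), Nat.div_eq_of_lt i.2, add_zero]
      have e2 : (j * L + i) % L = i := by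
        rw [mul_comm, Nat.mul_add_mod, Nat.mod_eq_of_lt i.2]
      simp only [e1, e2]
      rw [List.getD_eq_getElem _ _ h2]
    have e1 : {x : ℕ → Fin N | BLK N L l.length x = l} = {x | ∀ k : Fin (l.length * L), x (k:ℕ) = x0 k} := by
      ext x
      simp only [mem_ofPred_eq]
      constructor
      · intro h k
        have h3 : BLK N L l.length x = BLK N L l.length x0 := h.trans e0.symm
        have h4 := List.ofFn_injective h3
        have hk : (k:ℕ) / L < l.length := Nat.div_lt_of_lt_mul (k.2.trans_eq (mul_comm _ _))
        have h5 := congrFun (congrFun h4 ⟨k / L, hk⟩) ⟨k % L, Nat.mod_lt _ (by omega)⟩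
        simp only at h5
        rw [mul_comm, Nat.div_add_mod] at h5
        exact h5
      · intro h
        rw [← e0]
        have : (BLK N L l.length x0).length = l.length := by simp [BLK]
        rw [this]
        unfold BLK
        congr 1
        funext j i
        have h1 := j.2
        have h2 := i.2
        exact h ⟨j * L + i, by
          calc (j:ℕ) * L + i < j * L + L := by omega
            _ = (j + 1) * L := by ring
            _ ≤ l.length * L := Nat.mul_le_mul_right _ h1⟩
    rw [e1, hμ.2]
    have hN0 : (0:ℝ) < N := by positivity
    rw [ENNReal.ofReal_inv_of_pos (by simp; positivity), ENNReal.ofReal_pow (by positivity)]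
    simp only [Fintype.card_fun, Fintype.card_fin]
    rw [ENNReal.ofReal_natCast, one_div, ENNReal.inv_pow]
    push_cast
    rw [← ENNReal.inv_pow, ← ENNReal.inv_pow, ← pow_mul, mul_comm]

end blocks
end SA

namespace SA
open scoped Classical

section endgame
variable {N : ℕ} {c b : ℝ} {u v d : Fin N → ℝ}

lemma ev_exp (C : ℝ) {x : ℝ} (hx : 0 < x) : ∀ᶠ L : ℕ in atTop, C ≤ Real.exp (L * x) := by
  have h1 : Tendsto (fun L : ℕ => (L:ℝ) * x) atTop atTop :=
    tendsto_natCast_atTop_atTop.atTop_mul_const hx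
  exact (Real.tendsto_exp_atTop.comp h1).eventually_ge_atTop C

lemma ev_pow {x y : ℝ} (h0 : 0 < x) (h1 : x < 1) (hy : 0 < y) : ∀ᶠ L : ℕ in atTop, x ^ L ≤ y := by
  have := tendsto_pow_atTop_nhds_zero_of_lt_one h0.le h1
  filter_upwards [this.eventually (gt_mem_nhds hy)] with L hL using hL.le

theorem blockHyp (hN : 2 ≤ N) (hb1 : b < 1) (hc0 : 0 < c)
    (hmaps : ∀ i, Smap c b u v d i '' unitSq ⊆ unitSq)
    (hC1 : c < 1 / (N : ℝ)) (hC2 : c < b)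
    (hC3 : HochmanESC N (fun _ => c / b) (fun i => -(d i / b)))
    (hC4 : HochmanESC N (fun _ => c) u) {t : ℝ}
    (ht1 : t * (-Real.log b) < Real.log N)
    (ht2 : t * (-Real.log c) < Real.log N + min (Real.log N) (Real.log (b / c))) {ε0 : ℝ} (hε0 : 0 < ε0) :
    ∃ (Z L : ℕ) (G : Finset (Fin L → Fin N)) (a p : ℝ), 1 ≤ L ∧
      Hyp (c ^ L) (b ^ L) (uB c u L) (vB c b u v (fun i => -(d i / b)) L) (zB c b (fun i => -(d i / b)) L) G Z a p ∧
      2 * a ≤ (b ^ L) ^ t ∧ 2 * (a * p) ≤ (c ^ L) ^ t ∧ (a * p)⁻¹ ≤ Real.exp (2 * L * Real.log N) ∧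
      ((Gᶜ).card : ℝ) ≤ ε0 * Fintype.card (Fin L → Fin N) ∧ c ^ L * (2 * Z + 3) ≤ 1 := by
  haveI : NeZero N := ⟨by omega⟩
  have hb0 : 0 < b := hc0.trans hC2
  have hc1 : c < 1 := hC2.trans hb1
  have hτ0 : 0 < c / b := div_pos hc0 hb0
  have hτ1 : c / b < 1 := (div_lt_one hb0).2 hC2
  have hN0 : (0:ℝ) < N := by positivity
  set A := Real.log N with hA
  have hA0 : 0 < A := Real.log_pos (by exact_mod_cast hN)
  have hlogτ : -Real.log (c / b) = Real.log (b / c) := by rw [← Real.log_inv, inv_div]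
  set hB := min A (Real.log (b / c)) with hhB
  have hB0 : 0 < hB := lt_min hA0 (Real.log_pos ((one_lt_div hc0).2 hC2))
  have hminH : min A (-Real.log c) = A := by
    apply min_eq_left
    have : Real.log c ≤ Real.log (1 / N) := Real.log_le_log hc0 hC1.le
    rw [one_div, Real.log_inv] at this
    linarith
  set z : Fin N → ℝ := fun i => -(d i / b) with hz
  obtain ⟨Z, hZ1, hZ⟩ := ZZ_bound z hτ0 hτ1
  set γ := min (A - t * (-Real.log b)) (A + hB - t * (-Real.log c)) with hγ
  have hγ0 : 0 < γ := lt_min (by linarith) (by linarith)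
  have hγ1 : γ ≤ A - t * (-Real.log b) := min_le_left _ _
  have hγ2 : γ ≤ A + hB - t * (-Real.log c) := min_le_right _ _
  obtain ⟨ε, hε, hεγ, hε4, hεε, hεA, hεB⟩ : ∃ ε : ℝ, 0 < ε ∧ ε ≤ γ / 4 ∧ ε ≤ 1 / 4 ∧ ε ≤ ε0 / 2 ∧ ε ≤ A / 2 ∧ ε ≤ hB / 2 := by
    refine ⟨min (γ / 4) (min (1 / 4) (min (ε0 / 2) (min (A / 2) (hB / 2)))), ?_, ?_, ?_, ?_, ?_, ?_⟩
    · refine lt_min (by linarith) (lt_min (by norm_num) (lt_min (by linarith) (lt_min (by linarith) (by linarith))))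
    · exact min_le_left _ _
    · exact (min_le_right _ _).trans (min_le_left _ _)
    · exact (min_le_right _ _).trans ((min_le_right _ _).trans (min_le_left _ _))
    · exact (min_le_right _ _).trans ((min_le_right _ _).trans ((min_le_right _ _).trans (min_le_left _ _)))
    · exact (min_le_right _ _).trans ((min_le_right _ _).trans ((min_le_right _ _).trans (min_le_right _ _)))
  obtain ⟨L1, hL1⟩ := hochman_out hN hc0 hc1 u hC4 hε
  obtain ⟨L2, hL2⟩ := hochman_out hN hτ0 hτ1 z hC3 hε
  set q : ℝ := 4 * (2 * Z + 2) with hq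
  have hZ0 : (1:ℝ) ≤ Z := by exact_mod_cast hZ1
  have hq0 : 1 ≤ q := by rw [hq]; linarith
  obtain ⟨L, hLL1, hLL2, hLge, g1, g2, g3, g4, g5, g6⟩ := ((eventually_ge_atTop L1).and ((eventually_ge_atTop L2).and ((eventually_ge_atTop 1).and
    ((ev_exp 12 (half_pos hA0)).and ((ev_exp q (half_pos hB0)).and ((ev_exp 24 (half_pos hγ0)).and ((ev_exp (24 * q) (half_pos hγ0)).and
      ((ev_pow hτ0 hτ1 (show (0:ℝ) < 1 / 2 by norm_num)).and (ev_pow hc0 hc1 (show (0:ℝ) < 1 / (2 * Z + 3) by positivity)))))))))).exists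
  obtain ⟨GH, hGH1, hGH2⟩ := hL1 L hLL1
  obtain ⟨GB, hGB1, hGB2⟩ := hL2 L hLL2
  rw [hminH] at hGH2
  rw [hlogτ, ← hhB] at hGB2
  have hL0 : (0:ℝ) < L := by exact_mod_cast hLge
  set rv : (Fin L → Fin N) → (Fin L → Fin N) := fun w => w ∘ Fin.rev with hrv
  have hrvi : Function.Injective rv := by
    intro w w' h
    funext i
    have := congrFun h (Fin.rev i)
    simpa [hrv] using this
  set GB' : Finset (Fin L → Fin N) := Finset.univ.filter (fun w => rv w ∈ GB) with hGB'
  set G := GH ∩ GB' with hG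
  have hcard : (Fintype.card (Fin L → Fin N) : ℝ) = (N:ℝ) ^ L := by simp
  have hGc : ((Gᶜ).card : ℝ) ≤ 2 * ε * (N:ℝ) ^ L := by
    have e1 : (GB'ᶜ).card ≤ (GBᶜ).card := by
      apply Finset.card_le_card_of_injOn rv
      · intro w hw
        simpa [hGB'] using hw
      · exact hrvi.injOn
    have e2 : (Gᶜ).card ≤ (GHᶜ).card + (GB'ᶜ).card := by
      rw [hG, Finset.compl_inter]
      exact Finset.card_union_le _ _
    have e3 : ((Gᶜ).card : ℝ) ≤ (GHᶜ).card + (GBᶜ).card := by exact_mod_cast e2.trans (by omega)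
    linarith
  have hNL : (0:ℝ) < (N:ℝ) ^ L := by positivity
  have hGcard : (N:ℝ) ^ L ≤ 2 * G.card := by
    have e1 : (G.card : ℝ) + (Gᶜ).card = (N:ℝ) ^ L := by
      rw [← hcard]; exact_mod_cast Finset.card_add_card_compl G
    have e2 : 2 * ε * (N:ℝ) ^ L ≤ 1 / 2 * (N:ℝ) ^ L := by gcongr; linarith
    linarith
  set a := 12 * Real.exp (-(L * (A - ε))) with ha
  set p := q * Real.exp (-(L * (hB - ε))) with hp
  have ha0 : 0 < a := by positivity
  have hp0 : 0 < p := by positivity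
  have hap : a * p = 12 * q * Real.exp (-(L * (A + hB - 2 * ε))) := by
    rw [ha, hp]
    rw [show -(L * (A + hB - 2 * ε)) = -(L * (A - ε)) + -(L * (hB - ε)) by ring, Real.exp_add]; ring
  have expmul : ∀ C x y : ℝ, C ≤ Real.exp y → C * Real.exp (-x) ≤ Real.exp (y - x) := by
    intro C x y h
    rw [sub_eq_add_neg, Real.exp_add]; gcongr
  have hXu : ∀ w, uB c u L w = XX c u L w := uB_XX c u
  have hXz : ∀ w, zB c b z L w = XX (c / b) z L (rv w) := fun w => ZZ_ofFn z (c / b) w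
  have rpw : ∀ x : ℝ, 0 < x → (x ^ L) ^ t = Real.exp (-(L * (t * (-Real.log x)))) := by
    intro x hx
    rw [Real.rpow_def_of_pos (pow_pos hx _), Real.log_pow]; congr 1; ring
  refine ⟨Z, L, G, a, p, hLge, ?_, ?_, ?_, ?_, ?_, ?_⟩
  · constructor
    · positivity
    · exact pow_lt_pow_left₀ hC2 hc0.le (by omega)
    · exact pow_lt_one₀ hb0.le hb1 (by omega)
    · rw [← div_pow]; exact g5
    · intro l
      rw [UU_flat]
      have := (Sword_mem c b u v hmaps (flat l))
      rw [Sword_pt c b u v hb0.ne'] at this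
      exact ⟨this.1.1, this.1.2⟩
    · intro l
      rw [VV_flat c b u v z hb0.ne']
      have := (Sword_mem c b u v hmaps (flat l))
      rw [Sword_pt c b u v hb0.ne'] at this
      exact ⟨this.2.1, this.2.2⟩
    · exact hZ1
    · intro l; rw [ZZ_flat]; exact hZ _
    · exact ha0
    · have e1 := expmul 12 (L * (A - ε)) (L * (A / 2)) g1
      refine e1.trans ?_
      rw [← Real.exp_zero]
      apply Real.exp_le_exp.2
      have := mul_le_mul_of_nonneg_left hεA hL0.le
      linarith
    · exact hp0
    · have e1 := expmul q (L * (hB - ε)) (L * (hB / 2)) g2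
      refine e1.trans ?_
      rw [← Real.exp_zero]
      apply Real.exp_le_exp.2
      have := mul_le_mul_of_nonneg_left hεB hL0.le
      linarith
    · intro x
      have e1 := hGH2 x
      have e2 : (G.filter (fun i => x ≤ uB c u L i ∧ uB c u L i ≤ x + c ^ L)).card ≤
          (GH.filter (fun w => x ≤ XX c u L w ∧ XX c u L w ≤ x + c ^ L)).card := by
        apply Finset.card_le_card
        intro w hw
        simp only [Finset.mem_filter, hXu] at hw ⊢
        exact ⟨(Finset.mem_inter.1 hw.1).1, hw.2⟩
      have e3 : ((G.filter (fun i => x ≤ uB c u L i ∧ uB c u L i ≤ x + c ^ L)).card : ℝ) ≤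
          (GH.filter (fun w => x ≤ XX c u L w ∧ XX c u L w ≤ x + c ^ L)).card := by exact_mod_cast e2
      refine e3.trans (e1.trans ?_)
      have e4 := mul_le_mul_of_nonneg_right hGcard (Real.exp_pos (-(L * (A - ε)))).le
      rw [ha]
      linarith
    · intro x
      have e1 := hGB2 x
      have e2 : (G.filter (fun i => x ≤ zB c b z L i ∧ zB c b z L i ≤ x + c ^ L / b ^ L)).card ≤
          (GB.filter (fun w => x ≤ XX (c / b) z L w ∧ XX (c / b) z L w ≤ x + (c / b) ^ L)).card := by
        apply Finset.card_le_card_of_injOn rv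
        · intro w hw
          simp only [Finset.coe_filter, mem_ofPred_eq, hXz, ← div_pow] at hw ⊢
          refine ⟨?_, hw.2⟩
          have := (Finset.mem_inter.1 hw.1).2
          rw [hGB', Finset.mem_filter] at this
          exact this.2
        · exact hrvi.injOn
      have e3 : ((G.filter (fun i => x ≤ zB c b z L i ∧ zB c b z L i ≤ x + c ^ L / b ^ L)).card : ℝ) ≤
          (GB.filter (fun w => x ≤ XX (c / b) z L w ∧ XX (c / b) z L w ≤ x + (c / b) ^ L)).card := by exact_mod_cast e2
      refine e3.trans (e1.trans ?_)
      have e4 := mul_le_mul_of_nonneg_right hGcard (Real.exp_pos (-(L * (hB - ε)))).le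
      have e5 : p / (2 * Z + 2) = 4 * Real.exp (-(L * (hB - ε))) := by
        rw [hp, hq]; field_simp
      rw [e5]
      linarith
  · rw [rpw b hb0, ha]
    have e1 := expmul 24 (L * (A - ε)) (L * (γ / 2)) g3
    have e2 : Real.exp (L * (γ / 2) - L * (A - ε)) ≤ Real.exp (-(L * (t * (-Real.log b)))) := by
      apply Real.exp_le_exp.2
      have h3 := mul_le_mul_of_nonneg_left hγ1 hL0.le
      have h4 := mul_le_mul_of_nonneg_left hεγ hL0.le
      have h5 := mul_pos hL0 hγ0
      linarith
    linarith
  · rw [rpw c hc0, hap]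
    have e1 := expmul (24 * q) (L * (A + hB - 2 * ε)) (L * (γ / 2)) g4
    have e2 : Real.exp (L * (γ / 2) - L * (A + hB - 2 * ε)) ≤ Real.exp (-(L * (t * (-Real.log c)))) := by
      apply Real.exp_le_exp.2
      have h3 := mul_le_mul_of_nonneg_left hγ2 hL0.le
      have h4 := mul_le_mul_of_nonneg_left hεγ hL0.le
      have h5 := mul_pos hL0 hγ0
      linarith
    linarith
  · have e1 : Real.exp (-(2 * L * A)) ≤ a * p := by
      rw [hap]
      have e2 : Real.exp (-(2 * L * A)) ≤ Real.exp (-(L * (A + hB - 2 * ε))) := by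
        apply Real.exp_le_exp.2
        have h3 := mul_le_mul_of_nonneg_left (min_le_left A (Real.log (b / c))) hL0.le
        have h4 := mul_pos hL0 hε
        linarith
      have e3 := Real.exp_pos (-(L * (A + hB - 2 * ε)))
      have e4 : 1 * Real.exp (-(L * (A + hB - 2 * ε))) ≤ 12 * q * Real.exp (-(L * (A + hB - 2 * ε))) := by
        gcongr; linarith
      linarith
    rw [inv_le_comm₀ (by positivity) (Real.exp_pos _), ← Real.exp_neg]
    exact e1
  · rw [hcard]
    refine hGc.trans ?_
    gcongr
    linarith
  · rw [le_div_iff₀ (by positivity)] at g6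
    exact g6

theorem final_lt (hN : 2 ≤ N) (hb1 : b < 1) (hc0 : 0 < c)
    (hmaps : ∀ i, Smap c b u v d i '' unitSq ⊆ unitSq)
    (Pi : (ℕ → Fin N) → ℝ × ℝ)
    (hPi : ∀ i, Tendsto (fun n => Sword c b u v d (prefixWord i n) 0) atTop (nhds (Pi i)))
    (μ : Measure (ℕ → Fin N)) (hμ : IsUniformBernoulli N μ)
    (hC1 : c < 1 / (N : ℝ)) (hC2 : c < b)
    (hC3 : HochmanESC N (fun _ => c / b) (fun i => -(d i / b)))
    (hC4 : HochmanESC N (fun _ => c) u) {s t : ℝ} (hs : 0 < s) (hst : s < t)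
    (ht1 : t * (-Real.log b) < Real.log N)
    (ht2 : t * (-Real.log c) < Real.log N + min (Real.log N) (Real.log (b / c)))
    (A : Set (ℝ × ℝ)) (hA : μ.map Pi Aᶜ = 0) : ENNReal.ofReal s ≤ dimH A := by
  haveI := hμ.1
  haveI : NeZero N := ⟨by omega⟩
  have hb0 : 0 < b := hc0.trans hC2
  have hc1 : c < 1 := hC2.trans hb1
  have hτ0 : 0 < c / b := div_pos hc0 hb0
  have hlogc : Real.log c < 0 := Real.log_neg hc0 hc1
  have hlogb : Real.log b < 0 := Real.log_neg hb0 hb1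
  have hlogN : 0 < Real.log N := Real.log_pos (by exact_mod_cast hN)
  have hlogτ : Real.log (c / b) = Real.log c - Real.log b := Real.log_div hc0.ne' hb0.ne'
  have hlogcb : Real.log c < Real.log b := Real.log_lt_log hc0 hC2
  set κ := Real.log (c / b) / Real.log c with hκd
  have hκ0 : 0 ≤ κ := div_nonneg_of_nonpos (by linarith) hlogc.le
  have hκ1 : κ < 1 := by rw [hκd, div_lt_one_of_neg hlogc]; linarith
  have ht0 : 0 < t := hs.trans hst
  set η := (t - s) / 3 with hη
  have hη0 : 0 < η := by rw [hη]; linarith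
  obtain ⟨J, hJ1, hJ2⟩ : ∃ J : ℕ, κ ^ J ≤ η / t ∧ b ^ J ≤ c := by
    have e1 := tendsto_pow_atTop_nhds_zero_of_lt_one hκ0 hκ1
    exact ((e1.eventually (ge_mem_nhds (div_pos hη0 ht0))).and (ev_pow hb0 hb1 hc0)).exists
  have hJ1' : t * κ ^ J ≤ η := by rw [le_div_iff₀ ht0] at hJ1; linarith
  -- δ
  obtain ⟨δ, hδ0, hδ⟩ : ∃ δ : ℝ, 0 < δ ∧ 2 * (J * J * δ) * Real.log N ≤ η * (-Real.log c) := by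
    have e1 : 0 < 2 * (J * J + 1 : ℝ) * Real.log N := by positivity
    have e2 : 0 < η * (-Real.log c) := mul_pos hη0 (by linarith)
    refine ⟨η * (-Real.log c) / (2 * (J * J + 1 : ℝ) * Real.log N), div_pos e2 e1, ?_⟩
    set δ := η * (-Real.log c) / (2 * (J * J + 1 : ℝ) * Real.log N) with hd
    have e3 : δ * (2 * (J * J + 1 : ℝ) * Real.log N) = η * (-Real.log c) := div_mul_cancel₀ _ e1.ne'
    have e4 : 0 ≤ 2 * δ * Real.log N := by have := div_pos e2 e1; positivity
    linarith
  -- ε0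
  set ε0 : ℝ := ((8:ℝ) ^ (1 / δ))⁻¹ with hε0
  have h8 : 1 ≤ (8:ℝ) ^ (1 / δ) := Real.one_le_rpow (by norm_num) (by positivity)
  have hε00 : 0 < ε0 := by positivity
  have hε01 : ε0 ≤ 1 := inv_le_one_of_one_le₀ h8
  have hεδ : 8 ≤ (ε0⁻¹) ^ δ := by
    rw [hε0, inv_inv, ← Real.rpow_mul (by norm_num), one_div, inv_mul_cancel₀ hδ0.ne', Real.rpow_one]
  obtain ⟨Z, L, G, a, p, hL, H, k1, k2, k3, k4, k5⟩ := blockHyp hN hb1 hc0 hmaps hC1 hC2 hC3 hC4 ht1 ht2 hε00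
  have hL0 : (0:ℝ) < L := by exact_mod_cast hL
  have hcL : 0 < c ^ L := pow_pos hc0 L
  have hC := Cod_BLK hN hL hμ
  have hPi' : ∀ x, Tendsto (fun M => pt (c ^ L) (b ^ L) (uB c u L) (vB c b u v (fun i => -(d i / b)) L) (zB c b (fun i => -(d i / b)) L) (BLK N L M x)) atTop (𝓝 (Pi x)) := by
    intro x
    have e1 : Tendsto (fun M : ℕ => M * L) atTop atTop := tendsto_id.atTop_mul_const' (by omega)
    refine ((hPi x).comp e1).congr ?_
    intro M
    simp only [Function.comp]
    rw [pt_flat c b u v _ hb0.ne', flat_BLK, Sword_pt c b u v hb0.ne']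
  have hκL : (c ^ L) ^ κ = c ^ L / b ^ L := by
    rw [← div_pow, Real.rpow_def_of_pos hcL, Real.log_pow, ← Real.exp_log (pow_pos hτ0 L), Real.log_pow, hκd]
    congr 1
    field_simp
    rw [mul_div_cancel_left₀ _ hlogc.ne]
  have hθ : ((a * p)⁻¹) ^ (J * J * δ) ≤ (c ^ L) ^ (-η) := by
    have ha0 := H.ha0
    have hp0 := H.hp0
    have e0 : 0 ≤ J * J * δ := by positivity
    calc ((a * p)⁻¹) ^ (J * J * δ) ≤ (Real.exp (2 * L * Real.log N)) ^ (J * J * δ) := by gcongr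
      _ = Real.exp (L * (2 * (J * J * δ) * Real.log N)) := by rw [← Real.exp_mul]; congr 1; ring
      _ ≤ Real.exp (L * (η * (-Real.log c))) := by gcongr
      _ = _ := by rw [Real.rpow_def_of_pos hcL, Real.log_pow]; congr 1; ring
  have hbJ : (b ^ L) ^ J ≤ c ^ L := by
    rw [← pow_mul, mul_comm, pow_mul]; gcongr
  obtain ⟨F, hF1, hF2, n0, hF3⟩ := H.frost hC hPi' ht0.le hκ0 hκ1.le hκL k1 k2 J hη0 hbJ k5 hθ hε00 hε01 hεδ (by convert k4)
  have hPm : Measurable Pi := by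
    apply measurable_of_tendsto_metrizable (f := fun n x => Sword c b u v d (prefixWord x n) 0)
    · intro n
      exact Sword_meas n (fun l => Sword c b u v d l 0)
    · exact tendsto_pi_nhds.2 hPi
  have hσ : s ≤ t * (1 - κ ^ J) - 2 * η := by
    have : 3 * η = t - s := by rw [hη]; ring
    linarith
  refine (ENNReal.ofReal_le_ofReal hσ).trans ?_
  exact frost_dim hPm hF1 hF2 hcL (H.hcb.trans H.hb1) (hs.trans_le hσ) n0 hF3 A hA

end endgame
end SA

theorem statement14 (N : ℕ) (hN : 2 ≤ N) (b c : ℝ)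
    (hb0 : 0 < b) (hb1 : b < 1) (hc0 : 0 < c) (hc1 : c < 1)
    (u v d : Fin N → ℝ)
    (hmaps : ∀ i, Smap c b u v d i '' unitSq ⊆ unitSq)
    (Pi : (ℕ → Fin N) → ℝ × ℝ)
    (hPi : ∀ i, Tendsto (fun n => Sword c b u v d (prefixWord i n) 0) atTop (nhds (Pi i)))
    (μ : Measure (ℕ → Fin N)) (hμ : IsUniformBernoulli N μ)
    (ν : Measure (ℝ × ℝ)) (hν : ν = μ.map Pi)
    (hC1 : c < 1 / (N : ℝ)) (hC2 : c < b)
    (hC3 : HochmanESC N (fun _ => c / b) (fun i => -(d i / b)))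
    (hC4 : HochmanESC N (fun _ => c) u)
    (hC5 : min 1 (min (Real.log N / (-Real.log b))
        (2 * (1 - Real.log N / (-Real.log c)))) ≤ Real.log N / Real.log (b / c)) :
    ENNReal.ofReal (min (2 * Real.log N / (-Real.log c))
        (min (Real.log N / (-Real.log b))
          (1 + (Real.log N + Real.log b) / (-Real.log c)))) ≤
      measureDimH ν := by
  have hlogc : 0 < -Real.log c := by linarith [Real.log_neg hc0 hc1]
  have hlogb : 0 < -Real.log b := by linarith [Real.log_neg hb0 hb1]
  unfold measureDimH
  refine le_iInf fun A => le_iInf fun hA => ?_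
  rw [hν] at hA
  set T := min (2 * Real.log N / (-Real.log c))
        (min (Real.log N / (-Real.log b))
          (1 + (Real.log N + Real.log b) / (-Real.log c))) with hT
  have T1 : T ≤ 2 * Real.log N / (-Real.log c) := min_le_left _ _
  have T2 : T ≤ Real.log N / (-Real.log b) := (min_le_right _ _).trans (min_le_left _ _)
  have T3 : T ≤ 1 + (Real.log N + Real.log b) / (-Real.log c) := (min_le_right _ _).trans (min_le_right _ _)
  have T3' : 1 + (Real.log N + Real.log b) / (-Real.log c) = (Real.log N + Real.log (b / c)) / (-Real.log c) := by
    rw [Real.log_div hb0.ne' hc0.ne', eq_div_iff hlogc.ne', add_mul, div_mul_cancel₀ _ hlogc.ne']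
    ring
  rw [T3'] at T3
  rw [le_div_iff₀ hlogc] at T1 T3
  rw [le_div_iff₀ hlogb] at T2
  rcases le_or_gt T 0 with hT0 | hT0
  · rw [ENNReal.ofReal_of_nonpos hT0]; exact zero_le
  have key : ∀ s, 0 < s → s < T → ENNReal.ofReal s ≤ dimH A := by
    intro s hs hsT
    have ht : (s + T) / 2 < T := by linarith
    have e1 := mul_lt_mul_of_pos_right ht hlogb
    have e2 := mul_lt_mul_of_pos_right ht hlogc
    refine SA.final_lt hN hb1 hc0 hmaps Pi hPi μ hμ hC1 hC2 hC3 hC4 hs (t := (s + T) / 2) (by linarith) (by linarith) ?_ A hA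
    rcases min_choice (Real.log N) (Real.log (b / c)) with h | h <;> rw [h] <;> linarith
  have h1 : Tendsto (fun s : ℝ => ENNReal.ofReal s) (𝓝[<] T) (𝓝 (ENNReal.ofReal T)) :=
    (ENNReal.continuous_ofReal.tendsto T).mono_left nhdsWithin_le_nhds
  apply le_of_tendsto h1
  filter_upwards [Ioo_mem_nhdsLT hT0] with s hs using key s hs.1 hs.2

end
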